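/- arXiv:2311.17896 — 2 statements merged into one kernel-verified Lean document; each statement's English description precedes it below -/
import Mathlib

section
/- Let n ≥ 2 and let M = (c_{ij})_{0≤i,j≤n−1} be an n×n matrix over K = 𝔽_{q^n} such that the 𝔽_q-bilinear multiplication x ∘ y = Σ_{i,j} c_{ij} x^{qⁱ} y^{qʲ} on K has no zero divisors (i.e., x ∘ y = 0 implies x = 0 or y = 0, so it defines a finite semifield). Suppose moreover that q^{n(n−1)} > (n−1)(n−2)·q^{n(n−3/2)} + 5·n^{13/3}·q^{n(n−2)}, as an inequality of real numbers. Then there exists a nonzero tuple (x₀,…,x_{n−1}) ∈ Kⁿ with det(Σ_{j=0}^{n−1} xⱼ · M^{[σʲ]}) = 0, and moreover this tuple is not of the form (α, α^q, …, α^{q^{n−1}}) for any α ∈ K. (This is the key step proving that the BEL-rank of an n-dimensional finite semifield over 𝔽_q is at most n−1 for q large enough.) -/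
/-- The σ-twist of a matrix: `(M^[σ])_{i,j} = (M_{i-1,j-1})^q` (indices mod `n`). -/
def sigmaTwist (q : ℕ) {n : ℕ} {K : Type*} [Field K]
    (M : Matrix (ZMod n) (ZMod n) K) : Matrix (ZMod n) (ZMod n) K :=
  Matrix.of fun i j => (M (i - 1) (j - 1)) ^ q

open Polynomial

/-- Total degree bound for a polynomial in two variables. -/
def Wle {A : Type*} [Semiring A] (G : A[X][X]) (T : ℕ) : Prop :=
  ∀ i j, T < i + j → (G.coeff i).coeff j = 0

namespace Wle

variable {A : Type*} [CommRing A] {G H : A[X][X]} {S T : ℕ}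

theorem mono (hG : Wle G S) (h : S ≤ T) : Wle G T := fun i j hij => hG i j (by omega)

theorem zero : Wle (0 : A[X][X]) T := fun i j _ => by simp

theorem neg (hG : Wle G T) : Wle (-G) T := fun i j hij => by
  simp [hG i j hij]

theorem sub (hG : Wle G T) (hH : Wle H T) : Wle (G - H) T := fun i j hij => by
  simp [hG i j hij, hH i j hij]

theorem sum {ι : Type*} (s : Finset ι) (F : ι → A[X][X]) (hF : ∀ i ∈ s, Wle (F i) T) :
    Wle (∑ i ∈ s, F i) T := fun i j hij => by
  simp only [finsetSum_coeff]
  exact Finset.sum_eq_zero fun k hk => hF k hk i j hij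

theorem mul (hG : Wle G S) (hH : Wle H T) : Wle (G * H) (S + T) := fun i j hij => by
  rw [coeff_mul, finsetSum_coeff]
  refine Finset.sum_eq_zero fun x hx => ?_
  rw [coeff_mul]
  refine Finset.sum_eq_zero fun y hy => ?_
  rw [Finset.HasAntidiagonal.mem_antidiagonal] at hx hy
  by_cases hS : S < x.1 + y.1
  · rw [hG _ _ hS, zero_mul]
  · rw [hH _ _ (by omega), mul_zero]

theorem C_of_natDegree_le {p : A[X]} (hp : p.natDegree ≤ T) : Wle (C p) T := fun i j hij => by
  rw [coeff_C]
  split_ifs with h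
  · exact coeff_eq_zero_of_natDegree_lt (by omega)
  · simp

theorem X_pow (i : ℕ) : Wle (X ^ i : A[X][X]) i := fun a b hab => by
  rw [coeff_X_pow]
  split_ifs with h
  · rw [coeff_one, if_neg (by omega)]
  · simp

theorem C_mul_X_pow {p : A[X]} {a : ℕ} (hp : p.natDegree ≤ a) (i : ℕ) :
    Wle (C p * X ^ i) (a + i) := (C_of_natDegree_le hp).mul (X_pow i)

theorem natDegree_coeff_le (hG : Wle G T) (i : ℕ) : (G.coeff i).natDegree ≤ T - i :=
  natDegree_le_iff_coeff_eq_zero.2 fun j hj => hG i j (by omega)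

theorem natDegree_le (hG : Wle G T) : G.natDegree ≤ T :=
  natDegree_le_iff_coeff_eq_zero.2 fun i hi => by
    ext j
    exact hG i j (by omega)

theorem map {B : Type*} [CommRing B] (f : A →+* B) (hG : Wle G T) :
    Wle (G.map (mapRingHom f)) T := fun i j hij => by
  simp [hG i j hij]

theorem modByMonic_of_monic {h : A[X][X]} {n : ℕ} (hm : h.Monic) (hn : h.natDegree = n)
    (hw : Wle h n)
    {G : A[X][X]} {T : ℕ} (hG : Wle G T) : Wle (G %ₘ h) T := by
  rcases subsingleton_or_nontrivial A with hs | hs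
  · exact fun i j _ => Subsingleton.elim _ _
  induction hd : G.natDegree using Nat.strong_induction_on generalizing G with
  | _ d ih =>
    by_cases hlt : G.degree < h.degree
    · rwa [(modByMonic_eq_self_iff hm).2 hlt]
    have hle : h.degree ≤ G.degree := not_lt.1 hlt
    have hG0 : G ≠ 0 := by
      rintro rfl
      rw [degree_zero, le_bot_iff, degree_eq_bot] at hle
      exact hm.ne_zero hle
    have hnd : n ≤ d := by
      rw [← hn, ← hd]; exact natDegree_le_natDegree hle
    have hdT : d ≤ T := hd ▸ hG.natDegree_le
    set G' := G - h * (C G.leadingCoeff * X ^ (G.natDegree - h.natDegree)) with hG'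
    have hw' : Wle G' T := by
      refine hG.sub ?_
      have h1 : G.leadingCoeff.natDegree ≤ T - d := by
        rw [← hd]
        exact hG.natDegree_coeff_le G.natDegree
      refine (hw.mul (C_mul_X_pow h1 (G.natDegree - h.natDegree))).mono ?_
      omega
    have hdeg : G'.degree < G.degree := div_wf_lemma ⟨hle, hG0⟩ hm
    have hmod : G %ₘ h = G' %ₘ h := by
      have h2 : (h * (C G.leadingCoeff * X ^ (G.natDegree - h.natDegree))) %ₘ h = 0 :=
        (modByMonic_eq_zero_iff_dvd hm).2 (dvd_mul_right _ _)
      rw [hG', sub_modByMonic, h2, sub_zero]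
    rw [hmod]
    by_cases hG'0 : G' = 0
    · rw [hG'0, zero_modByMonic]; exact zero
    · exact ih G'.natDegree (hd ▸ natDegree_lt_natDegree hG'0 hdeg) hw' rfl

end Wle

/-- Underdetermined homogeneous linear systems have nontrivial solutions. -/
theorem exists_solution_of_card_lt {A ι κ : Type*} [CommRing A] [Nontrivial A]
    (U : Finset ι) (E : Finset κ) (L : κ → ι → A) (h : E.card < U.card) :
    ∃ d : ι → A, (∃ i ∈ U, d i ≠ 0) ∧ ∀ e ∈ E, ∑ i ∈ U, d i * L e i = 0 := by
  classical
  let φ : (U → A) →ₗ[A] (E → A) :=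
    LinearMap.pi fun e => ∑ i : U, (L e.1 i.1) • LinearMap.proj i
  have hφ : ¬ Function.Injective φ := fun hinj => by
    have := card_le_of_injective A φ hinj
    simp only [Fintype.card_coe] at this
    omega
  rw [← LinearMap.ker_eq_bot, Submodule.eq_bot_iff] at hφ
  push Not at hφ
  obtain ⟨v, hv, hv0⟩ := hφ
  refine ⟨fun i => if hi : i ∈ U then v ⟨i, hi⟩ else 0, ?_, ?_⟩
  · obtain ⟨i, hi⟩ := Function.ne_iff.1 hv0
    exact ⟨i, i.2, by simpa using hi⟩
  · intro e he
    have := congrFun (LinearMap.mem_ker.1 hv) ⟨e, he⟩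
    simp only [φ, LinearMap.pi_apply, LinearMap.sum_apply, LinearMap.smul_apply,
      LinearMap.proj_apply, Pi.zero_apply, smul_eq_mul] at this
    rw [← this, ← Finset.sum_coe_sort U]
    refine Finset.sum_congr rfl fun i _ => ?_
    simp [mul_comm]

/-- The polynomial with prescribed coefficients on a finite set of exponents `(i, j)`, where
`i` is the exponent of the outer variable. -/
noncomputable def biPoly {A : Type*} [CommRing A] (U : Finset (ℕ × ℕ)) (d : ℕ × ℕ → A) : A[X][X] :=
  ∑ u ∈ U, C (C (d u) * X ^ u.2) * X ^ u.1

theorem biPoly_coeff {A : Type*} [CommRing A] (U : Finset (ℕ × ℕ)) (d : ℕ × ℕ → A) (i j : ℕ) :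
    ((biPoly U d).coeff i).coeff j = if (i, j) ∈ U then d (i, j) else 0 := by
  classical
  simp only [biPoly, finsetSum_coeff, coeff_C_mul, coeff_X_pow]
  rw [← Finset.sum_ite_eq' U (i, j) d]
  refine Finset.sum_congr rfl fun u _ => ?_
  obtain ⟨a, b⟩ := u
  by_cases h1 : i = a
  · by_cases h2 : j = b
    · simp [h1, h2, coeff_X_pow]
    · simp [h1, h2, coeff_X_pow, Ne.symm h2]
  · simp [h1, Ne.symm h1]

theorem biPoly_mul_modByMonic_coeff {A : Type*} [CommRing A] (U : Finset (ℕ × ℕ)) (d : ℕ × ℕ → A)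
    (G h : A[X][X]) (i j : ℕ) :
    (((biPoly U d * G) %ₘ h).coeff i).coeff j =
      ∑ u ∈ U, d u * ((((C (X ^ u.2) * X ^ u.1 * G) %ₘ h)).coeff i).coeff j := by
  have : (biPoly U d * G) %ₘ h = ∑ u ∈ U, C (C (d u)) * ((C (X ^ u.2) * X ^ u.1 * G) %ₘ h) := by
    rw [biPoly, Finset.sum_mul]
    have := map_sum (modByMonicHom h) (fun u : ℕ × ℕ =>
      C (C (d u) * X ^ u.2) * X ^ u.1 * G) U
    simp only [modByMonicHom_apply] at this
    rw [this]
    refine Finset.sum_congr rfl fun u _ => ?_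
    rw [← smul_eq_C_mul (C (d u)), ← smul_modByMonic, smul_eq_C_mul, C_mul]
    simp only [mul_assoc]
  rw [this]
  simp [finsetSum_coeff]

theorem biPoly_ne_zero {A : Type*} [CommRing A] {U : Finset (ℕ × ℕ)} {d : ℕ × ℕ → A}
    (h : ∃ u ∈ U, d u ≠ 0) : biPoly U d ≠ 0 := by
  obtain ⟨u, hu, hd⟩ := h
  intro h0
  have := biPoly_coeff U d u.1 u.2
  rw [h0, if_pos (by simpa using hu)] at this
  exact hd (by simpa using this.symm)

theorem Wle.biPoly {A : Type*} [CommRing A] {U : Finset (ℕ × ℕ)} {d : ℕ × ℕ → A} {T : ℕ}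
    (h : ∀ u ∈ U, u.1 + u.2 ≤ T) : Wle (biPoly U d) T := fun i j hij => by
  rw [biPoly_coeff, if_neg]
  intro hu
  have := h _ hu
  simp only at this
  omega

theorem degree_biPoly_lt {A : Type*} [CommRing A] {U : Finset (ℕ × ℕ)} {d : ℕ × ℕ → A} {n : ℕ}
    (h : ∀ u ∈ U, u.1 < n) : (biPoly U d).degree < n := by
  rw [degree_lt_iff_coeff_zero]
  intro i hi
  ext j
  rw [biPoly_coeff, if_neg, coeff_zero]
  intro hu
  have := h _ hu
  simp only at this
  omega

/-- The exponents `(i, j)` with `i < n` and `i + j < T`. -/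
def wedge (n T : ℕ) : Finset (ℕ × ℕ) :=
  (Finset.range n ×ˢ Finset.range T).filter fun u => u.1 + u.2 < T

theorem mem_wedge {n T : ℕ} {u : ℕ × ℕ} : u ∈ wedge n T ↔ u.1 < n ∧ u.1 + u.2 < T := by
  simp only [wedge, Finset.mem_filter, Finset.mem_product, Finset.mem_range]
  omega

theorem card_wedge (n T : ℕ) : (wedge n T).card = ∑ i ∈ Finset.range n, (T - i) := by
  have : wedge n T = (Finset.range n).biUnion
      fun i => (Finset.range (T - i)).image (Prod.mk i) := by
    ext u
    simp only [mem_wedge, Finset.mem_biUnion, Finset.mem_range, Finset.mem_image]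
    constructor
    · rintro ⟨h1, h2⟩
      exact ⟨u.1, h1, u.2, by omega, rfl⟩
    · rintro ⟨i, hi, j, hj, rfl⟩
      exact ⟨hi, by simp only; omega⟩
  rw [this, Finset.card_biUnion]
  · refine Finset.sum_congr rfl fun i _ => ?_
    rw [Finset.card_image_of_injective _ (Prod.mk_right_injective i), Finset.card_range]
  · intro i _ i' _ hne
    rw [Function.onFun, Finset.disjoint_left]
    intro u hu hu'
    simp only [Finset.mem_image] at hu hu'
    obtain ⟨_, _, rfl⟩ := hu
    obtain ⟨_, _, h⟩ := hu'
    exact hne (congrArg Prod.fst h).symm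

theorem exists_mul_modByMonic_eq_C {A : Type*} [CommRing A] [Nontrivial A] {h G : A[X][X]}
    {n α : ℕ} (hm : h.Monic) (hn : h.natDegree = n) (hpos : 0 < n) (hw : Wle h n)
    (hG : Wle G α) :
    ∃ B : A[X][X], B ≠ 0 ∧ B.degree < n ∧
      ∃ M : A[X], M.natDegree ≤ n * α ∧ (B * G) %ₘ h = C M := by
  obtain ⟨m, rfl⟩ : ∃ m, n = m + 1 := ⟨n - 1, by omega⟩
  let U := wedge (m + 1) (m * α + 1)
  let E := wedge m (m * α + α)
  have hcard : E.card < U.card := by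
    rw [card_wedge, card_wedge, Finset.sum_range_succ']
    have : ∑ i ∈ Finset.range m, (m * α + α - i) ≤
        ∑ i ∈ Finset.range m, (m * α + 1 - (i + 1) + α) :=
      Finset.sum_le_sum fun i _ => by omega
    rw [Finset.sum_add_distrib] at this
    simp only [Finset.sum_const, Finset.card_range, smul_eq_mul] at this
    omega
  obtain ⟨d, hd, hE⟩ := exists_solution_of_card_lt U E
    (fun e u => ((((C (X ^ u.2) * X ^ u.1 * G) %ₘ h)).coeff (e.1 + 1)).coeff e.2) hcard
  have hBw : Wle (biPoly U d * G) (m * α + α) :=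
    (Wle.biPoly fun u hu => by have := (mem_wedge.1 hu).2; omega).mul hG
  have hRw := Wle.modByMonic_of_monic hm hn hw hBw
  set R := (biPoly U d * G) %ₘ h with hR
  have hRc : R = C (R.coeff 0) := by
    ext i j
    rcases i with _ | i
    · simp
    · rw [coeff_C, if_neg (by omega), coeff_zero]
      by_cases hij : (i, j) ∈ E
      · rw [hR, biPoly_mul_modByMonic_coeff]
        exact hE _ hij
      · rw [mem_wedge] at hij
        simp only at hij
        by_cases him : i < m
        · exact hRw _ _ (by omega)
        · have : R.degree < h.degree := degree_modByMonic_lt _ hm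
          rw [degree_eq_natDegree hm.ne_zero, hn] at this
          rw [coeff_eq_zero_of_degree_lt (n := i + 1), coeff_zero]
          refine this.trans_le ?_
          exact_mod_cast (by omega : m + 1 ≤ i + 1)
  refine ⟨biPoly U d, biPoly_ne_zero hd, degree_biPoly_lt fun u hu => (mem_wedge.1 hu).1,
    R.coeff 0, ?_, hRc⟩
  have := hRw.natDegree_coeff_le 0
  rw [add_mul]
  omega

/-- Substitution of a power series for the outer variable. -/
noncomputable def evalSeries {A : Type*} [CommRing A] (z : PowerSeries A) :
    A[X][X] →+* PowerSeries A :=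
  eval₂RingHom Polynomial.coeToPowerSeries.ringHom z

section EvalSeries

variable {A : Type*} [CommRing A] (z : PowerSeries A)

theorem evalSeries_C (p : A[X]) : evalSeries z (C p) = (p : PowerSeries A) := by
  simp [evalSeries]

theorem evalSeries_X : evalSeries z X = z := by
  simp [evalSeries]

theorem evalSeries_eq_sum {n : ℕ} (G : A[X][X]) (hG : G.degree < n) :
    evalSeries z G = ∑ i ∈ Finset.range n, (G.coeff i : PowerSeries A) * z ^ i := by
  rcases eq_or_ne G 0 with rfl | h0
  · simp
  rw [evalSeries, coe_eval₂RingHom, eval₂_eq_sum_range' _ ((natDegree_lt_iff_degree_lt h0).2 hG)]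
  simp

theorem exists_wle (G : A[X][X]) : ∃ T, Wle G T := by
  refine ⟨G.natDegree + ∑ i ∈ Finset.range (G.natDegree + 1), (G.coeff i).natDegree,
    fun i j hij => ?_⟩
  by_cases hi : i ≤ G.natDegree
  · have := Finset.single_le_sum (f := fun i => (G.coeff i).natDegree) (fun _ _ => Nat.zero_le _)
      (Finset.mem_range.2 (show i < G.natDegree + 1 by omega))
    exact coeff_eq_zero_of_natDegree_lt (by omega)
  · rw [coeff_eq_zero_of_natDegree_lt (p := G) (by omega), coeff_zero]

end EvalSeries

/-- A prime bivariate polynomial is the minimal polynomial of its power series roots. -/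
theorem eq_zero_of_evalSeries_eq_zero {k : Type*} [CommRing k] [IsDomain k] {h : k[X][X]}
    {n : ℕ} (hm : h.Monic) (hp : Prime h) (hn : h.natDegree = n) (hpos : 0 < n) (hw : Wle h n)
    {y : PowerSeries k} (hy : evalSeries y h = 0) {G : k[X][X]} (hd : G.degree < n)
    (hG : evalSeries y G = 0) : G = 0 := by
  obtain ⟨α, hα⟩ := exists_wle G
  obtain ⟨B, hB0, hBd, M, -, hM⟩ := exists_mul_modByMonic_eq_C hm hn hpos hw hα
  have hdeg : h.degree = n := by rw [degree_eq_natDegree hm.ne_zero, hn]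
  have key := modByMonic_add_div (B * G) h
  have hM0 : M = 0 := by
    have := congrArg (evalSeries y) key
    rw [map_add, map_mul, map_mul, hy, hG, hM, evalSeries_C, zero_mul, mul_zero, add_zero] at this
    exact_mod_cast this
  rw [hM0, C_0, modByMonic_eq_zero_iff_dvd hm] at hM
  rcases hp.dvd_or_dvd hM with h1 | h1
  · exact absurd h1 (hm.not_dvd_of_degree_lt hB0 (by rwa [hdeg]))
  · by_contra h0
    exact hm.not_dvd_of_degree_lt h0 (by rwa [hdeg]) h1

/-- The same statement after extending the coefficients to power series. -/
theorem eq_zero_of_evalSeries_map_C_eq_zero {k : Type*} [CommRing k] [IsDomain k] {h : k[X][X]}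
    {n : ℕ} (hm : h.Monic) (hp : Prime h) (hn : h.natDegree = n) (hpos : 0 < n) (hw : Wle h n)
    {y : PowerSeries k} (hy : evalSeries y h = 0) {G : (PowerSeries k)[X][X]} (hd : G.degree < n)
    (hG : evalSeries (PowerSeries.map PowerSeries.C y) G = 0) : G = 0 := by
  obtain ⟨N, hN⟩ := exists_wle G
  let P : ℕ → k[X][X] := fun l =>
    biPoly (wedge n (N + 1)) fun u => PowerSeries.coeff l ((G.coeff u.1).coeff u.2)
  have hPc : ∀ l i j, ((P l).coeff i).coeff j = PowerSeries.coeff l ((G.coeff i).coeff j) := by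
    intro l i j
    simp only [P]
    rw [biPoly_coeff]
    split_ifs with hu
    · rfl
    · rw [mem_wedge] at hu
      by_cases hi : i < n
      · rw [hN i j (by simp only at hu; omega), map_zero]
      · rw [coeff_eq_zero_of_degree_lt (n := i), coeff_zero, map_zero]
        exact hd.trans_le (by exact_mod_cast not_lt.1 hi)
  have hPd : ∀ l, (P l).degree < n := fun l => degree_biPoly_lt fun u hu => (mem_wedge.1 hu).1
  have hP0 : ∀ l, P l = 0 := by
    intro l
    refine eq_zero_of_evalSeries_eq_zero hm hp hn hpos hw hy (hPd l) ?_
    ext m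
    have h1 := congrArg (PowerSeries.coeff l) (congrArg (PowerSeries.coeff m) hG)
    rw [evalSeries_eq_sum _ _ hd] at h1
    rw [evalSeries_eq_sum _ _ (hPd l)]
    simp only [map_sum, map_zero, PowerSeries.coeff_mul, Polynomial.coeff_coe, ← map_pow,
      PowerSeries.coeff_map] at h1 ⊢
    rw [← h1]
    refine Finset.sum_congr rfl fun i _ => Finset.sum_congr rfl fun x _ => ?_
    rw [hPc, ← PowerSeries.coeff_mul, PowerSeries.coeff_mul_C]
  ext i j l
  rw [← hPc, hP0]
  simp

theorem eq_zero_of_sum_X_pow_mul_expand_eq_zero {k : Type*} [CommRing k] {s : ℕ} (hs : s ≠ 0)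
    (M : (PowerSeries k)[X]) (hM : M.natDegree < s)
    (h : M.eval₂ (PowerSeries.expand s hs (R := k)).toRingHom PowerSeries.X = 0) : M = 0 := by
  ext u l
  by_cases hu : u < s
  swap
  · rw [coeff_eq_zero_of_natDegree_lt (by omega)]
    simp
  rw [eval₂_eq_sum_range' _ hM] at h
  have := congrArg (PowerSeries.coeff (u + s * l)) h
  simp only [map_sum, PowerSeries.coeff_mul_X_pow', map_zero] at this
  rw [Finset.sum_eq_single u] at this
  · simpa using this
  · intro i hi hne
    rw [Finset.mem_range] at hi
    split_ifs with hle
    · refine PowerSeries.coeff_expand_of_not_dvd _ _ _ ?_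
      intro hdvd
      have h2 : u + s * l ≡ i [MOD s] := ((Nat.modEq_iff_dvd' hle).2 hdvd).symm
      have h3 : u ≡ i [MOD s] := by
        simpa [Nat.ModEq] using h2
      exact hne (Nat.ModEq.eq_of_lt_of_lt h3 hu hi).symm
    · rfl
  · intro h; exact absurd (Finset.mem_range.2 hu) h

theorem expand_map_iterateFrobenius {k : Type*} [CommRing k] {p : ℕ} [ExpChar k p] (e : ℕ)
    (hs : p ^ e ≠ 0) (f : PowerSeries k) :
    PowerSeries.expand (p ^ e) hs (PowerSeries.map (iterateFrobenius k p e) f) = f ^ p ^ e := by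
  rw [← PowerSeries.map_expand]
  exact MvPowerSeries.map_iterateFrobenius_expand p (expChar_pos k p).ne' f e

theorem coeff_eq_zero_of_sum_eq_zero {k : Type*} [Field k] [PerfectField k] {p : ℕ} [ExpChar k p]
    {h : k[X][X]} {n : ℕ} (hm : h.Monic) (hp : Prime h) (hn : h.natDegree = n) (hpos : 0 < n)
    (hw : Wle h n) {y : PowerSeries k} (hy : evalSeries y h = 0) {e α : ℕ} (hs : n * α < p ^ e)
    (U : Finset (ℕ × ℕ)) (hU : ∀ f ∈ U, f.1 < n) (c : ℕ × ℕ → ℕ × ℕ → k)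
    (hc : ∑ a ∈ wedge n (α + 1), ∑ f ∈ U,
      PowerSeries.C (c a f) * PowerSeries.X ^ (a.2 + p ^ e * f.2) * y ^ (a.1 + p ^ e * f.1) = 0)
    {a f : ℕ × ℕ} (ha : a ∈ wedge n (α + 1)) (hf : f ∈ U) : c a f = 0 := by
  have hs0 : p ^ e ≠ 0 := by omega
  have hdeg : h.degree = n := by rw [degree_eq_natDegree hm.ne_zero, hn]
  let θ : PowerSeries k →+* PowerSeries k := (PowerSeries.expand (p ^ e) hs0 (R := k)).toRingHom
  let y' : PowerSeries k := PowerSeries.map (iterateFrobenius k p e) y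
  have hθy : θ y' = y ^ p ^ e := expand_map_iterateFrobenius e hs0 y
  have hθX : θ PowerSeries.X = PowerSeries.X ^ p ^ e := PowerSeries.expand_X _ _
  have hθC : ∀ r : k, θ (PowerSeries.C r) = PowerSeries.C r := PowerSeries.expand_C _ _
  let E : ℕ × ℕ → PowerSeries k := fun a =>
    ∑ f ∈ U, PowerSeries.C (c a f) * PowerSeries.X ^ f.2 * y' ^ f.1
  let F : (PowerSeries k)[X][X] := biPoly (wedge n (α + 1)) E
  have hFw : Wle F α := Wle.biPoly fun u hu => by have := (mem_wedge.1 hu).2; omega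
  have hFd : F.degree < n := degree_biPoly_lt fun u hu => (mem_wedge.1 hu).1
  let Θ : (PowerSeries k)[X][X] →+* PowerSeries k := eval₂RingHom (eval₂RingHom θ PowerSeries.X) y
  have hΘF : Θ F = 0 := by
    rw [← hc]
    simp only [F, biPoly, map_sum, Θ]
    refine Finset.sum_congr rfl fun a _ => ?_
    simp only [coe_eval₂RingHom, eval₂_C, eval₂_X, E, map_sum, map_mul,
      map_pow, hθy, hθX, hθC, Finset.sum_mul]
    refine Finset.sum_congr rfl fun f _ => ?_
    ring
  let hS : (PowerSeries k)[X][X] := h.map (mapRingHom PowerSeries.C)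
  have hSm : hS.Monic := hm.map _
  have hSn : hS.natDegree = n := by rw [hm.natDegree_map, hn]
  have hSw : Wle hS n := hw.map _
  have hΘh : Θ hS = 0 := by
    rw [← hy]
    simp only [Θ, hS, evalSeries, coe_eval₂RingHom, eval₂_map]
    congr 1
    ext r
    · simp [hθC, coeToPowerSeries.ringHom_apply]
    · simp [coeToPowerSeries.ringHom_apply]
  have hevh : evalSeries (PowerSeries.map PowerSeries.C y) hS = 0 := by
    rw [← map_zero (PowerSeries.map (PowerSeries.C (R := k))), ← hy]
    simp only [hS, evalSeries, coe_eval₂RingHom, eval₂_map, hom_eval₂]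
    congr 1
    ext r <;> simp [coeToPowerSeries.ringHom_apply]
  obtain ⟨B, hB0, hBd, M, hMd, hM⟩ := exists_mul_modByMonic_eq_C hSm hSn hpos hSw hFw
  have key := modByMonic_add_div (B * F) hS
  have hM0 : M = 0 := by
    refine eq_zero_of_sum_X_pow_mul_expand_eq_zero hs0 M (by omega) ?_
    have := congrArg Θ key
    rw [map_add, map_mul, map_mul, hΘh, hΘF, hM, zero_mul, mul_zero, add_zero] at this
    simp only [Θ, coe_eval₂RingHom, eval₂_C] at this
    exact this
  have hF0 : F = 0 := by
    have := congrArg (evalSeries (PowerSeries.map PowerSeries.C y)) key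
    rw [hM, hM0, map_add, map_mul, map_mul, hevh, C_0, map_zero, zero_mul, add_zero] at this
    rcases mul_eq_zero.1 this.symm with h1 | h1
    · exact absurd (eq_zero_of_evalSeries_map_C_eq_zero hm hp hn hpos hw hy hBd h1) hB0
    · exact eq_zero_of_evalSeries_map_C_eq_zero hm hp hn hpos hw hy hFd h1
  have hE0 : E a = 0 := by
    have := biPoly_coeff (wedge n (α + 1)) E a.1 a.2
    rw [if_pos (by simpa using ha)] at this
    change (F.coeff _).coeff _ = _ at this
    rw [hF0] at this
    simpa using this.symm
  have : PerfectRing k p := PerfectField.toPerfectRing p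
  choose r hr using fun f => (bijective_iterateFrobenius (R := k) p e).2 (c a f)
  let D : k[X][X] := biPoly U r
  have hDd : D.degree < n := degree_biPoly_lt hU
  have hD : evalSeries y D = 0 := by
    have hinj : Function.Injective (PowerSeries.map (iterateFrobenius k p e)) := by
      intro f g hfg
      ext m
      have := congrArg (PowerSeries.coeff m) hfg
      simp only [PowerSeries.coeff_map] at this
      exact (iterateFrobenius k p e).injective this
    apply hinj
    rw [map_zero, ← hE0]
    simp only [D, biPoly, map_sum, E]
    refine Finset.sum_congr rfl fun f _ => ?_
    rw [← hr f]
    simp [evalSeries_C, evalSeries_X, y']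
  have hD0 := eq_zero_of_evalSeries_eq_zero hm hp hn hpos hw hy hDd hD
  have := biPoly_coeff U r f.1 f.2
  rw [if_pos (by simpa using hf)] at this
  change (D.coeff _).coeff _ = _ at this
  rw [hD0] at this
  have hrf : r f = 0 := by simpa using this.symm
  rw [← hr f, hrf, map_zero]

theorem exists_evalSeries_eq_zero_of_isRoot {A : Type*} [CommRing A] {h : A[X][X]}
    (hm : h.Monic) (y0 : A) (hy0 : (h.map (evalRingHom 0)).eval y0 = 0)
    (hy1 : IsUnit ((derivative (h.map (evalRingHom 0))).eval y0)) :
    ∃ y : PowerSeries A, evalSeries y h = 0 ∧ PowerSeries.constantCoeff y = y0 := by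
  let f : (PowerSeries A)[X] := h.map coeToPowerSeries.ringHom
  have hcomp : PowerSeries.constantCoeff.comp coeToPowerSeries.ringHom =
      (evalRingHom 0 : A[X] →+* A) := by
    ext <;> simp [coeToPowerSeries.ringHom_apply]
  have hconst : ∀ g : A[X][X], PowerSeries.constantCoeff
      ((g.map coeToPowerSeries.ringHom).eval (PowerSeries.C y0)) =
        (g.map (evalRingHom 0)).eval y0 := by
    intro g
    rw [← hcomp, ← map_map, ← eval₂_hom, ← eval_map]
    simp
  obtain ⟨y, hy, hy'⟩ := HenselianRing.is_henselian
    (I := Ideal.span {(PowerSeries.X : PowerSeries A)})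
    f (hm.map _) (PowerSeries.C y0) (by
      rw [Ideal.mem_span_singleton, PowerSeries.X_dvd_iff, hconst]
      exact hy0) (by
      refine IsUnit.map _ ?_
      rw [PowerSeries.isUnit_iff_constantCoeff]
      simp only [f]
      rwa [derivative_map, hconst, ← derivative_map])
  refine ⟨y, ?_, ?_⟩
  · rwa [IsRoot, eval_map] at hy
  · rw [Ideal.mem_span_singleton, PowerSeries.X_dvd_iff, map_sub, sub_eq_zero] at hy'
    simpa using hy'

theorem exists_evalSeries_eq_zero {k : Type*} [Field k] [IsAlgClosed k] {h : k[X][X]}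
    (hm : h.Monic) (hd : h.natDegree ≠ 0) (hsep : (h.map (evalRingHom 0)).Separable) :
    ∃ y : PowerSeries k, evalSeries y h = 0 := by
  have hd0 : (h.map (evalRingHom 0)).degree ≠ 0 := by
    rw [hm.degree_map, degree_eq_natDegree hm.ne_zero]
    exact_mod_cast hd
  obtain ⟨y0, hy0⟩ := IsAlgClosed.exists_root _ hd0
  obtain ⟨y, hy, -⟩ := exists_evalSeries_eq_zero_of_isRoot hm y0 hy0 (isUnit_iff_ne_zero.2
    (hsep.eval₂_derivative_ne_zero (RingHom.id _) (by simpa using hy0)))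
  exact ⟨y, hy⟩

theorem coeff_coeff_sum_modByMonic {A ι : Type*} [CommRing A] (U : Finset ι) (d : ι → A)
    (m : ι → A[X][X]) (h : A[X][X]) (i j : ℕ) :
    (((∑ u ∈ U, C (C (d u)) * m u) %ₘ h).coeff i).coeff j =
      ∑ u ∈ U, d u * ((m u %ₘ h).coeff i).coeff j := by
  have := map_sum (modByMonicHom h) (fun u => C (C (d u)) * m u) U
  simp only [modByMonicHom_apply] at this
  rw [this]
  simp only [finsetSum_coeff]
  refine Finset.sum_congr rfl fun u _ => ?_
  rw [← smul_eq_C_mul (C (d u)), smul_modByMonic, smul_eq_C_mul, coeff_C_mul, coeff_C_mul]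

/-- The coefficient of `Z ^ k` in `(h(Z) - h(Y)) / (Z - Y)`. -/
noncomputable def divDiff {A : Type*} [CommRing A] (h : A[X]) (k : ℕ) : A[X] :=
  ∑ i ∈ Finset.range (h.natDegree + 1), if k < i then C (h.coeff i) * X ^ (i - 1 - k) else 0

theorem divDiff_pred_natDegree {A : Type*} [CommRing A] {h : A[X]} (hm : h.Monic)
    (hn : h.natDegree ≠ 0) : divDiff h (h.natDegree - 1) = 1 := by
  rw [divDiff, Finset.sum_eq_single h.natDegree]
  · rw [if_pos (by omega), Nat.sub_self, hm.coeff_natDegree]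
    simp
  · intro i hi hne
    rw [Finset.mem_range] at hi
    rw [if_neg (by omega)]
  · simp

theorem sum_divDiff_mul {A B : Type*} [CommRing A] [CommRing B] [Algebra A B] (h : A[X]) (y z : B) :
    (∑ k ∈ Finset.range h.natDegree, aeval y (divDiff h k) * z ^ k) * (z - y) =
      aeval z h - aeval y h := by
  have h1 : ∑ k ∈ Finset.range h.natDegree, aeval y (divDiff h k) * z ^ k =
      ∑ i ∈ Finset.range (h.natDegree + 1), algebraMap A B (h.coeff i) *
        ∑ k ∈ Finset.range i, z ^ k * y ^ (i - 1 - k) := by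
    simp only [divDiff, map_sum, Finset.sum_mul, Finset.mul_sum]
    rw [Finset.sum_comm]
    refine Finset.sum_congr rfl fun i hi => ?_
    rw [Finset.mem_range] at hi
    have hsub : Finset.range i ⊆ Finset.range h.natDegree := by
      intro k hk; rw [Finset.mem_range] at *; omega
    rw [← Finset.sum_subset hsub]
    · refine Finset.sum_congr rfl fun k hk => ?_
      rw [if_pos (Finset.mem_range.1 hk)]
      simp only [map_mul, aeval_C, map_pow, aeval_X]
      ring
    · intro k _ hk
      rw [Finset.mem_range] at hk
      rw [if_neg hk]
      simp
  rw [h1, Finset.sum_mul, aeval_eq_sum_range, aeval_eq_sum_range, ← Finset.sum_sub_distrib]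
  refine Finset.sum_congr rfl fun i _ => ?_
  rw [mul_assoc, geom_sum₂_mul, Algebra.smul_def, Algebra.smul_def, mul_sub]

theorem Wle.divDiff {A : Type*} [CommRing A] {h : A[X][X]} {n : ℕ} (hw : Wle h n) (k : ℕ)
    (hk : k < n) : Wle (divDiff h k) (n - 1 - k) := by
  refine Wle.sum _ _ fun i _ => ?_
  split_ifs with hki
  · rcases eq_or_ne (h.coeff i) 0 with h0 | h0
    · rw [h0, C_0, zero_mul]; exact Wle.zero
    have hin : i ≤ n := by
      by_contra hin
      exact h0 (by ext j; exact hw i j (by omega))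
    exact (Wle.C_mul_X_pow (hw.natDegree_coeff_le i) (i - 1 - k)).mono (by omega)
  · exact Wle.zero

theorem divDiff_map {A B : Type*} [CommRing A] [CommRing B] [Nontrivial B] (f : A →+* B) {h : A[X]}
    (hm : h.Monic) (k : ℕ) : divDiff (h.map f) k = (divDiff h k).map f := by
  simp only [divDiff, hm.natDegree_map, Polynomial.map_sum]
  refine Finset.sum_congr rfl fun i _ => ?_
  split_ifs <;> simp

/-- A polynomial over a finite field without roots is coprime to `X ^ q - X`. -/
theorem isCoprime_X_pow_card_sub_X {K : Type*} [Field K] [Fintype K] {g : K[X]}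
    (hg : ∀ a, ¬ g.IsRoot a) : IsCoprime g (X ^ Fintype.card K - X) := by
  have hdeg : (X ^ Fintype.card K - X : K[X]).natDegree = Fintype.card K :=
    FiniteField.X_pow_card_sub_X_natDegree_eq K Fintype.one_lt_card
  have hmon : (X ^ Fintype.card K - X : K[X]).Monic :=
    monic_X_pow_sub (by rw [degree_X]; exact_mod_cast Fintype.one_lt_card)
  have hroots := FiniteField.roots_X_pow_card_sub_X K
  have := prod_multiset_X_sub_C_of_monic_of_roots_card_eq hmon (by rw [hroots, hdeg]; rfl)
  rw [← this, hroots]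
  change IsCoprime g (∏ a : K, (X - C a))
  refine IsCoprime.prod_right fun a _ => ?_
  refine IsCoprime.symm (((irreducible_X_sub_C a).coprime_iff_not_dvd).2 ?_)
  rw [dvd_iff_isRoot]
  exact hg a

/-- If `φ ^ P` agrees with `B * ∑ γ_k Y ^ (qk)` modulo a separable `g` without rational roots,
then `g` divides `φ`. -/
theorem dvd_of_dvd_sub {K : Type*} [Field K] [Fintype K] {g : K[X]} (hsep : g.Separable)
    (hg : ∀ a, ¬ g.IsRoot a) {φ B : K[X]} {P : ℕ} (hP : P ≠ 0)
    (h : g ∣ φ ^ P - B * ∑ k ∈ Finset.range g.natDegree,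
      divDiff g k * (X ^ Fintype.card K) ^ k) : g ∣ φ := by
  have h1 : g ∣ ∑ k ∈ Finset.range g.natDegree, divDiff g k * (X ^ Fintype.card K) ^ k := by
    refine (isCoprime_X_pow_card_sub_X hg).dvd_of_dvd_mul_right ?_
    have := sum_divDiff_mul g (X : K[X]) (X ^ Fintype.card K)
    simp only [aeval_X_left_apply] at this
    rw [this]
    refine dvd_sub ?_ dvd_rfl
    rw [← expand_aeval, FiniteField.expand_card, aeval_X_left_apply]
    exact dvd_pow_self _ Fintype.card_ne_zero
  rw [← hsep.squarefree.dvd_pow_iff_dvd hP]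
  exact (dvd_iff_dvd_of_dvd_sub h).2 (h1.mul_left _)

theorem exists_separable_of_eval_ne_zero {k : Type*} [Field k] {h : k[X][X]} {n : ℕ}
    (hm : h.Monic) (hp : Prime h) (hn : h.natDegree = n) (hpos : 0 < n) (hw : Wle h n)
    (hd : derivative h ≠ 0) :
    ∃ N : k[X], N ≠ 0 ∧ N.natDegree ≤ n * (n - 1) ∧
      ∀ x, N.eval x ≠ 0 → (h.map (evalRingHom x)).Separable := by
  have hdw : Wle (derivative h) (n - 1) := fun i j hij => by
    rw [coeff_derivative, ← Nat.cast_succ, coeff_mul_natCast, hw _ _ (by omega), zero_mul]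
  obtain ⟨B, hB0, hBd, N, hNd, hN⟩ := exists_mul_modByMonic_eq_C hm hn hpos hw hdw
  have hdeg : h.degree = n := by rw [degree_eq_natDegree hm.ne_zero, hn]
  have key := modByMonic_add_div (B * derivative h) h
  refine ⟨N, ?_, hNd, fun x hx => ?_⟩
  · rintro rfl
    rw [C_0, modByMonic_eq_zero_iff_dvd hm] at hN
    rcases hp.dvd_or_dvd hN with h1 | h1
    · exact hm.not_dvd_of_degree_lt hB0 (by rwa [hdeg]) h1
    · exact hm.not_dvd_of_degree_lt hd (degree_derivative_lt hm.ne_zero) h1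
  · rw [hN] at key
    have h2 := congrArg (Polynomial.map (evalRingHom x)) key
    simp only [Polynomial.map_add, Polynomial.map_mul, map_C, coe_evalRingHom,
      ← derivative_map] at h2
    refine ⟨-C (N.eval x)⁻¹ * ((B * derivative h) /ₘ h).map (evalRingHom x),
      C (N.eval x)⁻¹ * B.map (evalRingHom x), ?_⟩
    have h3 : C (N.eval x)⁻¹ * C (N.eval x) = (1 : k[X]) := by
      rw [← C_mul, inv_mul_cancel₀ hx, C_1]
    linear_combination h3 - C (N.eval x)⁻¹ * h2

theorem sum_tsub_eq {n a : ℕ} (h : n ≤ a + 1) :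
    2 * (∑ i ∈ Finset.range n, ((a - i : ℕ) : ℤ)) = 2 * n * a - n * (n - 1) := by
  induction n with
  | zero => simp
  | succ n ih =>
    rw [Finset.sum_range_succ, mul_add, ih (by omega)]
    push_cast [Nat.cast_sub (show n ≤ a by omega)]
    ring

theorem card_wedge_eq {n a : ℕ} (h : n ≤ a + 1) :
    2 * ((wedge n a).card : ℤ) = 2 * n * a - n * (n - 1) := by
  rw [card_wedge]
  push_cast
  exact sum_tsub_eq h

theorem card_equations_lt_card_unknowns {n a P : ℕ} (hn : 2 ≤ n) (ha : n ≤ a) (hP : n ≤ P)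
    (h : n * (n - 1) * (a + P) ≤ 2 * (a * P)) :
    ∑ k ∈ Finset.range (n - 1), (wedge n (a * P - k)).card <
      (wedge n a).card * (wedge n P).card := by
  obtain ⟨m, rfl⟩ : ∃ m, n = m + 1 := ⟨n - 1, by omega⟩
  have haP : 2 * (m + 1) ≤ a * P :=
    Nat.mul_le_mul (hn.trans ha) hP
  have h1 := card_wedge_eq (n := m + 1) (a := a) (by omega)
  have h2 := card_wedge_eq (n := m + 1) (a := P) (by omega)
  have h3 : 2 * (∑ k ∈ Finset.range m, ((wedge (m + 1) (a * P - k)).card : ℤ)) =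
      (m + 1) * (2 * m * (a * P) - m * (m - 1)) - m * ((m + 1) * m) := by
    rw [← sum_tsub_eq (n := m) (a := a * P) (by omega) |>.trans (by push_cast; ring :
      (2 * m * ((a * P : ℕ) : ℤ) - m * (m - 1)) = 2 * m * (a * P) - m * (m - 1)), Finset.mul_sum,
      Finset.mul_sum, Finset.mul_sum]
    have : (m : ℤ) * ((m + 1) * m) = ∑ k ∈ Finset.range m, ((m + 1) * m : ℤ) := by simp
    rw [this, ← Finset.sum_sub_distrib]
    refine Finset.sum_congr rfl fun k hk => ?_
    rw [Finset.mem_range] at hk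
    rw [card_wedge_eq (by omega)]
    push_cast
    ring
  simp only [Nat.add_sub_cancel] at h ⊢
  zify at h ⊢ hn
  push_cast at h h1 h2
  have h4 : 4 * (((wedge (m + 1) a).card : ℤ) * (wedge (m + 1) P).card) =
      (2 * (m + 1) * a - (m + 1) * (m + 1 - 1)) * (2 * (m + 1) * P - (m + 1) * (m + 1 - 1)) := by
    rw [← h1, ← h2]; ring
  have hm : (1 : ℤ) ≤ m := by linarith
  have : (2 : ℤ) * (m + 1) * (2 * (a * P)) - 2 * (m + 1) * ((m + 1) * m * (a + P)) ≥ 0 := by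
    nlinarith
  nlinarith [mul_nonneg (show (0:ℤ) ≤ m by linarith) (show (0:ℤ) ≤ m by linarith)]

/-- The method of Stepanov: an absolutely irreducible plane curve over a large finite field has a
rational point over one of the good fibres. -/
theorem false_of_forall_not_isRoot {K : Type*} [Field K] [Fintype K] {p : ℕ} [Fact p.Prime]
    [CharP K p] {h : K[X][X]} {n : ℕ} (hm : h.Monic) (hn : h.natDegree = n) (hn2 : 2 ≤ n)
    (hw : Wle h n)
    (hirr : Irreducible (h.map (mapRingHom (algebraMap K (AlgebraicClosure K)))))
    (hsep0 : (h.map (evalRingHom 0)).Separable)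
    (hroot : ∀ x, (h.map (evalRingHom x)).Separable → ∀ y, ¬ (h.map (evalRingHom x)).IsRoot y)
    {r e α : ℕ} (hQ : Fintype.card K = p ^ r * p ^ e) (hα : n ≤ α + 1) (hP : n ≤ p ^ r)
    (hαs : n * α < p ^ e) (hG : n * (n - 1) * (α + 1 + p ^ r) ≤ 2 * ((α + 1) * p ^ r))
    (hs : p ^ e * (p ^ r - 1) + α + n * (n - 1) < p ^ r * p ^ e) : False := by
  classical
  set P := p ^ r with hPdef
  set s := p ^ e with hsdef
  have hcard := card_equations_lt_card_unknowns hn2 hα hP hG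
  set a := α + 1 with ha
  let U := wedge n a ×ˢ wedge n P
  let E : Finset (Σ _ : ℕ, ℕ × ℕ) := (Finset.range (n - 1)).sigma fun k => wedge n (a * P - k)
  let δ : ℕ → (ℕ × ℕ) × (ℕ × ℕ) → K[X][X] := fun k u =>
    (if u.2.1 = k then 1 else 0) - (if u.2.1 = n - 1 then divDiff h k else 0)
  let mon : (ℕ × ℕ) × (ℕ × ℕ) → K[X][X] := fun u =>
    C (X ^ (P * u.1.2 + u.2.2)) * X ^ (P * u.1.1)
  obtain ⟨d, ⟨u0, hu0, hd0⟩, hd⟩ := exists_solution_of_card_lt U E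
    (fun x u => (((mon u * δ x.1 u) %ₘ h).coeff x.2.1).coeff x.2.2) (by
      rw [Finset.card_sigma, Finset.card_product]
      exact hcard)
  let D : ℕ → K[X][X] := fun k => ∑ u ∈ U, C (C (d u)) * (mon u * δ k u)
  have hDw : ∀ k < n - 1, Wle (D k) (a * P - 1 - k) := by
    intro k hk
    refine Wle.sum _ _ fun u hu => ?_
    obtain ⟨h1, h2⟩ := Finset.mem_product.1 hu
    rw [mem_wedge] at h1 h2
    have hle : P * u.1.2 + P * u.1.1 + P ≤ a * P := by
      have : P * (u.1.2 + u.1.1 + 1) ≤ P * a := Nat.mul_le_mul_left _ (by omega)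
      rw [mul_comm a P]
      linarith [this]
    have hmon : Wle (C (C (d u)) * mon u) (P * u.1.2 + u.2.2 + P * u.1.1) := by
      have := (Wle.C_of_natDegree_le (T := 0) (natDegree_C (d u)).le).mul
        (Wle.C_mul_X_pow (natDegree_X_pow_le (R := K) (P * u.1.2 + u.2.2)) (P * u.1.1))
      rwa [zero_add] at this
    rw [← mul_assoc]
    by_cases hk1 : u.2.1 = k
    · simp only [δ]
      rw [if_pos hk1, if_neg (by omega), sub_zero, mul_one]
      exact hmon.mono (by omega)
    · by_cases hk2 : u.2.1 = n - 1
      · simp only [δ]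
        rw [if_neg hk1, if_pos hk2, zero_sub]
        exact (hmon.mul (hw.divDiff k (by omega)).neg).mono (by omega)
      · simp only [δ]
        rw [if_neg hk1, if_neg hk2, sub_zero, mul_zero]
        exact Wle.zero
  have hdeg : h.degree = n := by rw [degree_eq_natDegree hm.ne_zero, hn]
  have hDdvd : ∀ k < n, h ∣ D k := by
    intro k hk
    by_cases hk1 : k < n - 1
    · rw [← modByMonic_eq_zero_iff_dvd hm]
      ext j l
      by_cases hjl : (j, l) ∈ wedge n (a * P - k)
      · rw [coeff_coeff_sum_modByMonic]
        simpa using hd ⟨k, (j, l)⟩ (Finset.mem_sigma.2 ⟨Finset.mem_range.2 hk1, hjl⟩)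
      · rw [mem_wedge] at hjl
        simp only at hjl
        by_cases hjn : j < n
        · have haP : n ≤ a * P := hα.trans (Nat.le_mul_of_pos_right _ (by omega))
          have hjl' : a * P - 1 - k < j + l := by
            generalize a * P = t at *
            omega
          rw [Wle.modByMonic_of_monic hm hn hw (hDw k hk1) j l hjl']
          simp
        · have : (D k %ₘ h).degree < h.degree := degree_modByMonic_lt _ hm
          rw [hdeg] at this
          rw [coeff_eq_zero_of_degree_lt (n := j) (this.trans_le (by exact_mod_cast not_lt.1 hjn))]
          simp
    · have hk2 : k = n - 1 := by omega
      have : D k = 0 := by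
        refine Finset.sum_eq_zero fun u _ => ?_
        have hγ : divDiff h k = 1 := by
          rw [hk2, ← hn]; exact divDiff_pred_natDegree hm (by omega)
        rw [hk2] at hγ
        simp only [δ, hγ, hk2, sub_self, mul_zero]
      rw [this]
      exact dvd_zero _
  choose c hc using fun u => (bijective_iterateFrobenius (R := K) p r).2 (d u)
  have hcd : ∀ u, c u ^ P = d u := fun u => by rw [← hc u, iterateFrobenius_def]
  let φ : K[X][X] := ∑ u ∈ U, C (C (c u) * X ^ (u.1.2 + s * u.2.2)) * X ^ (u.1.1 + s * u.2.1)
  have hgood : ∀ x : K, (h.map (evalRingHom x)).Separable →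
      h.map (evalRingHom x) ∣ φ.map (evalRingHom x) := by
    intro x hx
    let B : K[X] := ∑ u ∈ U, if u.2.1 = n - 1 then
      C (d u * x ^ (P * u.1.2 + u.2.2)) * X ^ (P * u.1.1) else 0
    refine dvd_of_dvd_sub hx (hroot x hx) (P := P) (B := B) (by omega) ?_
    have key : φ.map (evalRingHom x) ^ P - B * ∑ k ∈ Finset.range (h.map (evalRingHom x)).natDegree,
        divDiff (h.map (evalRingHom x)) k * (X ^ Fintype.card K) ^ k =
        ∑ k ∈ Finset.range n, (D k).map (evalRingHom x) * (X ^ Fintype.card K) ^ k := by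
      rw [hm.natDegree_map, hn]
      have e1 : φ.map (evalRingHom x) ^ P = ∑ k ∈ Finset.range n, ∑ u ∈ U,
          (if u.2.1 = k then C (d u * x ^ (P * u.1.2 + u.2.2)) * X ^ (P * u.1.1) else 0) *
            (X ^ Fintype.card K) ^ k := by
        simp only [φ, Polynomial.map_sum, Polynomial.map_mul, map_C, Polynomial.map_pow, map_X,
          coe_evalRingHom, eval_mul, eval_C, eval_pow, eval_X]
        rw [hPdef, sum_pow_char_pow, ← hPdef, Finset.sum_comm]
        refine Finset.sum_congr rfl fun u hu => ?_
        have hun := (mem_wedge.1 (Finset.mem_product.1 hu).2).1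
        rw [Finset.sum_eq_single u.2.1]
        · rw [if_pos rfl, mul_pow, ← C_pow, mul_pow, hcd, ← pow_mul, ← pow_mul, ← pow_mul, hQ]
          have hx1 : x ^ ((u.1.2 + s * u.2.2) * P) = x ^ (P * u.1.2 + u.2.2) := by
            have : x ^ (P * s * u.2.2) = x ^ u.2.2 := by
              rw [pow_mul, ← hQ, FiniteField.pow_card]
            rw [show (u.1.2 + s * u.2.2) * P = P * u.1.2 + P * s * u.2.2 by ring, pow_add, this,
              pow_add]
          rw [hx1]
          ring
        · intro k _ hk
          rw [if_neg hk.symm, zero_mul]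
        · intro h; exact absurd (Finset.mem_range.2 hun) h
      rw [e1, Finset.mul_sum, ← Finset.sum_sub_distrib]
      refine Finset.sum_congr rfl fun k _ => ?_
      rw [← Finset.sum_mul, ← mul_assoc, ← sub_mul]
      congr 1
      simp only [D, B, Polynomial.map_sum, Finset.sum_mul, divDiff_map _ hm]
      rw [← Finset.sum_sub_distrib]
      refine Finset.sum_congr rfl fun u _ => ?_
      simp only [mon, δ]
      split_ifs <;> simp <;> ring
    rw [key]
    exact Finset.dvd_sum fun k hk =>
      ((Polynomial.map_dvd _ (hDdvd k (Finset.mem_range.1 hk)))).mul_right _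
  have hφw : Wle φ (α + s * (P - 1)) := by
    refine Wle.sum _ _ fun u hu => ?_
    obtain ⟨h1, h2⟩ := Finset.mem_product.1 hu
    rw [mem_wedge] at h1 h2
    have := (Wle.C_of_natDegree_le (T := 0) (natDegree_C (c u)).le).mul
        (Wle.C_mul_X_pow (natDegree_X_pow_le (R := K) (u.1.2 + s * u.2.2)) (u.1.1 + s * u.2.1))
    rw [← mul_assoc, ← C_mul] at this
    refine this.mono ?_
    have : s * (u.2.2 + u.2.1) ≤ s * (P - 1) := Nat.mul_le_mul_left _ (by omega)
    rw [mul_add] at this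
    omega
  have hirrK : Irreducible h :=
    hm.irreducible_of_irreducible_map (mapRingHom (algebraMap K (AlgebraicClosure K))) h hirr
  have hder : derivative h ≠ 0 := by
    intro h0
    have h1 : derivative (h.map (evalRingHom (0 : K))) = 0 := by
      rw [derivative_map, h0, Polynomial.map_zero]
    rw [Separable, h1, isCoprime_zero_right] at hsep0
    have := natDegree_eq_zero_of_isUnit hsep0
    rw [hm.natDegree_map] at this
    omega
  obtain ⟨N, hN0, hNd, hN⟩ := exists_separable_of_eval_ne_zero hm hirrK.prime hn (by omega) hw hder
  have hφdvd : h ∣ φ := by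
    rw [← modByMonic_eq_zero_iff_dvd hm]
    have hRw := Wle.modByMonic_of_monic hm hn hw hφw
    ext1 i
    rw [coeff_zero]
    have hprod : N * (φ %ₘ h).coeff i = 0 := by
      refine eq_zero_of_natDegree_lt_card_of_eval_eq_zero _ Function.injective_id (fun x => ?_) ?_
      · simp only [id, eval_mul]
        by_cases hx : N.eval x = 0
        · rw [hx, zero_mul]
        · have h1 := hgood x (hN x hx)
          rw [← modByMonic_eq_zero_iff_dvd (hm.map _), ← map_modByMonic _ hm] at h1
          have h2 := congrArg (fun g => coeff g i) h1
          simp only [coeff_map, coe_evalRingHom, coeff_zero] at h2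
          rw [h2, mul_zero]
      · rw [hQ]
        refine natDegree_mul_le.trans_lt ?_
        have := hRw.natDegree_coeff_le i
        omega
    exact (mul_eq_zero.1 hprod).resolve_left hN0
  let k := AlgebraicClosure K
  let ι := algebraMap K k
  let h' : k[X][X] := h.map (mapRingHom ι)
  have hm' : h'.Monic := hm.map _
  have hn' : h'.natDegree = n := by rw [hm.natDegree_map, hn]
  obtain ⟨y, hy⟩ := exists_evalSeries_eq_zero hm' (by omega) (by
    have : (h'.map (evalRingHom 0)) = (h.map (evalRingHom 0)).map ι := by
      simp only [h', Polynomial.map_map]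
      congr 1
      ext <;> simp
    rw [this]
    exact hsep0.map)
  have hφy : evalSeries y (φ.map (mapRingHom ι)) = 0 := by
    obtain ⟨g, hg⟩ := hφdvd
    rw [hg, Polynomial.map_mul, map_mul, hy, zero_mul]
  have : ExpChar k p := inferInstance
  have hc0 := coeff_eq_zero_of_sum_eq_zero (p := p) (e := e) (α := α) hm' hirr.prime hn' (by omega)
    (hw.map _) hy hαs (wedge n P) (fun f hf => (mem_wedge.1 hf).1) (fun a f => ι (c (a, f))) (by
      rw [← hφy, ← Finset.sum_product']
      simp only [φ, Polynomial.map_sum, map_sum]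
      refine Finset.sum_congr rfl fun u _ => ?_
      simp [evalSeries_C, evalSeries_X, s])
    (Finset.mem_product.1 hu0).1 (Finset.mem_product.1 hu0).2
  have : c u0 = 0 := by simpa [ι] using hc0
  refine hd0 ?_
  rw [← hcd, this, zero_pow (by omega)]

theorem exists_submatrix_det_ne_zero {A ι κ : Type*} [CommRing A] [IsDomain A] [Finite ι]
    [Fintype κ] [DecidableEq κ] (M : Matrix ι κ A) (hM : ∀ d : κ → A, M.mulVec d = 0 → d = 0) :
    ∃ f : κ → ι, (M.submatrix f id).det ≠ 0 := by
  have := Fintype.ofFinite ι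
  let L := FractionRing A
  let ML : Matrix ι κ L := M.map (algebraMap A L)
  have hinj : Function.Injective (algebraMap A L) := IsFractionRing.injective A L
  have hcol : LinearIndependent L ML.col := by
    rw [LinearIndependent.iff_fractionRing (R := A) (K := L) |>.symm, Fintype.linearIndependent_iff]
    intro d hd
    have h0 := hM d (by
      funext i
      apply hinj
      have := congrFun hd i
      simp only [Finset.sum_apply, Pi.zero_apply, ML, Algebra.smul_def] at this
      simp only [Matrix.mulVec, dotProduct, map_sum, map_mul, Pi.zero_apply, map_zero]
      rw [← this]
      exact Finset.sum_congr rfl fun _ _ => mul_comm _ _)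
    exact fun i => congrFun h0 i
  have hrank : ML.rank = Fintype.card κ := by
    rw [← Matrix.rank_transpose]
    exact LinearIndependent.rank_matrix (by simpa using hcol)
  rw [Matrix.rank_eq_finrank_span_row] at hrank
  obtain ⟨g, hg, -, hli⟩ := Submodule.exists_fun_fin_finrank_span_eq L (Set.range ML.row)
  choose r hr using hg
  let e : κ ≃ Fin (Module.finrank L (Submodule.span L (Set.range ML.row))) :=
    Fintype.equivOfCardEq (by simp [hrank])
  refine ⟨r ∘ e, fun h0 => ?_⟩
  have hli2 : LinearIndependent L (ML.submatrix (r ∘ e) id).row := by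
    have := hli.comp e e.injective
    have hfun : (ML.submatrix (r ∘ e) id).row = g ∘ e := by
      funext i
      rw [Function.comp, ← hr]
      rfl
    rw [hfun]
    exact this
  rw [Matrix.linearIndependent_rows_iff_isUnit, Matrix.isUnit_iff_isUnit_det] at hli2
  apply hli2.ne_zero
  have : ML.submatrix (r ∘ e) id = (algebraMap A L).mapMatrix (M.submatrix (r ∘ e) id) := rfl
  rw [this, ← RingHom.map_det, h0, map_zero]

namespace MvPolynomial

theorem totalDegree_det_le {σ R κ : Type*} [CommRing R] [Fintype κ] [DecidableEq κ]
    (M : Matrix κ κ (MvPolynomial σ R)) (d : ℕ) (hM : ∀ i j, (M i j).totalDegree ≤ d) :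
    M.det.totalDegree ≤ Fintype.card κ * d := by
  rw [Matrix.det_apply]
  refine totalDegree_finsetSum_le fun s _ => ?_
  have h1 : (∏ i, M (s i) i).totalDegree ≤ Fintype.card κ * d :=
    (totalDegree_finsetProd _ _).trans ((Finset.sum_le_card_nsmul _ _ d fun i _ => hM _ _).trans
      (by simp))
  rcases Int.units_eq_one_or (Equiv.Perm.sign s) with h | h
  · rwa [h, one_smul]
  · rwa [h, Units.neg_smul, one_smul, totalDegree_neg]

theorem exists_eval_ne_zero {σ R : Type*} [Finite σ] [CommRing R] [IsDomain R]
    {P : MvPolynomial σ R} (hP : P ≠ 0) (S : Finset R) (hS : P.totalDegree < S.card) :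
    ∃ x : σ → R, (∀ i, x i ∈ S) ∧ eval x P ≠ 0 := by
  by_contra! h
  exact hP (eq_zero_of_eval_zero_at_prod_finset P (fun _ => S)
    (fun i => (degreeOf_le_totalDegree P i).trans_lt hS) h)

end MvPolynomial

/-- An irreducible polynomial with nonzero derivative has a separable specialization. -/
theorem exists_separable_map_eval {K σ : Type*} [Field K] [Finite σ]
    {F : (MvPolynomial σ K)[X]} {n : ℕ} (hm : F.Monic) (hn : F.natDegree = n) (hpos : 0 < n)
    (hdeg : ∀ i, (F.coeff i).totalDegree ≤ n) (hirr : Irreducible F) (hder : derivative F ≠ 0)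
    (S : Finset K) (hS : (2 * n - 1) * n < S.card) :
    ∃ w : σ → K, (∀ i, w i ∈ S) ∧ (F.map (MvPolynomial.eval w)).Separable := by
  set d := (derivative F).natDegree with hd
  have hdn : d ≤ n - 1 := hn ▸ natDegree_derivative_le F
  have hres : F.resultant (derivative F) ≠ 0 := by
    intro h0
    let L := FractionRing (MvPolynomial σ K)
    have hinj : Function.Injective (algebraMap (MvPolynomial σ K) L) := IsFractionRing.injective _ L
    have hirrL := (hm.irreducible_iff_irreducible_map_fraction_map (K := L)).1 hirr
    have h1 := congrArg (algebraMap (MvPolynomial σ K) L) h0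
    rw [map_zero, ← resultant_map_map, ← natDegree_map_eq_of_injective hinj,
      ← natDegree_map_eq_of_injective hinj (p := derivative F), resultant_eq_zero_iff] at h1
    apply h1.2
    rw [hirrL.coprime_iff_not_dvd]
    intro hdvd
    have hne : (derivative F).map (algebraMap (MvPolynomial σ K) L) ≠ 0 :=
      (Polynomial.map_ne_zero_iff hinj).2 hder
    have := natDegree_le_of_dvd hdvd hne
    rw [natDegree_map_eq_of_injective hinj, natDegree_map_eq_of_injective hinj] at this
    omega
  have hentry : ∀ i j, (sylvester F (derivative F) F.natDegree d i j).totalDegree ≤ n := by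
    have hd' : ∀ i, ((derivative F).coeff i).totalDegree ≤ n := fun i => by
      rw [coeff_derivative]
      refine (MvPolynomial.totalDegree_mul _ _).trans ?_
      have : ((i : MvPolynomial σ K) + 1).totalDegree = 0 := by
        have : (i : MvPolynomial σ K) + 1 = MvPolynomial.C ((i : K) + 1) := by simp
        rw [this, MvPolynomial.totalDegree_C]
      rw [this]
      exact hdeg _
    intro i j
    induction j using Fin.addCases with
    | left j =>
      simp only [sylvester, Matrix.of_apply, Fin.addCases_left]
      split_ifs
      · exact hd' _
      · simp
    | right j =>
      simp only [sylvester, Matrix.of_apply, Fin.addCases_right]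
      split_ifs
      · exact hdeg _
      · simp
  have htot : (F.resultant (derivative F)).totalDegree < S.card := by
    refine lt_of_le_of_lt ?_ hS
    refine (MvPolynomial.totalDegree_det_le _ n hentry).trans ?_
    rw [Fintype.card_fin]
    gcongr
    omega
  obtain ⟨w, hw, hne⟩ := MvPolynomial.exists_eval_ne_zero hres S htot
  refine ⟨w, hw, ?_⟩
  rw [← resultant_map_map] at hne
  obtain ⟨a, b, -, -, hab⟩ := exists_mul_add_mul_eq_C_resultant (F.map (MvPolynomial.eval w))
    ((derivative F).map (MvPolynomial.eval w)) natDegree_map_le natDegree_map_le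
    (Or.inl (by omega : F.natDegree ≠ 0))
  rw [separable_def, derivative_map]
  set c := (F.map (MvPolynomial.eval w)).resultant
    ((derivative F).map (MvPolynomial.eval w)) F.natDegree (derivative F).natDegree
  refine ⟨C c⁻¹ * a, C c⁻¹ * b, ?_⟩
  rw [mul_assoc, mul_assoc, mul_comm a, mul_comm b, ← mul_add, hab, ← C_mul,
    inv_mul_cancel₀ hne, C_1]

/-- Restriction of polynomials to the line through `w` with direction `v`. -/
noncomputable def lineHom {k B σ : Type*} [Field k] [CommRing B] [Algebra k B] (w : σ → k)
    (v : σ → B) : MvPolynomial σ k →+* B[X] :=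
  (MvPolynomial.aeval fun i => C (algebraMap k B (w i)) + X * C (v i) :
    MvPolynomial σ k →ₐ[k] B[X]).toRingHom

section lineHom

variable {k B B' σ : Type*} [Field k] [CommRing B] [Algebra k B] [CommRing B'] [Algebra k B']
  (w : σ → k) (v : σ → B)

theorem lineHom_C (a : k) : lineHom w v (MvPolynomial.C a) = C (algebraMap k B a) := by
  simp [lineHom, Polynomial.algebraMap_apply]

theorem lineHom_X (i : σ) :
    lineHom w v (MvPolynomial.X i) = C (algebraMap k B (w i)) + X * C (v i) := by
  simp [lineHom]

theorem mapRingHom_comp_lineHom (φ : B →ₐ[k] B') :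
    (mapRingHom (φ : B →+* B')).comp (lineHom w v) = lineHom w (φ ∘ v) := by
  refine MvPolynomial.ringHom_ext (fun a => ?_) fun i => ?_
  · simp [lineHom_C]
  · simp [lineHom_X]

theorem evalRingHom_comp_lineHom :
    (evalRingHom 0).comp (lineHom w v) = (algebraMap k B).comp (MvPolynomial.eval w) := by
  refine MvPolynomial.ringHom_ext (fun a => ?_) fun i => ?_
  · simp [lineHom_C]
  · simp [lineHom_X]

theorem natDegree_lineHom_le (p : MvPolynomial σ k) :
    (lineHom w v p).natDegree ≤ p.totalDegree := by
  rw [lineHom, AlgHom.toRingHom_eq_coe, RingHom.coe_coe, MvPolynomial.aeval_def,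
    MvPolynomial.eval₂_eq]
  refine natDegree_sum_le_of_forall_le _ _ fun d hd => ?_
  refine natDegree_mul_le.trans ?_
  rw [Polynomial.algebraMap_apply, natDegree_C, zero_add]
  refine (natDegree_prod_le _ _).trans ?_
  refine le_trans (Finset.sum_le_sum fun i _ => ?_) (MvPolynomial.le_totalDegree hd)
  refine natDegree_pow_le_of_le (m := 1) (d i) ?_ |>.trans (by rw [mul_one])
  refine natDegree_add_le_of_degree_le (by simp) ?_
  exact natDegree_mul_le.trans (by rw [natDegree_C]; exact natDegree_X_le)

theorem wle_map_lineHom {F : (MvPolynomial σ k)[X]} {n : ℕ} (hn : F.natDegree ≤ n)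
    (hdeg : ∀ i, (F.coeff i).totalDegree ≤ n - i) : Wle (F.map (lineHom w v)) n := by
  intro i j hij
  rw [coeff_map]
  by_cases hi : i ≤ n
  · refine coeff_eq_zero_of_natDegree_lt ((natDegree_lineHom_le w v _).trans_lt ?_)
    have := hdeg i
    omega
  · rw [coeff_eq_zero_of_natDegree_lt (p := F) (by omega), map_zero, coeff_zero]

end lineHom

/-- Power series whose `i`-th coefficient is a polynomial of degree at most `i`. -/
def weightedSubring (σ k : Type*) [CommRing k] : Subring (PowerSeries (MvPolynomial σ k)) where
  carrier := {s | ∀ i, (PowerSeries.coeff i s).totalDegree ≤ i}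
  mul_mem' {a b} ha hb i := by
    rw [PowerSeries.coeff_mul]
    refine MvPolynomial.totalDegree_finsetSum_le fun x hx => ?_
    rw [Finset.HasAntidiagonal.mem_antidiagonal] at hx
    refine (MvPolynomial.totalDegree_mul _ _).trans ?_
    have := ha x.1
    have := hb x.2
    omega
  one_mem' i := by
    rw [PowerSeries.coeff_one]
    split_ifs <;> simp
  add_mem' {a b} ha hb i := by
    rw [map_add]
    exact (MvPolynomial.totalDegree_add _ _).trans (max_le (ha i) (hb i))
  zero_mem' i := by simp
  neg_mem' {a} ha i := by
    rw [map_neg, MvPolynomial.totalDegree_neg]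
    exact ha i

theorem X_mem_weightedSubring {σ k : Type*} [CommRing k] :
    (PowerSeries.X : PowerSeries (MvPolynomial σ k)) ∈ weightedSubring σ k := fun i => by
  rw [PowerSeries.coeff_X]
  split_ifs <;> simp

theorem lineHom_mem_weightedSubring {σ k : Type*} [Field k] (w : σ → k)
    (p : MvPolynomial σ k) :
    ((lineHom w MvPolynomial.X p : (MvPolynomial σ k)[X]) : PowerSeries (MvPolynomial σ k)) ∈
      weightedSubring σ k := by
  have hC : ∀ a : k, ((C (algebraMap k (MvPolynomial σ k) a) : (MvPolynomial σ k)[X]) :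
      PowerSeries (MvPolynomial σ k)) ∈ weightedSubring σ k := fun a i => by
    rw [coeff_coe, coeff_C]
    split_ifs <;> simp [MvPolynomial.algebraMap_eq]
  induction p using MvPolynomial.induction_on with
  | C a => rw [lineHom_C]; exact hC a
  | add p q hp hq => rw [map_add, coe_add]; exact add_mem hp hq
  | mul_X p i hp =>
    rw [map_mul, coe_mul, lineHom_X]
    refine mul_mem hp ?_
    rw [coe_add]
    refine add_mem (hC _) fun j => ?_
    rw [coeff_coe, mul_comm, coeff_C_mul_X]
    split_ifs with h
    · subst h
      exact (MvPolynomial.totalDegree_X i).le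
    · simp

theorem mem_weightedSubring_of_evalSeries_eq_zero {σ k : Type*} [Field k]
    {h : (MvPolynomial σ k)[X][X]}
    (hh : ∀ i, ((h.coeff i : (MvPolynomial σ k)[X]) : PowerSeries (MvPolynomial σ k)) ∈
      weightedSubring σ k)
    {y : PowerSeries (MvPolynomial σ k)} (hy : evalSeries y h = 0) {a u : k} (hu : u ≠ 0)
    (ha : PowerSeries.constantCoeff y = MvPolynomial.C a)
    (hu' : (derivative (h.map (evalRingHom 0))).eval (MvPolynomial.C a) = MvPolynomial.C u) :
    y ∈ weightedSubring σ k := by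
  intro i
  induction i using Nat.strong_induction_on with
  | _ m ih =>
    rcases Nat.eq_zero_or_pos m with rfl | hpos
    · rw [PowerSeries.coeff_zero_eq_constantCoeff_apply, ha]
      simp
    obtain ⟨b, hb⟩ : (PowerSeries.X : PowerSeries (MvPolynomial σ k)) ^ m ∣
        y - ((PowerSeries.trunc m y : (MvPolynomial σ k)[X]) : PowerSeries (MvPolynomial σ k)) := by
      rw [PowerSeries.X_pow_dvd_iff]
      intro j hj
      rw [map_sub, coeff_coe, PowerSeries.coeff_trunc, if_pos hj, sub_self]
    set t : PowerSeries (MvPolynomial σ k) :=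
      ((PowerSeries.trunc m y : (MvPolynomial σ k)[X]) : PowerSeries (MvPolynomial σ k)) with ht
    have htmem : t ∈ weightedSubring σ k := fun j => by
      rw [ht, coeff_coe, PowerSeries.coeff_trunc]
      split_ifs with hj
      · exact ih j hj
      · simp
    let f : (PowerSeries (MvPolynomial σ k))[X] := h.map coeToPowerSeries.ringHom
    have hfy : f.eval y = 0 := by
      rw [eval_map]; exact hy
    obtain ⟨c, hc⟩ := f.binomExpansion t (PowerSeries.X ^ m * b)
    rw [show t + PowerSeries.X ^ m * b = y by rw [← hb]; ring, hfy] at hc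
    have hft : f.eval t ∈ weightedSubring σ k := by
      rw [eval_eq_sum_range]
      refine sum_mem fun i _ => mul_mem ?_ (pow_mem htmem _)
      simp only [f, coeff_map]
      exact hh i
    have hcm : PowerSeries.coeff m (f.eval t) =
        - (PowerSeries.constantCoeff ((derivative f).eval t) * PowerSeries.constantCoeff b) := by
      have h1 := congrArg (PowerSeries.coeff m) hc
      rw [map_zero, map_add, map_add,
        show (derivative f).eval t * (PowerSeries.X ^ m * b) =
          PowerSeries.X ^ m * ((derivative f).eval t * b) by ring,
        show c * (PowerSeries.X ^ m * b) ^ 2 =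
          PowerSeries.X ^ m * (PowerSeries.X ^ m * (c * b ^ 2)) by ring] at h1
      have h2 : ∀ s : PowerSeries (MvPolynomial σ k),
          PowerSeries.coeff m (PowerSeries.X ^ m * s) = PowerSeries.constantCoeff s := fun s => by
        have := PowerSeries.coeff_X_pow_mul s m 0
        simpa using this
      rw [h2, h2, map_mul, map_mul, map_pow, PowerSeries.constantCoeff_X, zero_pow (by omega),
        zero_mul, add_zero] at h1
      exact eq_neg_of_add_eq_zero_left h1.symm
    have hconstt : PowerSeries.constantCoeff t = MvPolynomial.C a := by
      rw [← PowerSeries.coeff_zero_eq_constantCoeff_apply, ht, coeff_coe, PowerSeries.coeff_trunc,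
        if_pos hpos, PowerSeries.coeff_zero_eq_constantCoeff_apply, ha]
    have hder : PowerSeries.constantCoeff ((derivative f).eval t) = MvPolynomial.C u := by
      have hcomp : PowerSeries.constantCoeff.comp coeToPowerSeries.ringHom =
          (evalRingHom 0 : (MvPolynomial σ k)[X] →+* MvPolynomial σ k) := by
        ext <;> simp [coeToPowerSeries.ringHom_apply]
      rw [← hu', ← hconstt, derivative_map, ← hcomp, ← map_map, ← derivative_map, ← eval₂_hom,
        ← eval_map, ← derivative_map]
    have hbm : PowerSeries.constantCoeff b = PowerSeries.coeff m y := by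
      have := congrArg (PowerSeries.coeff m) hb
      rw [map_sub, ht, coeff_coe, PowerSeries.coeff_trunc, if_neg (lt_irrefl m), sub_zero] at this
      rw [this]
      have := PowerSeries.coeff_X_pow_mul b m 0
      simpa using this.symm
    rw [hder, hbm] at hcm
    have hfin : PowerSeries.coeff m y =
        MvPolynomial.C (-u⁻¹) * PowerSeries.coeff m (f.eval t) := by
      rw [hcm, map_neg, neg_mul_neg, ← mul_assoc, ← map_mul, inv_mul_cancel₀ hu, map_one, one_mul]
    rw [hfin]
    refine (MvPolynomial.totalDegree_mul _ _).trans ?_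
    rw [MvPolynomial.totalDegree_C, zero_add]
    exact hft m

theorem exists_top_coeff {A : Type*} [CommRing A] {f : A[X][X]} (hf : f ≠ 0) :
    ∃ i j, (f.coeff i).coeff j ≠ 0 ∧ ∀ a b, (f.coeff a).coeff b ≠ 0 →
      a + b < i + j ∨ a + b = i + j ∧ a ≤ i := by
  classical
  obtain ⟨T, hT⟩ := exists_wle f
  let s := (Finset.range (T + 1) ×ˢ Finset.range (T + 1)).filter
    fun u => (f.coeff u.1).coeff u.2 ≠ 0
  have hs : ∀ a b, (f.coeff a).coeff b ≠ 0 → (a, b) ∈ s := fun a b hab => by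
    have : ¬ T < a + b := fun h => hab (hT a b h)
    simp only [s, Finset.mem_filter, Finset.mem_product, Finset.mem_range]
    exact ⟨by omega, hab⟩
  have hne : s.Nonempty := by
    have h1 : f.leadingCoeff ≠ 0 := leadingCoeff_ne_zero.2 hf
    have h2 : f.leadingCoeff.leadingCoeff ≠ 0 := leadingCoeff_ne_zero.2 h1
    exact ⟨_, hs f.natDegree f.leadingCoeff.natDegree h2⟩
  obtain ⟨⟨i, j⟩, hu, hmax⟩ := s.exists_max_image (fun u => toLex (u.1 + u.2, u.1)) hne
  refine ⟨i, j, (Finset.mem_filter.1 hu).2, fun a b hab => ?_⟩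
  have := hmax (a, b) (hs a b hab)
  rw [Prod.Lex.le_iff] at this
  simpa using this

theorem Wle.of_mul_left {A : Type*} [CommRing A] [IsDomain A] {f g : A[X][X]} (hf : f.Monic)
    (hg : g.Monic) (hfg : Wle (f * g) (f.natDegree + g.natDegree)) : Wle f f.natDegree := by
  intro a b hab
  by_contra h0
  obtain ⟨i, j, hij, hmax⟩ := exists_top_coeff hf.ne_zero
  obtain ⟨i', j', hij', hmax'⟩ := exists_top_coeff hg.ne_zero
  have h1 := hmax a b h0
  have h2 := hmax' g.natDegree 0 (by rw [hg.coeff_natDegree]; simp)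
  have key := hfg (i + i') (j + j') (by omega)
  rw [coeff_mul, finsetSum_coeff, Finset.sum_eq_single (i, i'), coeff_mul,
    Finset.sum_eq_single (j, j')] at key
  · exact (mul_ne_zero hij hij') key
  · rintro ⟨x, y⟩ hxy hne
    rw [Finset.HasAntidiagonal.mem_antidiagonal] at hxy
    simp only at hxy ⊢
    by_contra hprod
    have h3 := hmax i x (left_ne_zero_of_mul hprod)
    have h4 := hmax' i' y (right_ne_zero_of_mul hprod)
    exact hne (by ext <;> simp only <;> omega)
  · intro h
    exact absurd (by simp) h
  · rintro ⟨x, y⟩ hxy hne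
    rw [Finset.HasAntidiagonal.mem_antidiagonal] at hxy
    simp only at hxy ⊢
    rw [coeff_mul]
    refine Finset.sum_eq_zero ?_
    rintro ⟨z, t⟩ hzt
    rw [Finset.HasAntidiagonal.mem_antidiagonal] at hzt
    simp only at hzt ⊢
    by_contra hprod
    have h3 := hmax x z (left_ne_zero_of_mul hprod)
    have h4 := hmax' y t (right_ne_zero_of_mul hprod)
    exact hne (by ext <;> simp only <;> omega)
  · intro h
    exact absurd (by simp) h

theorem coeff_evalSeries_biPoly {A : Type*} [CommRing A] (z : PowerSeries A) (U : Finset (ℕ × ℕ))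
    (d : ℕ × ℕ → A) (i : ℕ) :
    PowerSeries.coeff i (evalSeries z (biPoly U d)) =
      ∑ u ∈ U, PowerSeries.coeff i (PowerSeries.X ^ u.2 * z ^ u.1) * d u := by
  rw [biPoly, map_sum, map_sum]
  refine Finset.sum_congr rfl fun u _ => ?_
  rw [map_mul, map_pow, evalSeries_C, evalSeries_X, Polynomial.coe_mul, Polynomial.coe_C,
    Polynomial.coe_pow, Polynomial.coe_X, mul_assoc, PowerSeries.coeff_C_mul, mul_comm]

theorem biPoly_coeff_eq {A : Type*} [CommRing A] (U : Finset (ℕ × ℕ)) (g : A[X][X])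
    (hg : ∀ i j, (g.coeff i).coeff j ≠ 0 → (i, j) ∈ U) :
    biPoly U (fun u => (g.coeff u.1).coeff u.2) = g := by
  ext i j
  rw [biPoly_coeff]
  split_ifs with h
  · rfl
  · by_contra h0
    exact h (hg i j (Ne.symm h0))

theorem evalSeries_map {A B : Type*} [CommRing A] [CommRing B] (φ : A →+* B) (z : PowerSeries A)
    (G : A[X][X]) : evalSeries (PowerSeries.map φ z) (G.map (mapRingHom φ)) =
      PowerSeries.map φ (evalSeries z G) := by
  rw [evalSeries, evalSeries, coe_eval₂RingHom, coe_eval₂RingHom, eval₂_map, hom_eval₂]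
  congr 1
  refine RingHom.ext fun p => ?_
  ext i
  simp [coeToPowerSeries.ringHom_apply]

/-- The coefficients of the monomials of degree less than `n` in the variable and `z`. -/
noncomputable def expansionMatrix {A : Type*} [CommRing A] (n N : ℕ) (z : PowerSeries A) :
    Matrix (Fin (N + 1)) (wedge n n) A :=
  Matrix.of fun i u => PowerSeries.coeff i (PowerSeries.X ^ u.1.2 * z ^ u.1.1)

theorem expansionMatrix_map {A B : Type*} [CommRing A] [CommRing B] (φ : A →+* B) (n N : ℕ)
    (z : PowerSeries A) :
    expansionMatrix n N (PowerSeries.map φ z) = (expansionMatrix n N z).map φ := by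
  ext i u
  simp only [expansionMatrix, Matrix.of_apply, Matrix.map_apply]
  rw [← PowerSeries.coeff_map, map_mul (PowerSeries.map φ), map_pow (PowerSeries.map φ),
    map_pow (PowerSeries.map φ), PowerSeries.map_X]

theorem expansionMatrix_mulVec_eq_zero {A : Type*} [CommRing A] {h : A[X][X]}
    {n : ℕ} (hm : h.Monic) (hp : Prime h) (hn : h.natDegree = n) (hpos : 0 < n) (hw : Wle h n)
    {y : PowerSeries A} (hy : evalSeries y h = 0) (d : wedge n n → A)
    (hd : (expansionMatrix n (n * (n - 1)) y).mulVec d = 0) : d = 0 := by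
  classical
  have : Nontrivial A := by
    by_contra hA
    rw [not_nontrivial_iff_subsingleton] at hA
    exact hp.ne_zero (Subsingleton.elim _ _)
  let d' : ℕ × ℕ → A := fun u => if hu : u ∈ wedge n n then d ⟨u, hu⟩ else 0
  by_contra hd0
  obtain ⟨u, hu⟩ := Function.ne_iff.1 hd0
  have hg0 : biPoly (wedge n n) d' ≠ 0 := biPoly_ne_zero ⟨u, u.2, by simpa [d'] using hu⟩
  have hgw : Wle (biPoly (wedge n n) d') (n - 1) := Wle.biPoly fun u hu => by
    rw [mem_wedge] at hu
    omega
  have hgd : (biPoly (wedge n n) d').degree < n := degree_biPoly_lt fun u hu => (mem_wedge.1 hu).1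
  have hgX : (PowerSeries.X : PowerSeries A) ^ (n * (n - 1) + 1) ∣
      evalSeries y (biPoly (wedge n n) d') := by
    rw [PowerSeries.X_pow_dvd_iff]
    intro i hi
    rw [coeff_evalSeries_biPoly, ← Finset.sum_coe_sort]
    have := congrFun hd ⟨i, hi⟩
    simp only [Matrix.mulVec, dotProduct, expansionMatrix, Matrix.of_apply, Pi.zero_apply] at this
    rw [← this]
    exact Finset.sum_congr rfl fun u _ => by simp [d']
  obtain ⟨B, hB0, hBd, M, hMd, hM⟩ := exists_mul_modByMonic_eq_C hm hn hpos hw hgw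
  have hdeg : h.degree = n := by rw [degree_eq_natDegree hm.ne_zero, hn]
  have hM0 : M = 0 := by
    have key := congrArg (evalSeries y) (modByMonic_add_div (B * biPoly (wedge n n) d') h)
    rw [map_add, map_mul, map_mul, hy, hM, evalSeries_C, zero_mul, add_zero] at key
    have hdvd : (PowerSeries.X : PowerSeries A) ^ (n * (n - 1) + 1) ∣ (M : PowerSeries A) := by
      rw [key]
      exact hgX.mul_left _
    rw [PowerSeries.X_pow_dvd_iff] at hdvd
    ext i
    by_cases hi : i < n * (n - 1) + 1
    · simpa using hdvd i hi
    · rw [coeff_eq_zero_of_natDegree_lt (p := M) (by omega), coeff_zero]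
  rw [hM0, C_0, modByMonic_eq_zero_iff_dvd hm] at hM
  rcases hp.dvd_or_dvd hM with h1 | h1
  · exact hm.not_dvd_of_degree_lt hB0 (by rwa [hdeg]) h1
  · exact hm.not_dvd_of_degree_lt hg0 (by rwa [hdeg]) h1

theorem irreducible_map_lineHom_X {k σ : Type*} [Field k] {F : (MvPolynomial σ k)[X]}
    (hm : F.Monic) (hirr : Irreducible F) (w : σ → k) :
    Irreducible (F.map (lineHom w (MvPolynomial.X : σ → MvPolynomial σ k))) := by
  refine (hm.map _).irreducible_of_irreducible_map (evalRingHom (1 : MvPolynomial σ k)) _ ?_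
  let φ : MvPolynomial σ k ≃ₐ[k] MvPolynomial σ k := AlgEquiv.ofAlgHom
    (MvPolynomial.aeval fun i => MvPolynomial.X i + MvPolynomial.C (w i))
    (MvPolynomial.aeval fun i => MvPolynomial.X i - MvPolynomial.C (w i))
    (by ext i; simp) (by ext i; simp)
  have hφ : (evalRingHom (1 : MvPolynomial σ k)).comp (lineHom w MvPolynomial.X) =
      (φ.toRingEquiv : MvPolynomial σ k →+* MvPolynomial σ k) := by
    refine MvPolynomial.ringHom_ext (fun a => ?_) fun i => ?_
    · simp [lineHom_C, φ]
    · simp [lineHom_X, φ, add_comm]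
  rw [Polynomial.map_map, hφ]
  exact (MulEquiv.irreducible_iff (Polynomial.mapEquiv φ.toRingEquiv)).2 hirr

/-- An effective Bertini theorem: an irreducible polynomial stays irreducible on a line through a
given point with direction in a prescribed large grid. -/
theorem exists_irreducible_map_lineHom {k σ : Type*} [Field k] [Finite σ]
    {F : (MvPolynomial σ k)[X]} {n : ℕ} (hm : F.Monic) (hn : F.natDegree = n) (hpos : 0 < n)
    (hdeg : ∀ i, (F.coeff i).totalDegree ≤ n - i) (hirr : Irreducible F) (w : σ → k) {a : k}
    (ha : (F.map (MvPolynomial.eval w)).eval a = 0)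
    (hsep : (F.map (MvPolynomial.eval w)).Separable) (S : Finset k)
    (hS : (wedge n n).card * (n * (n - 1)) < S.card) :
    ∃ v : σ → k, (∀ i, v i ∈ S) ∧ Irreducible (F.map (lineHom w v)) := by
  classical
  set H := F.map (lineHom w (MvPolynomial.X : σ → MvPolynomial σ k)) with hH
  have hHm : H.Monic := hm.map _
  have hHn : H.natDegree = n := by rw [hH, hm.natDegree_map, hn]
  have hHw : Wle H n := wle_map_lineHom _ _ hn.le hdeg
  have hHp : Prime H := (irreducible_map_lineHom_X hm hirr w).prime
  have hH0 : H.map (evalRingHom 0) =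
      (F.map (MvPolynomial.eval w)).map (MvPolynomial.C : k →+* MvPolynomial σ k) := by
    rw [hH, Polynomial.map_map, evalRingHom_comp_lineHom, Polynomial.map_map]
    rfl
  set u := (derivative (F.map (MvPolynomial.eval w))).eval a with hu
  have hu0 : u ≠ 0 := by
    have := hsep.eval₂_derivative_ne_zero (RingHom.id k) (x := a) (by simpa using ha)
    rwa [eval₂_id] at this
  have hu' : (derivative (H.map (evalRingHom 0))).eval (MvPolynomial.C a) =
      (MvPolynomial.C u : MvPolynomial σ k) := by
    rw [hH0, derivative_map, eval_map, eval₂_hom]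
  obtain ⟨y, hy, hya⟩ := exists_evalSeries_eq_zero_of_isRoot hHm (MvPolynomial.C a)
    (by rw [hH0, eval_map, eval₂_hom, ha, map_zero])
    (by rw [hu']; exact (isUnit_iff_ne_zero.2 hu0).map MvPolynomial.C)
  have hymem := mem_weightedSubring_of_evalSeries_eq_zero (fun i => by
    rw [hH, coeff_map]
    exact lineHom_mem_weightedSubring w _) hy hu0 hya hu'
  obtain ⟨r, hr⟩ := exists_submatrix_det_ne_zero (expansionMatrix n (n * (n - 1)) y)
    (expansionMatrix_mulVec_eq_zero hHm hHp hHn hpos hHw hy)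
  obtain ⟨v, hv, hdet⟩ := MvPolynomial.exists_eval_ne_zero hr S (by
    refine (MvPolynomial.totalDegree_det_le _ (n * (n - 1)) fun i j => ?_).trans_lt
      (by simpa using hS)
    simp only [expansionMatrix, Matrix.submatrix_apply, Matrix.of_apply, id]
    have hmem : PowerSeries.X ^ j.1.2 * y ^ j.1.1 ∈ weightedSubring σ k :=
      mul_mem (pow_mem X_mem_weightedSubring _) (pow_mem hymem _)
    exact (hmem _).trans (Nat.lt_succ_iff.1 (r i).2))
  refine ⟨v, hv, ?_⟩
  let φ : MvPolynomial σ k →ₐ[k] k := MvPolynomial.aeval v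
  have hφe : (φ : MvPolynomial σ k →+* k) = MvPolynomial.eval v := by
    ext <;> simp [φ]
  set h := F.map (lineHom w v) with hh
  have hhH : H.map (mapRingHom (φ : MvPolynomial σ k →+* k)) = h := by
    rw [hH, Polynomial.map_map, mapRingHom_comp_lineHom, hh]
    congr 2
    funext i
    simp [φ]
  set z := PowerSeries.map (φ : MvPolynomial σ k →+* k) y with hz
  have hhz : evalSeries z h = 0 := by
    rw [← hhH, evalSeries_map, hy, map_zero]
  have hhm : h.Monic := hm.map _
  have hhn : h.natDegree = n := by rw [hh, hm.natDegree_map, hn]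
  have hhw : Wle h n := wle_map_lineHom _ _ hn.le hdeg
  have hker : ∀ g : k[X][X], Wle g (n - 1) → evalSeries z g = 0 → g = 0 := by
    intro g hgw hg0
    have hgU : ∀ i j, (g.coeff i).coeff j ≠ 0 → (i, j) ∈ wedge n n := fun i j hij => by
      rw [mem_wedge]
      have : ¬ n - 1 < i + j := fun h => hij (hgw i j h)
      simp only
      omega
    let d : wedge n n → k := fun u => (g.coeff u.1.1).coeff u.1.2
    have hMd : ((expansionMatrix n (n * (n - 1)) z).submatrix r id).mulVec d = 0 := by
      funext i
      have := coeff_evalSeries_biPoly z (wedge n n) (fun u => (g.coeff u.1).coeff u.2) (r i)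
      rw [biPoly_coeff_eq _ _ hgU, hg0, map_zero, ← Finset.sum_coe_sort] at this
      simp only [Matrix.mulVec, dotProduct, Matrix.submatrix_apply, expansionMatrix,
        Matrix.of_apply, id, Pi.zero_apply]
      exact this.symm
    have hdet' : ((expansionMatrix n (n * (n - 1)) z).submatrix r id).det ≠ 0 := by
      rw [← hφe] at hdet
      rw [hz, expansionMatrix_map]
      rw [RingHom.map_det] at hdet
      exact hdet
    have hd0 := Matrix.eq_zero_of_mulVec_eq_zero hdet' hMd
    rw [← biPoly_coeff_eq _ _ hgU, biPoly]
    refine Finset.sum_eq_zero fun u hu => ?_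
    have : (g.coeff u.1).coeff u.2 = 0 := congrFun hd0 ⟨u, hu⟩
    simp [this]
  rw [hhm.irreducible_iff_natDegree]
  refine ⟨fun h1 => ?_, fun g g' hg hg' hgg => ?_⟩
  · rw [h1, natDegree_one] at hhn
    omega
  by_contra! hne
  have hadd : g.natDegree + g'.natDegree = n := by rw [← hg.natDegree_mul hg', hgg, hhn]
  have hw1 : Wle g (n - 1) := (Wle.of_mul_left hg hg' (by rwa [hgg, hadd])).mono (by omega)
  have hw2 : Wle g' (n - 1) :=
    (Wle.of_mul_left hg' hg (by rwa [mul_comm, hgg, add_comm, hadd])).mono (by omega)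
  rw [← hgg, map_mul] at hhz
  rcases mul_eq_zero.1 hhz with h0 | h0
  · exact hg.ne_zero (hker g hw1 h0)
  · exact hg'.ne_zero (hker g' hw2 h0)

theorem card_wedge_self (n : ℕ) : 2 * (wedge n n).card = n * (n + 1) := by
  rw [card_wedge]
  induction n with
  | zero => simp
  | succ n ih =>
    rw [Finset.sum_range_succ', mul_add]
    simp only [Nat.sub_zero, Nat.add_sub_add_right]
    rw [ih]
    ring

theorem totalDegree_map_le {R S σ : Type*} [CommSemiring R] [CommSemiring S] (f : R →+* S)
    (p : MvPolynomial σ R) : (MvPolynomial.map f p).totalDegree ≤ p.totalDegree :=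
  Finset.sup_mono (MvPolynomial.support_map_subset f p)

/-- Over a large finite field, a geometrically irreducible polynomial restricts to a
geometrically irreducible polynomial on some line, separable above the base point. -/
theorem exists_line_irreducible {K σ : Type*} [Field K] [Fintype K] [Finite σ]
    {F : (MvPolynomial σ K)[X]} {n : ℕ} (hm : F.Monic) (hn : F.natDegree = n) (hn2 : 2 ≤ n)
    (hdeg : ∀ i, (F.coeff i).totalDegree ≤ n - i)
    (hirr : Irreducible (F.map (MvPolynomial.map (algebraMap K (AlgebraicClosure K)))))
    (hder : derivative F ≠ 0) (hK : n ^ 4 < Fintype.card K) :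
    ∃ w v : σ → K, (F.map (MvPolynomial.eval w)).Separable ∧
      Irreducible ((F.map (lineHom w v)).map (mapRingHom (algebraMap K (AlgebraicClosure K)))) := by
  classical
  let ι := algebraMap K (AlgebraicClosure K)
  have hιinj : Function.Injective ι := ι.injective
  have hirrK : Irreducible F := hm.irreducible_of_irreducible_map _ _ hirr
  obtain ⟨w, -, hw⟩ := exists_separable_map_eval hm hn (by omega)
    (fun i => (hdeg i).trans (by omega)) hirrK hder Finset.univ (by
      rw [Finset.card_univ]
      refine lt_of_le_of_lt ?_ hK
      calc (2 * n - 1) * n ≤ (n * n) * (n * n) := by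
            refine Nat.mul_le_mul ?_ (Nat.le_mul_of_pos_left _ (by omega))
            have := Nat.mul_le_mul_right n hn2
            omega
        _ = n ^ 4 := by ring)
  set Fb := F.map (MvPolynomial.map ι) with hFb
  have hFbm : Fb.Monic := hm.map _
  have hFbn : Fb.natDegree = n := by rw [hFb, hm.natDegree_map, hn]
  have hcomp : ∀ w : σ → K, (MvPolynomial.eval (ι ∘ w)).comp (MvPolynomial.map ι) =
      ι.comp (MvPolynomial.eval w) := fun w => by
    refine MvPolynomial.ringHom_ext (fun a => ?_) fun i => ?_ <;> simp
  have hspec : Fb.map (MvPolynomial.eval (ι ∘ w)) = (F.map (MvPolynomial.eval w)).map ι := by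
    rw [hFb, Polynomial.map_map, hcomp, Polynomial.map_map]
  have hsep : (Fb.map (MvPolynomial.eval (ι ∘ w))).Separable := by
    rw [hspec]; exact hw.map
  obtain ⟨a, ha⟩ := IsAlgClosed.exists_root (Fb.map (MvPolynomial.eval (ι ∘ w))) (by
    rw [hFbm.degree_map, degree_eq_natDegree hFbm.ne_zero, hFbn]
    exact_mod_cast (by omega : n ≠ 0))
  obtain ⟨v', hv', hv'irr⟩ := exists_irreducible_map_lineHom hFbm hFbn (by omega) (fun i => by
      rw [hFb, coeff_map]
      exact (totalDegree_map_le ι _).trans (hdeg i)) hirr (ι ∘ w) ha hsep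
    (Finset.univ.image ι) (by
      rw [Finset.card_image_of_injective _ hιinj, Finset.card_univ]
      refine lt_of_le_of_lt ?_ hK
      have h1 := card_wedge_self n
      have h2 : 2 * ((wedge n n).card * (n * (n - 1))) = n * (n + 1) * (n * (n - 1)) := by
        rw [← mul_assoc, h1]
      obtain ⟨m, rfl⟩ : ∃ m, n = m + 1 := ⟨n - 1, by omega⟩
      rw [Nat.add_sub_cancel] at h2 ⊢
      nlinarith [sq_nonneg (m : ℤ), Nat.zero_le m])
  simp only [Finset.mem_image, Finset.mem_univ, true_and] at hv'
  choose v hv using hv'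
  refine ⟨w, v, hw, ?_⟩
  have : (F.map (lineHom w v)).map (mapRingHom ι) = Fb.map (lineHom (ι ∘ w) v') := by
    rw [hFb, Polynomial.map_map, Polynomial.map_map]
    congr 1
    refine MvPolynomial.ringHom_ext (fun a => ?_) fun i => ?_
    · simp [lineHom_C]
    · simp [lineHom_X, hv]
  rw [this]
  exact hv'irr

theorem exists_exponent_not_dvd {K L σ : Type*} [Field K] [Field L] [PerfectField K] {p : ℕ}
    [Fact p.Prime] [CharP K p] (ι : K →+* L) {f : MvPolynomial σ K}
    (hirr : Irreducible (MvPolynomial.map ι f)) :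
    ∃ κ ∈ f.support, ∃ i, ¬ p ∣ κ i := by
  by_contra! h
  have : ExpChar K p := ExpChar.prime Fact.out
  have hp0 : p ≠ 0 := (Fact.out : p.Prime).ne_zero
  let g : MvPolynomial σ K := ∑ κ ∈ f.support, MvPolynomial.monomial
    (κ.mapRange (· / p) (Nat.zero_div p)) ((frobeniusEquiv K p).symm (f.coeff κ))
  have hg : g ^ p = f := by
    rw [sum_pow_char]
    conv_rhs => rw [f.as_sum]
    refine Finset.sum_congr rfl fun κ hκ => ?_
    rw [MvPolynomial.monomial_pow, frobeniusEquiv_symm_pow_p]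
    have : p • κ.mapRange (· / p) (Nat.zero_div p) = κ := by
      ext i
      simp [Nat.mul_div_cancel' (h κ hκ i)]
    rw [this]
  rw [← hg, map_pow] at hirr
  exact not_irreducible_pow (Fact.out : p.Prime).ne_one hirr

theorem finSuccEquiv_map {R S : Type*} [CommRing R] [CommRing S] (φ : R →+* S) {m : ℕ}
    (f : MvPolynomial (Fin (m + 1)) R) :
    MvPolynomial.finSuccEquiv S m (MvPolynomial.map φ f) =
      (MvPolynomial.finSuccEquiv R m f).map (MvPolynomial.map φ) := by
  ext i κ
  rw [MvPolynomial.finSuccEquiv_coeff_coeff, MvPolynomial.coeff_map, coeff_map,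
    MvPolynomial.coeff_map, MvPolynomial.finSuccEquiv_coeff_coeff]

/-- A geometrically irreducible form in the sense of functions over a large finite field has a
nontrivial zero. -/
theorem false_of_anisotropic_aux {K : Type*} [Field K] [Fintype K] {p : ℕ} [Fact p.Prime]
    [CharP K p] {m n : ℕ} (hn2 : 2 ≤ n) (f : MvPolynomial (Fin (m + 1)) K)
    (htd : f.totalDegree ≤ n)
    (hhom : ∀ (a : K) (x : Fin (m + 1) → K),
      MvPolynomial.eval (a • x) f = a ^ n * MvPolynomial.eval x f)
    (hz : ∀ x, MvPolynomial.eval x f = 0 → x = 0)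
    (hirr : Irreducible (MvPolynomial.map (algebraMap K (AlgebraicClosure K)) f))
    (hκ : ∃ κ ∈ f.support, ¬ p ∣ κ 0) (hK : n ^ 4 < Fintype.card K)
    {r e α : ℕ} (hQ : Fintype.card K = p ^ r * p ^ e)
    (hα : n ≤ α + 1) (hP : n ≤ p ^ r) (hαs : n * α < p ^ e)
    (hG : n * (n - 1) * (α + 1 + p ^ r) ≤ 2 * ((α + 1) * p ^ r))
    (hs : p ^ e * (p ^ r - 1) + α + n * (n - 1) < p ^ r * p ^ e) : False := by
  have hnK : n < Fintype.card K := lt_of_le_of_lt (Nat.le_self_pow (by norm_num) n) hK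
  set F0 := MvPolynomial.finSuccEquiv K m f with hF0
  have hF0deg : ∀ i, F0.coeff i ≠ 0 → (F0.coeff i).totalDegree + i ≤ n := fun i hi =>
    (MvPolynomial.totalDegree_coeff_finSuccEquiv_add_le f i hi).trans htd
  have hF0n : F0.natDegree ≤ n := natDegree_le_iff_coeff_eq_zero.2 fun i hi => by
    by_contra h
    have := hF0deg i h
    omega
  set q : K[X] := F0.map (MvPolynomial.eval 0) with hq
  have hqev : ∀ y, q.eval y = MvPolynomial.eval (Fin.cons y (0 : Fin m → K)) f := fun y =>
    (MvPolynomial.eval_eq_eval_mv_eval' _ _ _).symm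
  set c0 := q.eval 1 with hc0
  have hc00 : c0 ≠ 0 := by
    intro h
    rw [hc0, hqev] at h
    exact one_ne_zero (α := K) (by simpa using congrFun (hz _ h) 0)
  have hqX : q = C c0 * X ^ n := by
    refine eq_of_natDegree_lt_card_of_eval_eq _ _ Function.injective_id (fun y => ?_) ?_
    · rw [id, eval_mul, eval_C, eval_pow, eval_X, hqev, hc0, hqev, mul_comm, ← hhom]
      congr 1
      congr 1
      funext j
      refine Fin.cases ?_ (fun j => ?_) j <;> simp
    · refine lt_of_le_of_lt (max_le ?_ (natDegree_C_mul_X_pow_le _ _)) hnK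
      exact natDegree_map_le.trans hF0n
  have hcn : F0.coeff n = MvPolynomial.C c0 := by
    have h1 : MvPolynomial.eval 0 (F0.coeff n) = c0 := by
      have := congrArg (fun g => g.coeff n) hqX
      simpa [hq] using this
    have h2 : F0.coeff n ≠ 0 := by
      intro h
      rw [h, map_zero] at h1
      exact hc00 h1.symm
    have h3 : (F0.coeff n).totalDegree = 0 := by
      have := hF0deg n h2
      omega
    rw [MvPolynomial.totalDegree_eq_zero_iff_eq_C] at h3
    rw [h3, MvPolynomial.eval_C] at h1
    rw [h3, h1]
  have hu : (C (MvPolynomial.C c0⁻¹) : (MvPolynomial (Fin m) K)[X]) *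
      C (MvPolynomial.C c0) = 1 := by
    rw [← C_mul, ← map_mul, inv_mul_cancel₀ hc00, map_one, C_1]
  set F := C (MvPolynomial.C c0⁻¹) * F0 with hF
  have hFF0 : F0 = C (MvPolynomial.C c0) * F := by
    rw [hF, ← mul_assoc, mul_comm (C (MvPolynomial.C c0)), hu, one_mul]
  have hFc : F.coeff n = 1 := by
    rw [hF, coeff_C_mul, hcn, ← map_mul, inv_mul_cancel₀ hc00, map_one]
  have hFle : F.natDegree ≤ n := (natDegree_C_mul_le _ _).trans hF0n
  have hFm : F.Monic := monic_of_natDegree_le_of_coeff_eq_one n hFle hFc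
  have hFn : F.natDegree = n :=
    natDegree_eq_of_le_of_coeff_ne_zero hFle (by rw [hFc]; exact one_ne_zero)
  have hFdeg : ∀ i, (F.coeff i).totalDegree ≤ n - i := fun i => by
    by_cases h : F0.coeff i = 0
    · rw [hF, coeff_C_mul, h, mul_zero, MvPolynomial.totalDegree_zero]
      omega
    · have := hF0deg i h
      rw [hF, coeff_C_mul]
      refine (MvPolynomial.totalDegree_mul _ _).trans ?_
      rw [MvPolynomial.totalDegree_C]
      omega
  have hFirr : Irreducible (F.map (MvPolynomial.map (algebraMap K (AlgebraicClosure K)))) := by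
    have h1 : Irreducible (F0.map (MvPolynomial.map (algebraMap K (AlgebraicClosure K)))) := by
      rw [hF0, ← finSuccEquiv_map]
      exact (MulEquiv.irreducible_iff (MvPolynomial.finSuccEquiv (AlgebraicClosure K) m)).2 hirr
    rw [hF, Polynomial.map_mul]
    refine (irreducible_isUnit_mul ?_).2 h1
    exact (IsUnit.of_mul_eq_one _ hu).map (mapRingHom _)
  have hder : derivative F ≠ 0 := by
    obtain ⟨κ, hκ, hκp⟩ := hκ
    intro h0
    have h1 := congrArg (fun g => g.coeff (κ 0 - 1)) h0
    have hpos : κ 0 - 1 + 1 = κ 0 := by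
      have : κ 0 ≠ 0 := fun h => hκp (by rw [h]; exact dvd_zero p)
      omega
    simp only [coeff_derivative, coeff_zero] at h1
    have hc : ((κ 0 - 1 : ℕ) : MvPolynomial (Fin m) K) + 1 = ((κ 0 : ℕ) : _) := by
      exact_mod_cast congrArg (Nat.cast (R := MvPolynomial (Fin m) K)) hpos
    rw [hc, hpos, mul_eq_zero] at h1
    rcases h1 with h1 | h1
    · have h2 : F0.coeff (κ 0) = 0 := by rw [hFF0, coeff_C_mul, h1, mul_zero]
      have h3 := MvPolynomial.finSuccEquiv_coeff_coeff κ.tail f (κ 0)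
      rw [← hF0, h2, Finsupp.cons_tail, MvPolynomial.coeff_zero] at h3
      exact (MvPolynomial.mem_support_iff.1 hκ) h3.symm
    · exact hκp ((CharP.cast_eq_zero_iff _ p _).1 h1)
  obtain ⟨w, v, hsep, hvirr⟩ := exists_line_irreducible hFm hFn hn2 hFdeg hFirr hder hK
  have hspec : ∀ x, (F.map (lineHom w v)).map (evalRingHom x) =
      F.map (MvPolynomial.eval (w + x • v)) := fun x => by
    rw [Polynomial.map_map]
    congr 1
    refine MvPolynomial.ringHom_ext (fun a => ?_) fun i => ?_
    · simp [lineHom_C]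
    · simp [lineHom_X]
      ring
  refine false_of_forall_not_isRoot (hFm.map _) (by rw [hFm.natDegree_map, hFn]) hn2
    (wle_map_lineHom w v hFle hFdeg) hvirr ?_ ?_ hQ hα hP hαs hG hs
  · rw [hspec, zero_smul, add_zero]
    exact hsep
  · intro x hx y hy
    rw [hspec] at hx hy
    have h1 : MvPolynomial.eval (Fin.cons y (w + x • v)) f = 0 := by
      rw [MvPolynomial.eval_eq_eval_mv_eval', ← hF0, hFF0, Polynomial.map_mul, eval_mul, hy,
        mul_zero]
    have h2 : w + x • v = 0 := by
      have := hz _ h1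
      funext j
      simpa using congrFun this j.succ
    rw [h2] at hx
    have h3 : F.map (MvPolynomial.eval 0) = X ^ n := by
      rw [hF, Polynomial.map_mul, ← hq, hqX, Polynomial.map_C, MvPolynomial.eval_C, ← mul_assoc,
        ← C_mul, inv_mul_cancel₀ hc00, C_1, one_mul]
    rw [h3] at hx
    have := (hx.of_pow not_isUnit_X (by omega)).2
    omega

theorem false_of_anisotropic {K : Type*} [Field K] [Fintype K] {p : ℕ} [Fact p.Prime]
    [CharP K p] {m n : ℕ} (hn2 : 2 ≤ n) (f : MvPolynomial (Fin (m + 1)) K)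
    (htd : f.totalDegree ≤ n)
    (hhom : ∀ (a : K) (x : Fin (m + 1) → K),
      MvPolynomial.eval (a • x) f = a ^ n * MvPolynomial.eval x f)
    (hz : ∀ x, MvPolynomial.eval x f = 0 → x = 0)
    (hirr : Irreducible (MvPolynomial.map (algebraMap K (AlgebraicClosure K)) f))
    (hK : n ^ 4 < Fintype.card K)
    {r e α : ℕ} (hQ : Fintype.card K = p ^ r * p ^ e)
    (hα : n ≤ α + 1) (hP : n ≤ p ^ r) (hαs : n * α < p ^ e)
    (hG : n * (n - 1) * (α + 1 + p ^ r) ≤ 2 * ((α + 1) * p ^ r))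
    (hs : p ^ e * (p ^ r - 1) + α + n * (n - 1) < p ^ r * p ^ e) : False := by
  obtain ⟨κ, hκ, i, hi⟩ := exists_exponent_not_dvd (p := p) _ hirr
  let τ : Equiv.Perm (Fin (m + 1)) := Equiv.swap 0 i
  refine false_of_anisotropic_aux hn2 (MvPolynomial.rename τ f)
    ((MvPolynomial.totalDegree_rename_le _ _).trans htd) (fun a x => ?_) (fun x hx => ?_) ?_
    ⟨κ.mapDomain τ, ?_, ?_⟩ hK hQ hα hP hαs hG hs
  · rw [MvPolynomial.eval_rename, MvPolynomial.eval_rename, ← hhom]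
    rfl
  · rw [MvPolynomial.eval_rename] at hx
    funext j
    have := congrFun (hz _ hx) (τ.symm j)
    simpa using this
  · rw [MvPolynomial.map_rename]
    exact (MulEquiv.irreducible_iff (MvPolynomial.renameEquiv _ τ)).2 hirr
  · rw [MvPolynomial.mem_support_iff, MvPolynomial.coeff_rename_mapDomain _ τ.injective]
    exact MvPolynomial.mem_support_iff.1 hκ
  · have : κ.mapDomain τ (τ i) = κ i := Finsupp.mapDomain_apply τ.injective _ _
    rw [show τ i = 0 from Equiv.swap_apply_right 0 i] at this
    rwa [this]

theorem prod_range_ringAut_dvd {A : Type*} [CommRing A] [IsDomain A]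
    [UniqueFactorizationMonoid A] (τ : RingAut A) {F h : A} (hF : τ F = F)
    (hh : Irreducible h) (hdvd : h ∣ F) (N : ℕ)
    (hN : ∀ i, 0 < i → i < N → ¬ Associated ((τ ^ i) h) h) :
    ∏ i ∈ Finset.range N, (τ ^ i) h ∣ F := by
  have hFi : ∀ i, (τ ^ i) F = F := fun i => by
    induction i with
    | zero => rfl
    | succ i ih => rw [pow_succ, RingAut.mul_apply, hF, ih]
  have hirr : ∀ i, Irreducible ((τ ^ i) h) := fun i =>
    (MulEquiv.irreducible_iff (τ ^ i)).2 hh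
  have hne : ∀ i j, i < j → j < N → ¬ Associated ((τ ^ j) h) ((τ ^ i) h) := by
    intro i j hij hj hass
    refine hN (j - i) (by omega) (by omega) ?_
    have h1 : (τ ^ j) h = (τ ^ i) ((τ ^ (j - i)) h) := by
      rw [← RingAut.mul_apply, ← pow_add, show i + (j - i) = j by omega]
    rw [h1] at hass
    have := hass.map (τ ^ i).symm
    rwa [RingEquiv.symm_apply_apply, RingEquiv.symm_apply_apply] at this
  refine Finset.prod_dvd_of_isRelPrime (fun i hi j hj hij => ?_) fun i _ => ?_
  · rw [Finset.mem_coe, Finset.mem_range] at hi hj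
    refine ((hirr i).isRelPrime_iff_not_dvd).2 fun hd => ?_
    have hass := (hirr i).associated_of_dvd (hirr j) hd
    rcases lt_or_gt_of_ne hij with h1 | h1
    · exact hne i j h1 hj hass.symm
    · exact hne j i h1 hi hass
  · have := map_dvd (τ ^ i) hdvd
    rwa [hFi] at this

theorem exists_prod_orbit_dvd {L σ : Type*} [Field L] (τ : RingAut (MvPolynomial σ L))
    (hτ : ∀ g, (τ g).totalDegree = g.totalDegree) {F h : MvPolynomial σ L} (hF0 : F ≠ 0)
    (hF : τ F = F) (hh : Irreducible h) (hdvd : h ∣ F) :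
    ∃ e, 0 < e ∧ Associated ((τ ^ e) h) h ∧ ∃ H, H ∣ F ∧ Associated (τ H) H ∧
      H.totalDegree = e * h.totalDegree := by
  have hdeg : ∀ i, ((τ ^ i) h).totalDegree = h.totalDegree := fun i => by
    induction i with
    | zero => rfl
    | succ i ih => rw [pow_succ', RingAut.mul_apply, hτ, ih]
  have hdegprod : ∀ N, (∏ i ∈ Finset.range N, (τ ^ i) h).totalDegree = N * h.totalDegree := by
    intro N
    induction N with
    | zero => simp
    | succ N ih =>
      rw [Finset.prod_range_succ, MvPolynomial.totalDegree_mul_of_isDomain, ih, hdeg]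
      · ring
      · exact Finset.prod_ne_zero_iff.2 fun i _ =>
          (map_ne_zero_iff _ (τ ^ i).injective).2 hh.ne_zero
      · exact (map_ne_zero_iff _ (τ ^ N).injective).2 hh.ne_zero
  have hle : ∀ G, G ∣ F → G.totalDegree ≤ F.totalDegree := by
    rintro G ⟨E, rfl⟩
    rw [MvPolynomial.totalDegree_mul_of_isDomain (left_ne_zero_of_mul hF0)
      (right_ne_zero_of_mul hF0)]
    omega
  have hpos : 0 < h.totalDegree := by
    rw [Nat.pos_iff_ne_zero]
    intro h0
    refine hh.not_isUnit ?_
    rw [MvPolynomial.totalDegree_eq_zero_iff_eq_C] at h0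
    have h1 : h.coeff 0 ≠ 0 := fun h1 => hh.ne_zero (by rw [h0, h1, map_zero])
    rw [h0]
    exact (IsUnit.mk0 _ h1).map MvPolynomial.C
  have hex : ∃ e, 0 < e ∧ Associated ((τ ^ e) h) h := by
    by_contra! hcon
    have h1 := hle _ (prod_range_ringAut_dvd τ hF hh hdvd (F.totalDegree + 1)
      fun i hi _ => hcon i hi)
    rw [hdegprod] at h1
    nlinarith
  classical
  obtain ⟨he, hass⟩ := Nat.find_spec hex
  refine ⟨Nat.find hex, he, hass, _, prod_range_ringAut_dvd τ hF hh hdvd _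
    fun i hi hlt hi' => Nat.find_min hex hlt ⟨hi, hi'⟩, ?_, hdegprod _⟩
  set e := Nat.find hex
  obtain ⟨e', he'⟩ : ∃ e', e = e' + 1 := ⟨e - 1, by omega⟩
  rw [map_prod]
  have h1 : ∀ i, τ ((τ ^ i) h) = (τ ^ (i + 1)) h := fun i => by
    rw [pow_succ', RingAut.mul_apply]
  simp_rw [h1]
  rw [he', Finset.prod_range_succ, Finset.prod_range_succ' (fun i => (τ ^ i) h)]
  refine Associated.mul_mul (Associated.refl _) ?_
  rw [← he']
  simpa using hass

theorem mem_range_algebraMap_of_pow_card_eq {K L : Type*} [Field K] [Fintype K] [Field L]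
    [Algebra K L] {a : L} (ha : a ^ Fintype.card K = a) : a ∈ (algebraMap K L).range := by
  classical
  have h0 : (X ^ Fintype.card K - X : L[X]) ≠ 0 :=
    FiniteField.X_pow_card_sub_X_ne_zero L Fintype.one_lt_card
  have hsub : Finset.univ.image (algebraMap K L) ⊆
      (X ^ Fintype.card K - X : L[X]).roots.toFinset := by
    intro b hb
    obtain ⟨c, -, rfl⟩ := Finset.mem_image.1 hb
    rw [Multiset.mem_toFinset, mem_roots h0, IsRoot.def]
    simp [← map_pow, FiniteField.pow_card]
  have heq := Finset.eq_of_subset_of_card_le hsub (by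
    rw [Finset.card_image_of_injective _ (algebraMap K L).injective, Finset.card_univ]
    refine (Multiset.toFinset_card_le _).trans ((card_roots' _).trans ?_)
    rw [FiniteField.X_pow_card_sub_X_natDegree_eq L Fintype.one_lt_card])
  have : a ∈ (X ^ Fintype.card K - X : L[X]).roots.toFinset := by
    rw [Multiset.mem_toFinset, mem_roots h0, IsRoot.def]
    simp [ha]
  rw [← heq] at this
  obtain ⟨c, -, hc⟩ := Finset.mem_image.1 this
  exact ⟨c, hc⟩

theorem exists_map_eq_of_coeff_pow_card {K L σ : Type*} [Field K] [Fintype K] [Field L]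
    [Algebra K L] {h : MvPolynomial σ L} (hh : ∀ κ, h.coeff κ ^ Fintype.card K = h.coeff κ) :
    ∃ h0 : MvPolynomial σ K, MvPolynomial.map (algebraMap K L) h0 = h := by
  refine MvPolynomial.mem_range_map_iff_coeffs_subset.2 ?_
  intro a ha
  obtain ⟨κ, -, rfl⟩ := MvPolynomial.mem_coeffs_iff.1 ha
  exact mem_range_algebraMap_of_pow_card_eq (hh κ)

/-- Chevalley–Warning: an anisotropic form of degree at most the number of variables has no proper
factors. -/
theorem totalDegree_eq_zero_of_anisotropic {K σ : Type*} [Field K] [Fintype K] [Fintype σ]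
    {f g h : MvPolynomial σ K} (hf : f = g * h) (hf0 : f ≠ 0)
    (htd : f.totalDegree ≤ Fintype.card σ) (h0 : MvPolynomial.eval 0 f = 0)
    (hz : ∀ x, MvPolynomial.eval x f = 0 → x = 0) :
    g.totalDegree = 0 ∨ h.totalDegree = 0 := by
  classical
  obtain ⟨p, hp⟩ := CharP.exists K
  have hpp : p.Prime := CharP.char_is_prime K p
  have key : ∀ g' : MvPolynomial σ K, g'.totalDegree < Fintype.card σ →
      MvPolynomial.eval 0 g' = 0 → (∀ x, MvPolynomial.eval x g' = 0 → x = 0) → False := by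
    intro g' hg hg0 hgz
    have h1 := char_dvd_card_solutions p hg
    have h2 : Fintype.card {x : σ → K // MvPolynomial.eval x g' = 0} = 1 := by
      rw [Fintype.card_eq_one_iff]
      exact ⟨⟨0, hg0⟩, fun y => Subtype.ext (hgz _ y.2)⟩
    rw [h2] at h1
    exact hpp.one_lt.ne' (Nat.dvd_one.1 h1)
  by_contra! hcon
  subst hf
  rw [MvPolynomial.totalDegree_mul_of_isDomain (left_ne_zero_of_mul hf0)
    (right_ne_zero_of_mul hf0)] at htd
  rw [map_mul, mul_eq_zero] at h0
  rcases h0 with h0 | h0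
  · exact key g (by omega) h0 fun x hx => hz x (by rw [map_mul, hx, zero_mul])
  · exact key h (by omega) h0 fun x hx => hz x (by rw [map_mul, hx, mul_zero])

theorem isUnit_of_totalDegree_eq_zero {L σ : Type*} [Field L] {h : MvPolynomial σ L}
    (h0 : h ≠ 0) (hd : h.totalDegree = 0) : IsUnit h := by
  rw [MvPolynomial.totalDegree_eq_zero_iff_eq_C] at hd
  have h1 : h.coeff 0 ≠ 0 := fun h1 => h0 (by rw [hd, h1, map_zero])
  rw [hd]
  exact (IsUnit.mk0 _ h1).map MvPolynomial.C

theorem totalDegree_eq_zero_of_isUnit {L σ : Type*} [Field L] {h : MvPolynomial σ L}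
    (hu : IsUnit h) : h.totalDegree = 0 :=
  (MvPolynomial.isUnit_iff_totalDegree_of_isReduced.1 hu).2

theorem card_le_totalDegree_of_anisotropic {K σ : Type*} [Field K] [Fintype K] [Fintype σ]
    {f : MvPolynomial σ K} (h0 : MvPolynomial.eval 0 f = 0)
    (hz : ∀ x, MvPolynomial.eval x f = 0 → x = 0) : Fintype.card σ ≤ f.totalDegree := by
  classical
  by_contra! hlt
  obtain ⟨p, hp⟩ := CharP.exists K
  have h1 := char_dvd_card_solutions p hlt
  have h2 : Fintype.card {x : σ → K // MvPolynomial.eval x f = 0} = 1 := by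
    rw [Fintype.card_eq_one_iff]
    exact ⟨⟨0, h0⟩, fun y => Subtype.ext (hz _ y.2)⟩
  rw [h2] at h1
  exact (CharP.char_is_prime K p).one_lt.ne' (Nat.dvd_one.1 h1)

theorem isUnit_or_isUnit_of_frobenius_associated {K L σ : Type*} [Field K] [Fintype K]
    [Fintype σ] [Nonempty σ] [Field L] [Algebra K L] {f : MvPolynomial σ K}
    (htd : f.totalDegree ≤ Fintype.card σ) (h0 : MvPolynomial.eval 0 f = 0)
    (hz : ∀ x, MvPolynomial.eval x f = 0 → x = 0) {φ : L →+* L}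
    (hφ : ∀ a, φ a = a ^ Fintype.card K) {g h : MvPolynomial σ L}
    (hf : MvPolynomial.map (algebraMap K L) f = h * g)
    (hass : Associated (MvPolynomial.map φ h) h) : IsUnit h ∨ IsUnit g := by
  have hφK : φ.comp (algebraMap K L) = algebraMap K L := RingHom.ext fun a => by
    rw [RingHom.comp_apply, hφ, ← map_pow, FiniteField.pow_card]
  have hev : MvPolynomial.eval (fun _ => 1) f ≠ 0 := fun h1 => by
    obtain ⟨i⟩ := ‹Nonempty σ›
    exact one_ne_zero (α := K) (congrFun (hz _ h1) i)
  have hf0 : f ≠ 0 := fun h1 => hev (by rw [h1, map_zero])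
  have hevL : ∀ P : MvPolynomial σ L, MvPolynomial.eval (fun _ => 1) (MvPolynomial.map φ P) =
      φ (MvPolynomial.eval (fun _ => 1) P) := fun P => by
    rw [MvPolynomial.eval_map, MvPolynomial.eval, MvPolynomial.coe_eval₂Hom, MvPolynomial.hom_eval₂]
    simp
  have hevF : MvPolynomial.eval (fun _ => 1) (MvPolynomial.map (algebraMap K L) f) ≠ 0 := by
    have h1 : MvPolynomial.eval (fun _ => 1) (MvPolynomial.map (algebraMap K L) f) =
        algebraMap K L (MvPolynomial.eval (fun _ => 1) f) := by
      rw [MvPolynomial.eval_map, MvPolynomial.eval, MvPolynomial.coe_eval₂Hom,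
        MvPolynomial.hom_eval₂]
      simp
    rw [h1]
    exact (_root_.map_ne_zero _).2 hev
  set c := MvPolynomial.eval (fun _ => 1) h with hc
  have hc0 : c ≠ 0 := by
    intro h1
    rw [hf, map_mul, ← hc, h1, zero_mul] at hevF
    exact hevF rfl
  have hC : (MvPolynomial.C c⁻¹ : MvPolynomial σ L) * MvPolynomial.C c = 1 := by
    rw [← map_mul, inv_mul_cancel₀ hc0, map_one]
  have huc : IsUnit (MvPolynomial.C c : MvPolynomial σ L) := (IsUnit.mk0 _ hc0).map MvPolynomial.C
  have huc' : IsUnit (MvPolynomial.C c⁻¹ : MvPolynomial σ L) := IsUnit.of_mul_eq_one _ hC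
  set h' := MvPolynomial.C c⁻¹ * h with hh'
  set g' := MvPolynomial.C c * g with hg'
  have hF : MvPolynomial.map (algebraMap K L) f = h' * g' := by
    rw [hf, hh', hg']
    linear_combination (-(h * g)) * hC
  have hh1 : MvPolynomial.eval (fun _ => 1) h' = 1 := by
    rw [hh', map_mul, MvPolynomial.eval_C, inv_mul_cancel₀ hc0]
  have hhass : Associated h h' := associated_unit_mul_right _ _ huc'
  have hass' : Associated h' (MvPolynomial.map φ h') :=
    hhass.symm.trans (hass.symm.trans (hhass.map (MvPolynomial.map φ)))
  have hfix : MvPolynomial.map φ h' = h' := by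
    obtain ⟨u, hu⟩ := hass'
    have h1 := congrArg (MvPolynomial.eval (fun _ => 1)) hu
    have h2 := (MvPolynomial.totalDegree_eq_zero_iff_eq_C).1
      (totalDegree_eq_zero_of_isUnit u.isUnit)
    rw [map_mul, hh1, hevL, hh1, map_one, one_mul, h2, MvPolynomial.eval_C] at h1
    rw [← hu, h2, h1, map_one, mul_one]
  have hh0 : h' ≠ 0 := fun h1 => by
    rw [h1, map_zero] at hh1
    exact zero_ne_one hh1
  have hgfix : MvPolynomial.map φ g' = g' := by
    have h1 := congrArg (MvPolynomial.map φ) hF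
    rw [MvPolynomial.map_map, hφK, map_mul, hfix, hF] at h1
    exact (mul_left_cancel₀ hh0 h1).symm
  have hco : ∀ P : MvPolynomial σ L, MvPolynomial.map φ P = P →
      ∀ κ, P.coeff κ ^ Fintype.card K = P.coeff κ := fun P hP κ => by
    conv_rhs => rw [← hP, MvPolynomial.coeff_map, hφ]
  obtain ⟨h₀, hh₀⟩ := exists_map_eq_of_coeff_pow_card (K := K) (hco h' hfix)
  obtain ⟨g₀, hg₀⟩ := exists_map_eq_of_coeff_pow_card (K := K) (hco g' hgfix)
  have hfac : f = h₀ * g₀ := by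
    apply MvPolynomial.map_injective _ (algebraMap K L).injective
    rw [hF, map_mul, hh₀, hg₀]
  have hh₀0 : h₀ ≠ 0 := fun h1 => hf0 (by rw [hfac, h1, zero_mul])
  have hg₀0 : g₀ ≠ 0 := fun h1 => hf0 (by rw [hfac, h1, mul_zero])
  rcases totalDegree_eq_zero_of_anisotropic hfac hf0 htd h0 hz with h1 | h1
  · left
    have := (isUnit_of_totalDegree_eq_zero hh₀0 h1).map (MvPolynomial.map (algebraMap K L))
    rw [hh₀] at this
    exact isUnit_of_mul_isUnit_right this
  · right
    have := (isUnit_of_totalDegree_eq_zero hg₀0 h1).map (MvPolynomial.map (algebraMap K L))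
    rw [hg₀] at this
    exact isUnit_of_mul_isUnit_right this

/-- The `p^k`-Frobenius on coefficients composed with a permutation of the variables. -/
noncomputable def frobRename (L : Type*) {σ : Type*} [Field L] [PerfectField L] (p k : ℕ)
    [ExpChar L p] (s : Equiv.Perm σ) : RingAut (MvPolynomial σ L) :=
  (MvPolynomial.mapEquiv σ (iterateFrobeniusEquiv L p k)).trans
    (MvPolynomial.renameEquiv L s).toRingEquiv

theorem frobRename_apply {L σ : Type*} [Field L] [PerfectField L] (p k : ℕ)
    [ExpChar L p] (s : Equiv.Perm σ) (g : MvPolynomial σ L) :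
    frobRename L p k s g = MvPolynomial.rename s (MvPolynomial.map (iterateFrobenius L p k) g) :=
  rfl

theorem frobRename_pow_apply {L σ : Type*} [Field L] [PerfectField L] (p k : ℕ)
    [ExpChar L p] (s : Equiv.Perm σ) (g : MvPolynomial σ L) (i : ℕ) :
    (frobRename L p k s ^ i) g = MvPolynomial.rename (s ^ i : Equiv.Perm σ)
      (MvPolynomial.map (iterateFrobenius L p (k * i)) g) := by
  induction i with
  | zero =>
    rw [pow_zero, pow_zero, mul_zero, iterateFrobenius_zero, MvPolynomial.map_id]
    exact (MvPolynomial.rename_id_apply g).symm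
  | succ i ih =>
    rw [pow_succ', RingAut.mul_apply, ih, frobRename_apply, MvPolynomial.map_rename,
      MvPolynomial.rename_rename, MvPolynomial.map_map, pow_succ']
    have h1 : (iterateFrobenius L p k).comp (iterateFrobenius L p (k * i)) =
        iterateFrobenius L p (k * (i + 1)) := by
      refine RingHom.ext fun a => ?_
      simp only [RingHom.comp_apply, iterateFrobenius_def, ← pow_mul, mul_add, mul_one, pow_add]
    rw [h1]
    rfl

theorem irreducible_map_of_anisotropic {K L σ : Type*} [Field K] [Fintype K]
    [Fintype σ] [Nonempty σ] [Field L] [PerfectField L] [Algebra K L] {p k n : ℕ} [ExpChar L p]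
    [ExpChar K p]
    (hQ : Fintype.card K = p ^ (k * n)) (hn : Fintype.card σ = n) {s : Equiv.Perm σ}
    (hs : s ^ n = 1) {f : MvPolynomial σ K}
    (htd : f.totalDegree ≤ n) (h0 : MvPolynomial.eval 0 f = 0)
    (hz : ∀ x, MvPolynomial.eval x f = 0 → x = 0)
    (hfs : MvPolynomial.rename s (MvPolynomial.map (iterateFrobenius K p k) f) = f) :
    Irreducible (MvPolynomial.map (algebraMap K L) f) := by
  subst hn
  set F := MvPolynomial.map (algebraMap K L) f with hFdef
  have hn0 : 0 < Fintype.card σ := Fintype.card_pos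
  have hdegf : f.totalDegree = Fintype.card σ :=
    le_antisymm htd (card_le_totalDegree_of_anisotropic h0 hz)
  have hdegF : F.totalDegree = Fintype.card σ := by
    rw [← hdegf, MvPolynomial.totalDegree, MvPolynomial.totalDegree, hFdef,
      MvPolynomial.support_map_of_injective _ (algebraMap K L).injective]
  have hF0 : F ≠ 0 := fun h1 => by
    rw [h1, MvPolynomial.totalDegree_zero] at hdegF
    omega
  have hFu : ¬ IsUnit F := fun h1 => by
    have := totalDegree_eq_zero_of_isUnit h1
    omega
  set τ := frobRename L p k s with hτ
  have hτF : τ F = F := by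
    rw [hτ, frobRename_apply, hFdef, MvPolynomial.map_map]
    conv_rhs => rw [← hfs, MvPolynomial.map_rename, MvPolynomial.map_map]
    have h1 : (iterateFrobenius L p k).comp (algebraMap K L) =
        (algebraMap K L).comp (iterateFrobenius K p k) := by
      refine RingHom.ext fun a => ?_
      simp [iterateFrobenius_def]
    rw [h1]
  have hτdeg : ∀ g, (τ g).totalDegree = g.totalDegree := fun g => by
    rw [hτ, frobRename_apply]
    have h1 := MvPolynomial.totalDegree_renameEquiv s
      (MvPolynomial.map (iterateFrobenius L p k) g)
    rw [MvPolynomial.renameEquiv_apply] at h1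
    rw [h1, MvPolynomial.totalDegree, MvPolynomial.totalDegree,
      MvPolynomial.support_map_of_injective _ (iterateFrobenius L p k).injective]
  have hτn : ∀ g, (τ ^ Fintype.card σ) g =
      MvPolynomial.map (iterateFrobenius L p (k * Fintype.card σ)) g := fun g => by
    rw [hτ, frobRename_pow_apply, hs]
    exact MvPolynomial.rename_id_apply _
  have hφ : ∀ a : L, iterateFrobenius L p (k * Fintype.card σ) a = a ^ Fintype.card K :=
    fun a => by rw [iterateFrobenius_def, hQ]
  have hiter : ∀ (ρ : RingAut (MvPolynomial σ L)) (g : MvPolynomial σ L),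
      Associated (ρ g) g → ∀ i, Associated ((ρ ^ i) g) g := by
    intro ρ g hg i
    induction i with
    | zero => exact Associated.refl _
    | succ i ih =>
      rw [pow_succ', RingAut.mul_apply]
      exact (ih.map ρ).trans hg
  obtain ⟨h, hh, hdvd⟩ := WfDvdMonoid.exists_irreducible_factor hFu hF0
  obtain ⟨e, he, hass, H, ⟨G, hG⟩, hH, hHdeg⟩ := exists_prod_orbit_dvd τ hτdeg hF0 hτF hh hdvd
  have hhpos : h.totalDegree ≠ 0 := fun h1 =>
    hh.not_isUnit (isUnit_of_totalDegree_eq_zero hh.ne_zero h1)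
  have hGu : IsUnit G := by
    refine (isUnit_or_isUnit_of_frobenius_associated htd h0 hz hφ hG ?_).resolve_left fun h1 => ?_
    · rw [← hτn]
      exact hiter τ H hH _
    · have := totalDegree_eq_zero_of_isUnit h1
      rw [hHdeg, mul_eq_zero] at this
      omega
  have hen : e ∣ Fintype.card σ := by
    rw [← hdegF, hG, MvPolynomial.totalDegree_mul_of_isDomain
      (fun h1 => hF0 (by rw [hG, h1, zero_mul])) hGu.ne_zero,
      totalDegree_eq_zero_of_isUnit hGu, hHdeg, add_zero]
    exact dvd_mul_right _ _
  obtain ⟨g, hg⟩ := hdvd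
  obtain ⟨c, hc⟩ := hen
  have hgu : IsUnit g := by
    refine (isUnit_or_isUnit_of_frobenius_associated htd h0 hz hφ hg ?_).resolve_left hh.not_isUnit
    rw [← hτn, hc, pow_mul]
    exact hiter _ h hass c
  rw [hg]
  exact (irreducible_mul_isUnit hgu).2 hh

theorem sigmaTwist_iterate_apply (q : ℕ) {n : ℕ} {K : Type*} [Field K]
    (M : Matrix (ZMod n) (ZMod n) K) (i : ℕ) (a b : ZMod n) :
    (sigmaTwist q)^[i] M a b = M (a - i) (b - i) ^ q ^ i := by
  induction i generalizing a b with
  | zero => simp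
  | succ i ih =>
    rw [Function.iterate_succ_apply', sigmaTwist, Matrix.of_apply, ih, ← pow_mul, ← pow_succ]
    congr 2 <;> · push_cast; ring

theorem sigmaTwist_iterate_card {q n : ℕ} {K : Type*} [Field K] [Fintype K]
    (hK : Fintype.card K = q ^ n) (M : Matrix (ZMod n) (ZMod n) K) :
    (sigmaTwist q)^[n] M = M := by
  ext a b
  rw [sigmaTwist_iterate_apply, ← hK, FiniteField.pow_card]
  simp

/-- The determinant of the generic combination of the twists of `M`. -/
noncomputable def twistDet (q : ℕ) {n : ℕ} [NeZero n] {K : Type*} [Field K]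
    (M : Matrix (ZMod n) (ZMod n) K) : MvPolynomial (Fin n) K :=
  (∑ j : Fin n, (MvPolynomial.X j : MvPolynomial (Fin n) K) •
    ((sigmaTwist q)^[(j : ℕ)] M).map MvPolynomial.C).det

theorem eval_twistDet (q : ℕ) {n : ℕ} [NeZero n] {K : Type*} [Field K]
    (M : Matrix (ZMod n) (ZMod n) K) (x : Fin n → K) :
    MvPolynomial.eval x (twistDet q M) =
      (∑ j : Fin n, x j • (sigmaTwist q)^[(j : ℕ)] M).det := by
  rw [twistDet, RingHom.map_det]
  congr 1
  ext a b
  simp [Matrix.sum_apply]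

theorem totalDegree_twistDet_le (q : ℕ) {n : ℕ} [NeZero n] {K : Type*} [Field K]
    (M : Matrix (ZMod n) (ZMod n) K) : (twistDet q M).totalDegree ≤ n := by
  have hM : ∀ a b, ((∑ j : Fin n, (MvPolynomial.X j : MvPolynomial (Fin n) K) •
      ((sigmaTwist q)^[(j : ℕ)] M).map MvPolynomial.C :
        Matrix (ZMod n) (ZMod n) (MvPolynomial (Fin n) K)) a b).totalDegree ≤ 1 := fun a b => by
    rw [Matrix.sum_apply]
    refine MvPolynomial.totalDegree_finsetSum_le fun j _ => ?_
    rw [Matrix.smul_apply, smul_eq_mul, Matrix.map_apply]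
    refine (MvPolynomial.totalDegree_mul _ _).trans ?_
    rw [MvPolynomial.totalDegree_C, MvPolynomial.totalDegree_X]
  have h := MvPolynomial.totalDegree_det_le _ 1 hM
  rwa [ZMod.card, mul_one] at h

theorem rename_map_twistDet {p k n : ℕ} [NeZero n] {K : Type*} [Field K] [Fintype K]
    [ExpChar K p] (hK : Fintype.card K = (p ^ k) ^ n) (M : Matrix (ZMod n) (ZMod n) K) :
    MvPolynomial.rename (Equiv.addRight (1 : Fin n))
      (MvPolynomial.map (iterateFrobenius K p k) (twistDet (p ^ k) M)) = twistDet (p ^ k) M := by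
  have h1 : MvPolynomial.rename (Equiv.addRight (1 : Fin n))
      (MvPolynomial.map (iterateFrobenius K p k) (twistDet (p ^ k) M)) =
      (((∑ j : Fin n, (MvPolynomial.X j : MvPolynomial (Fin n) K) •
        ((sigmaTwist (p ^ k))^[(j : ℕ)] M).map MvPolynomial.C)).submatrix
          (Equiv.addRight (1 : ZMod n)) (Equiv.addRight (1 : ZMod n))).det := by
    rw [twistDet, RingHom.map_det, AlgHom.map_det]
    congr 1
    ext1 a b
    simp only [Matrix.submatrix_apply, Matrix.sum_apply, AlgHom.mapMatrix_apply, Matrix.map_apply,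
      RingHom.mapMatrix_apply, Matrix.smul_apply, smul_eq_mul, map_sum, map_mul,
      MvPolynomial.map_X, MvPolynomial.map_C, MvPolynomial.rename_X, MvPolynomial.rename_C]
    refine Eq.trans ?_ (Equiv.sum_comp (Equiv.addRight (1 : Fin n))
      (fun j => (MvPolynomial.X j : MvPolynomial (Fin n) K) * MvPolynomial.C
        ((sigmaTwist (p ^ k))^[(j : ℕ)] M (Equiv.addRight 1 a) (Equiv.addRight 1 b))))
    refine Finset.sum_congr rfl fun j _ => ?_
    congr 2
    have h2 : (sigmaTwist (p ^ k))^[((Equiv.addRight (1 : Fin n) j : Fin n) : ℕ)] M =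
        sigmaTwist (p ^ k) ((sigmaTwist (p ^ k))^[(j : ℕ)] M) := by
      rw [← Function.iterate_succ_apply' (sigmaTwist (p ^ k))]
      rcases (Nat.succ_le_of_lt j.2).lt_or_eq with h | h
      · congr 2
        simp only [Equiv.coe_addRight, Fin.val_add, Fin.val_one', Nat.add_mod_mod]
        exact Nat.mod_eq_of_lt h
      · rw [h, sigmaTwist_iterate_card hK]
        have : ((Equiv.addRight (1 : Fin n) j : Fin n) : ℕ) = 0 := by
          simp only [Equiv.coe_addRight, Fin.val_add, Fin.val_one', Nat.add_mod_mod]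
          rw [show (j : ℕ) + 1 = n from h, Nat.mod_self]
        rw [this]
        rfl
    rw [h2, sigmaTwist, Matrix.of_apply, iterateFrobenius_def]
    simp
  rw [h1, Matrix.det_submatrix_equiv_self, twistDet]

theorem exists_det_eq_zero {p k n : ℕ} [Fact p.Prime] [NeZero n] (hn2 : 2 ≤ n) {K : Type*}
    [Field K] [Fintype K] [CharP K p] (hK : Fintype.card K = (p ^ k) ^ n)
    (M : Matrix (ZMod n) (ZMod n) K) (hK4 : n ^ 4 < Fintype.card K)
    {r e α : ℕ} (hQ : Fintype.card K = p ^ r * p ^ e)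
    (hα : n ≤ α + 1) (hP : n ≤ p ^ r) (hαs : n * α < p ^ e)
    (hG : n * (n - 1) * (α + 1 + p ^ r) ≤ 2 * ((α + 1) * p ^ r))
    (hs : p ^ e * (p ^ r - 1) + α + n * (n - 1) < p ^ r * p ^ e) :
    ∃ x : Fin n → K, x ≠ 0 ∧
      (∑ j : Fin n, x j • (sigmaTwist (p ^ k))^[(j : ℕ)] M).det = 0 := by
  by_contra! hcon
  have : ExpChar K p := ExpChar.prime Fact.out
  have : CharP (AlgebraicClosure K) p := charP_of_injective_algebraMap (algebraMap K _).injective p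
  have : ExpChar (AlgebraicClosure K) p := ExpChar.prime Fact.out
  have hz : ∀ x, MvPolynomial.eval x (twistDet (p ^ k) M) = 0 → x = 0 := fun x hx => by
    by_contra h
    rw [eval_twistDet] at hx
    exact hcon x h hx
  have hhom : ∀ (a : K) (x : Fin n → K), MvPolynomial.eval (a • x) (twistDet (p ^ k) M) =
      a ^ n * MvPolynomial.eval x (twistDet (p ^ k) M) := fun a x => by
    rw [eval_twistDet, eval_twistDet]
    have h1 : ∑ j : Fin n, (a • x) j • (sigmaTwist (p ^ k))^[(j : ℕ)] M =
        a • ∑ j : Fin n, x j • (sigmaTwist (p ^ k))^[(j : ℕ)] M := by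
      rw [Finset.smul_sum]
      exact Finset.sum_congr rfl fun j _ => by rw [Pi.smul_apply, smul_eq_mul, mul_smul]
    rw [h1, Matrix.det_smul, ZMod.card]
  have h0 : MvPolynomial.eval 0 (twistDet (p ^ k) M) = 0 := by
    have := hhom 0 0
    rwa [zero_smul, zero_pow (by omega), zero_mul] at this
  have hs1 : Equiv.addRight (1 : Fin n) ^ n = 1 := by
    refine Equiv.ext fun j => ?_
    have h1 : ∀ i, (Equiv.addRight (1 : Fin n) ^ i) j = j + i • (1 : Fin n) := fun i => by
      induction i with
      | zero => simp
      | succ i ih => rw [pow_succ', Equiv.Perm.mul_apply, ih, succ_nsmul,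
          ← add_assoc, Equiv.coe_addRight]
    rw [h1]
    have h2 : n • (1 : Fin n) = 0 := by simpa using card_nsmul_eq_zero' (x := (1 : Fin n))
    rw [h2, add_zero, Equiv.Perm.one_apply]
  have hirr := irreducible_map_of_anisotropic (L := AlgebraicClosure K)
    (by rw [hK, pow_mul]) (Fintype.card_fin n) hs1 (totalDegree_twistDet_le (p ^ k) M) h0 hz
    (rename_map_twistDet hK M)
  obtain ⟨m, rfl⟩ : ∃ m, n = m + 1 := ⟨n - 1, by omega⟩
  exact false_of_anisotropic hn2 _ (totalDegree_twistDet_le (p ^ k) M) hhom hz hirr hK4 hQ hα hP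
    hαs hG hs

/-- The automorphism `z ↦ z ^ q ^ i` for `i` in `ℤ/n`. -/
noncomputable def frobZMod (K : Type*) [Field K] (p k : ℕ) [ExpChar K p] {n : ℕ} (i : ZMod n) :
    K →+* K :=
  iterateFrobenius K p (k * i.val)

theorem frobZMod_apply {K : Type*} [Field K] {p k : ℕ} [ExpChar K p] {n : ℕ} (i : ZMod n)
    (z : K) : frobZMod K p k i z = z ^ (p ^ k) ^ i.val := by
  rw [frobZMod, iterateFrobenius_def, pow_mul p]

theorem frobZMod_frobZMod {K : Type*} [Field K] [Fintype K] {p k n : ℕ} [ExpChar K p] [NeZero n]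
    (hK : Fintype.card K = (p ^ k) ^ n) (i j : ZMod n) (z : K) :
    frobZMod K p k i (frobZMod K p k j z) = frobZMod K p k (i + j) z := by
  have hmod : ∀ m, z ^ (p ^ k) ^ m = z ^ (p ^ k) ^ (m % n) := fun m => by
    conv_lhs => rw [← Nat.mod_add_div m n, pow_add, pow_mul (p ^ k) n, ← hK, pow_mul,
      FiniteField.pow_card_pow]
  simp only [frobZMod_apply]
  rw [← pow_mul, ← pow_add, ZMod.val_add, ← hmod, add_comm]

theorem exists_sum_mul_frobZMod_ne_zero {K : Type*} [Field K] [Fintype K] {p k n : ℕ}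
    [ExpChar K p] [NeZero n] (hq : 1 < p ^ k) (hK : Fintype.card K = (p ^ k) ^ n)
    {a : ZMod n → K} (ha : a ≠ 0) : ∃ c, ∑ i, a i * frobZMod K p k i c ≠ 0 := by
  by_contra! h
  have hinj : ∀ i j : ZMod n, (p ^ k) ^ i.val = (p ^ k) ^ j.val → i = j := fun i j hij =>
    ZMod.val_injective n (Nat.pow_right_injective hq hij)
  have hP : ∑ i : ZMod n, C (a i) * X ^ (p ^ k) ^ i.val = (0 : K[X]) := by
    refine eq_of_natDegree_lt_card_of_eval_eq _ _ Function.injective_id (fun c => ?_) ?_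
    · have := h c
      simp only [frobZMod_apply] at this
      simpa [eval_finsetSum] using this
    · rw [natDegree_zero, max_eq_left (Nat.zero_le _), hK]
      have hn0 : n ≠ 0 := NeZero.ne n
      refine lt_of_le_of_lt (natDegree_sum_le_of_forall_le (n := (p ^ k) ^ (n - 1)) _ _
        fun i _ => ?_) (Nat.pow_lt_pow_right hq (by omega))
      refine (natDegree_C_mul_X_pow_le _ _).trans (Nat.pow_le_pow_right (by omega) ?_)
      have := ZMod.val_lt i
      omega
  refine ha (funext fun j => ?_)
  have h1 := congrArg (fun P => P.coeff ((p ^ k) ^ j.val)) hP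
  simp only [finsetSum_coeff, coeff_C_mul, coeff_X_pow, coeff_zero] at h1
  rw [Finset.sum_eq_single j] at h1
  · simpa using h1
  · intro i _ hij
    rw [if_neg fun h2 => hij (hinj _ _ h2).symm, mul_zero]
  · simp

theorem det_sum_frobenius_smul_ne_zero {K : Type*} [Field K] [Fintype K] {p k n : ℕ}
    [ExpChar K p] [NeZero n] (hq : 1 < p ^ k) (hK : Fintype.card K = (p ^ k) ^ n)
    (M : Matrix (ZMod n) (ZMod n) K)
    (hsf : ∀ x y : K,
      (∑ i : ZMod n, ∑ j : ZMod n, M i j * x ^ (p ^ k) ^ i.val * y ^ (p ^ k) ^ j.val) = 0 →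
        x = 0 ∨ y = 0) {α : K} (hα : α ≠ 0) :
    (∑ j : Fin n, α ^ (p ^ k) ^ (j : ℕ) • (sigmaTwist (p ^ k))^[(j : ℕ)] M).det ≠ 0 := by
  set A := ∑ j : Fin n, α ^ (p ^ k) ^ (j : ℕ) • (sigmaTwist (p ^ k))^[(j : ℕ)] M with hA
  let φ : ZMod n → K →+* K := fun i => frobZMod K p k i
  have hφ : ∀ i j z, φ i (φ j z) = φ (i + j) z := frobZMod_frobZMod hK
  have hshift : ∀ (j : ZMod n) (g : ZMod n → K), ∑ i, g (j + i) = ∑ i, g i := fun j g =>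
    Equiv.sum_comp (Equiv.addLeft j) g
  have hAapp : ∀ a b, A a b = ∑ j : ZMod n, φ j (α * M (a - j) (b - j)) := by
    intro a b
    obtain ⟨m, rfl⟩ : ∃ m, n = m + 1 := ⟨n - 1, by have := NeZero.ne n; omega⟩
    rw [hA, Matrix.sum_apply]
    refine Finset.sum_congr rfl fun j _ => ?_
    have hj : (((j : Fin (m + 1)) : ℕ) : ZMod (m + 1)) = j := Fin.cast_val_eq_self j
    rw [Matrix.smul_apply, sigmaTwist_iterate_apply, hj, smul_eq_mul, ← mul_pow]
    exact (frobZMod_apply (n := m + 1) j _).symm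
  have hAφ : ∀ i a b, φ i (A (a - i) (b - i)) = A a b := by
    intro i a b
    rw [hAapp, hAapp, map_sum, ← hshift i fun j =>
      φ j (α * M (a - j) (b - j))]
    refine Finset.sum_congr rfl fun j _ => ?_
    rw [hφ, sub_sub, sub_sub]
  intro hdet
  obtain ⟨v, hv0, hv⟩ := Matrix.exists_mulVec_eq_zero_iff.2 hdet
  have ha : (fun i => φ i (v (-i))) ≠ 0 := by
    obtain ⟨i, hi⟩ := Function.ne_iff.1 hv0
    refine Function.ne_iff.2 ⟨-i, ?_⟩
    rw [neg_neg]
    exact (_root_.map_ne_zero _).2 hi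
  obtain ⟨c, hc⟩ := exists_sum_mul_frobZMod_ne_zero hq hK ha
  set y := ∑ i, φ i (v (-i)) * φ i c with hy
  have hyb : ∀ b, φ b y = ∑ i, φ i (v (b - i) * c) := by
    intro b
    rw [hy, map_sum, ← hshift b fun i => φ i (v (b - i) * c)]
    refine Finset.sum_congr rfl fun i _ => ?_
    rw [← map_mul, hφ]
    congr 3
    ring
  have hAy : ∀ a, ∑ b, A a b * φ b y = 0 := by
    intro a
    simp_rw [hyb, Finset.mul_sum]
    rw [Finset.sum_comm]
    refine Finset.sum_eq_zero fun i _ => ?_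
    have h1 : ∀ b, A a b * φ i (v (b - i) * c) = φ i (A (a - i) (b - i) * v (b - i) * c) := by
      intro b
      rw [mul_assoc, map_mul (φ i) (A _ _), hAφ]
    have h2 : ∑ b, A (a - i) (b - i) * v (b - i) = 0 :=
      (Equiv.sum_comp (Equiv.subRight i) fun b => A (a - i) b * v b).trans (congrFun hv (a - i))
    simp_rw [h1]
    rw [← map_sum, ← Finset.sum_mul, h2, zero_mul, map_zero]
  have hc' : y ≠ 0 := hc
  let mul : K →+ K := 
    { toFun := fun x => ∑ i, ∑ j, M i j * φ i x * φ j y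
      map_zero' := by simp
      map_add' := fun x x' => by
        simp only [map_add, mul_add, add_mul, Finset.sum_add_distrib] }
  have hinj : Function.Injective mul := by
    rw [injective_iff_map_eq_zero]
    intro x hx
    refine (hsf x y ?_).resolve_right hc'
    rw [← hx]
    refine Finset.sum_congr rfl fun i _ => Finset.sum_congr rfl fun j _ => ?_
    rw [← frobZMod_apply, ← frobZMod_apply]
  have htr : ∀ x, ∑ j, φ j (α * mul x) = 0 := by
    intro x
    have h1 : ∑ a, φ a x * ∑ b, A a b * φ b y = 0 :=
      Finset.sum_eq_zero fun a _ => by rw [hAy, mul_zero]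
    rw [← h1]
    simp_rw [hAapp, Finset.sum_mul, Finset.mul_sum]
    have h2 : ∀ a, ∑ b, ∑ j, φ a x * (φ j (α * M (a - j) (b - j)) * φ b y) =
        ∑ j, ∑ b, φ a x * (φ j (α * M (a - j) (b - j)) * φ b y) := fun a => Finset.sum_comm
    simp_rw [h2]
    rw [Finset.sum_comm]
    refine Finset.sum_congr rfl fun j _ => ?_
    change φ j (α * ∑ a, ∑ b, M a b * φ a x * φ b y) = _
    rw [← hshift j fun a =>
      ∑ b, φ a x * (φ j (α * M (a - j) (b - j)) * φ b y)]
    rw [Finset.mul_sum, map_sum]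
    refine Finset.sum_congr rfl fun a _ => ?_
    rw [← hshift j fun b =>
      φ (j + a) x * (φ j (α * M (j + a - j) (b - j)) * φ b y)]
    rw [Finset.mul_sum, map_sum]
    refine Finset.sum_congr rfl fun b _ => ?_
    simp only [add_sub_cancel_left, ← hφ, map_mul]
    ring
  obtain ⟨z, hz⟩ := exists_sum_mul_frobZMod_ne_zero (a := fun _ => (1 : K)) hq hK
    (Function.ne_iff.2 ⟨0, one_ne_zero⟩)
  obtain ⟨x, hx⟩ := Finite.surjective_of_injective hinj (α⁻¹ * z)
  refine hz ?_
  have := htr x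
  rw [hx, mul_inv_cancel_left₀ hα] at this
  simpa using this

theorem lt_pow_of_large {q n : ℕ} (hn : 2 ≤ n) (hq : 1 < q)
    (hbig : (q : ℝ) ^ (n * (n - 1)) >
      ((n : ℝ) - 1) * ((n : ℝ) - 2) * (q : ℝ) ^ ((n : ℝ) * ((n : ℝ) - 3 / 2)) +
        5 * (n : ℝ) ^ ((13 : ℝ) / 3) * (q : ℝ) ^ (n * (n - 2))) :
    125 * n ^ 13 < q ^ (3 * n) := by
  have hq0 : (0 : ℝ) < q := by exact_mod_cast (by omega : 0 < q)
  have hn' : (2 : ℝ) ≤ n := by exact_mod_cast hn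
  have h1 : 0 ≤ ((n : ℝ) - 1) * ((n : ℝ) - 2) * (q : ℝ) ^ ((n : ℝ) * ((n : ℝ) - 3 / 2)) :=
    mul_nonneg (mul_nonneg (by linarith) (by linarith)) (Real.rpow_nonneg hq0.le _)
  have h2 : n * (n - 1) = n + n * (n - 2) := by
    obtain ⟨m, rfl⟩ : ∃ m, n = m + 2 := ⟨n - 2, by omega⟩
    simp only [Nat.add_sub_cancel, show m + 2 - 1 = m + 1 by omega]
    ring
  rw [h2, pow_add] at hbig
  have h3 : 5 * (n : ℝ) ^ ((13 : ℝ) / 3) < (q : ℝ) ^ n :=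
    lt_of_mul_lt_mul_right (by linarith) (pow_pos hq0 (n * (n - 2))).le
  have h4 : ((n : ℝ) ^ ((13 : ℝ) / 3)) ^ 3 = (n : ℝ) ^ 13 := by
    rw [← Real.rpow_natCast, ← Real.rpow_mul (by linarith), ← Real.rpow_natCast]
    norm_num
  have h5 := pow_lt_pow_left₀ h3 (by positivity) (by norm_num : 3 ≠ 0)
  rw [mul_pow, h4, ← pow_mul, mul_comm n 3] at h5
  norm_num at h5
  exact_mod_cast h5

theorem numeric_of_balanced {n q q₀ : ℕ} (hn : 2 ≤ n) (hq₀ : 2 ≤ q₀) (hq : q₀ ≤ q)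
    (h1 : n ≤ q₀ ^ (n / 2)) (h2 : n ^ 2 ≤ q₀ ^ (n - n / 2))
    (h3 : n * (n - 1) * (q₀ ^ (n % 2) + n) ≤ 2 * q₀ ^ (n - n / 2)) :
    n ≤ q ^ (n / 2) ∧ n ^ 2 ≤ q ^ (n - n / 2) ∧
      n * (n - 1) * (q ^ (n - n / 2) + n * q ^ (n / 2)) ≤
        2 * (q ^ (n - n / 2) * q ^ (n / 2)) := by
  refine ⟨h1.trans (Nat.pow_le_pow_left hq _), h2.trans (Nat.pow_le_pow_left hq _), ?_⟩
  have hd : n - n / 2 = n % 2 + n / 2 := by omega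
  rw [hd, pow_add] at h3 ⊢
  have h4 : n * (n - 1) * (q ^ (n % 2) + n) ≤ 2 * (q ^ (n % 2) * q ^ (n / 2)) := by
    have h5 : q₀ ^ (n / 2) ≤ q ^ (n / 2) := Nat.pow_le_pow_left hq _
    have h6 : q₀ ^ (n % 2) ≤ q ^ (n % 2) := Nat.pow_le_pow_left hq _
    have h7 : 0 < q₀ ^ (n % 2) := by positivity
    refine Nat.le_of_mul_le_mul_left ?_ h7
    calc q₀ ^ (n % 2) * (n * (n - 1) * (q ^ (n % 2) + n))
        = n * (n - 1) * (q₀ ^ (n % 2) * q ^ (n % 2) + n * q₀ ^ (n % 2)) := by ring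
      _ ≤ n * (n - 1) * (q₀ ^ (n % 2) * q ^ (n % 2) + n * q ^ (n % 2)) := by gcongr
      _ = n * (n - 1) * (q₀ ^ (n % 2) + n) * q ^ (n % 2) := by ring
      _ ≤ 2 * (q₀ ^ (n % 2) * q₀ ^ (n / 2)) * q ^ (n % 2) := Nat.mul_le_mul_right _ h3
      _ ≤ 2 * (q₀ ^ (n % 2) * q ^ (n / 2)) * q ^ (n % 2) := by gcongr
      _ = q₀ ^ (n % 2) * (2 * (q ^ (n % 2) * q ^ (n / 2))) := by ring
  calc n * (n - 1) * (q ^ (n % 2) * q ^ (n / 2) + n * q ^ (n / 2))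
      = n * (n - 1) * (q ^ (n % 2) + n) * q ^ (n / 2) := by ring
    _ ≤ 2 * (q ^ (n % 2) * q ^ (n / 2)) * q ^ (n / 2) := Nat.mul_le_mul_right _ h4
    _ = 2 * (q ^ (n % 2) * q ^ (n / 2) * q ^ (n / 2)) := by ring

theorem cube_le_two_pow {t : ℕ} (ht : 14 ≤ t) :
    (2 * t + 1) * (2 * t) * (2 * t + 3) ≤ 2 * 2 ^ t ∧ (2 * t + 1) ^ 2 ≤ 2 ^ t := by
  induction t, ht using Nat.le_induction with
  | base => norm_num
  | succ t ht ih =>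
    obtain ⟨h1, h2⟩ := ih
    rw [pow_succ 2]
    constructor
    · have : (2 * (t + 1) + 1) * (2 * (t + 1)) * (2 * (t + 1) + 3) ≤
          2 * ((2 * t + 1) * (2 * t) * (2 * t + 3)) := by nlinarith [Nat.mul_le_mul ht ht]
      omega
    · nlinarith

theorem numeric_two_of_le {n : ℕ} (hn : 27 ≤ n) :
    n ≤ 2 ^ (n / 2) ∧ n ^ 2 ≤ 2 ^ (n - n / 2) ∧
      n * (n - 1) * (2 ^ (n % 2) + n) ≤ 2 * 2 ^ (n - n / 2) := by
  rcases hn.eq_or_lt with rfl | hn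
  · norm_num
  obtain ⟨h1, h2⟩ := cube_le_two_pow (t := n / 2) (by omega)
  rcases Nat.mod_two_eq_zero_or_one n with h | h
  · obtain ⟨t, rfl⟩ : ∃ t, n = 2 * t := ⟨n / 2, by omega⟩
    have h3 : 2 * t / 2 = t := by omega
    have h4 : 2 * t - t = t := by omega
    rw [h3] at h1 h2 ⊢
    rw [h4, h]
    refine ⟨by nlinarith, by nlinarith, ?_⟩
    obtain ⟨u, hu⟩ : ∃ u, 2 * t = u + 1 := ⟨2 * t - 1, by omega⟩
    rw [hu] at h1 h2 ⊢
    simp only [Nat.add_sub_cancel, pow_zero]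
    nlinarith
  · obtain ⟨t, rfl⟩ : ∃ t, n = 2 * t + 1 := ⟨n / 2, by omega⟩
    have h3 : (2 * t + 1) / 2 = t := by omega
    have h4 : 2 * t + 1 - t = t + 1 := by omega
    rw [h3] at h1 h2 ⊢
    rw [h4, h, pow_succ 2 t, pow_one, Nat.add_sub_cancel]
    refine ⟨by nlinarith, by nlinarith, ?_⟩
    nlinarith

theorem exists_numeric {p k n : ℕ} (hp : p.Prime) (hk : 0 < k) (hn : 2 ≤ n)
    (hbig : 125 * n ^ 13 < (p ^ k) ^ (3 * n)) :
    (n = 22 ∧ p = 2 ∧ k = 1) ∨ ∃ r e, r + e = k * n ∧ n ≤ p ^ r ∧ n ^ 2 ≤ p ^ e ∧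
      n * (n - 1) * (p ^ e + n * p ^ r) ≤ 2 * (p ^ e * p ^ r) := by
  have hq2 : 2 ≤ p ^ k := hp.two_le.trans (Nat.le_self_pow hk.ne' p)
  have hbal : ∀ q₀, 2 ≤ q₀ → q₀ ≤ p ^ k → n ≤ q₀ ^ (n / 2) → n ^ 2 ≤ q₀ ^ (n - n / 2) →
      n * (n - 1) * (q₀ ^ (n % 2) + n) ≤ 2 * q₀ ^ (n - n / 2) →
      ∃ r e, r + e = k * n ∧ n ≤ p ^ r ∧ n ^ 2 ≤ p ^ e ∧
      n * (n - 1) * (p ^ e + n * p ^ r) ≤ 2 * (p ^ e * p ^ r) := by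
    intro q₀ h0 h1 h2 h3 h4
    have := numeric_of_balanced hn h0 h1 h2 h3 h4
    refine ⟨k * (n / 2), k * (n - n / 2), ?_, ?_⟩
    · rw [← mul_add]
      congr 1
      omega
    · simpa only [pow_mul] using this
  have hlow : ∀ q₀, q₀ ^ (3 * n) ≤ 125 * n ^ 13 → q₀ + 1 ≤ p ^ k := by
    intro q₀ h
    by_contra! hlt
    have := Nat.pow_le_pow_left (Nat.lt_succ_iff.1 hlt) (3 * n)
    omega
  have hprime : ∀ ℓ, ℓ.Prime → p ^ k = ℓ → p = ℓ ∧ k = 1 := by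
    rintro ℓ hℓ rfl
    have := Nat.Prime.eq_one_of_pow hℓ
    subst this
    exact ⟨(pow_one p).symm, rfl⟩
  rcases le_or_gt 27 n with h27 | h27
  · obtain ⟨h1, h2, h3⟩ := numeric_two_of_le h27
    exact Or.inr (hbal 2 le_rfl hq2 h1 h2 h3)
  have main : ∀ q₀ q₁, q₀ ^ (3 * n) ≤ 125 * n ^ 13 → q₁ ≤ q₀ + 1 → 2 ≤ q₁ → n ≤ q₁ ^ (n / 2) →
      n ^ 2 ≤ q₁ ^ (n - n / 2) → n * (n - 1) * (q₁ ^ (n % 2) + n) ≤ 2 * q₁ ^ (n - n / 2) →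
      ∃ r e, r + e = k * n ∧ n ≤ p ^ r ∧ n ^ 2 ≤ p ^ e ∧
      n * (n - 1) * (p ^ e + n * p ^ r) ≤ 2 * (p ^ e * p ^ r) := by
    intro q₀ q₁ h h1 h2
    exact hbal q₁ h2 (h1.trans (hlow q₀ h))
  have special : ∀ ℓ r e, ℓ.Prime → ℓ ≤ p ^ k → r + e = n → n ≤ ℓ ^ r → n ^ 2 ≤ ℓ ^ e →
      n * (n - 1) * (ℓ ^ e + n * ℓ ^ r) ≤ 2 * (ℓ ^ e * ℓ ^ r) →
      n ≤ (ℓ + 1) ^ (n / 2) → n ^ 2 ≤ (ℓ + 1) ^ (n - n / 2) →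
      n * (n - 1) * ((ℓ + 1) ^ (n % 2) + n) ≤ 2 * (ℓ + 1) ^ (n - n / 2) →
      ∃ r e, r + e = k * n ∧ n ≤ p ^ r ∧ n ^ 2 ≤ p ^ e ∧
      n * (n - 1) * (p ^ e + n * p ^ r) ≤ 2 * (p ^ e * p ^ r) := by
    intro ℓ r e hℓ hle hre h1 h2 h3 h4 h5 h6
    rcases hle.eq_or_lt with h | h
    · obtain ⟨rfl, rfl⟩ := hprime ℓ hℓ h.symm
      exact ⟨r, e, by omega, h1, h2, h3⟩
    · exact hbal (ℓ + 1) (by have := hℓ.two_le; omega) h h4 h5 h6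
  interval_cases n
  · exact Or.inr (main 10 11 (by norm_num) (by norm_num) (by norm_num) (by norm_num) (by norm_num)
      (by norm_num))
  · exact Or.inr (main 8 9 (by norm_num) (by norm_num) (by norm_num) (by norm_num) (by norm_num)
      (by norm_num))
  · exact Or.inr (main 6 7 (by norm_num) (by norm_num) (by norm_num) (by norm_num) (by norm_num)
      (by norm_num))
  · exact Or.inr (main 5 6 (by norm_num) (by norm_num) (by norm_num) (by norm_num) (by norm_num)
      (by norm_num))
  · exact Or.inr (main 4 5 (by norm_num) (by norm_num) (by norm_num) (by norm_num) (by norm_num)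
      (by norm_num))
  · exact Or.inr (main 4 5 (by norm_num) (by norm_num) (by norm_num) (by norm_num) (by norm_num)
      (by norm_num))
  iterate 3
    · exact Or.inr (main 3 4 (by norm_num) (by norm_num) (by norm_num) (by norm_num) (by norm_num)
        (by norm_num))
  · exact Or.inr (special 3 4 7 (by norm_num) (hlow 2 (by norm_num)) (by norm_num) (by norm_num)
      (by norm_num) (by norm_num) (by norm_num) (by norm_num) (by norm_num))
  · exact Or.inr (special 3 5 7 (by norm_num) (hlow 2 (by norm_num)) (by norm_num) (by norm_num)
      (by norm_num) (by norm_num) (by norm_num) (by norm_num) (by norm_num))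
  iterate 9
    · exact Or.inr (main 2 3 (by norm_num) (by norm_num) (by norm_num) (by norm_num) (by norm_num)
        (by norm_num))
  · rcases hq2.eq_or_lt with h | h
    · exact Or.inl ⟨rfl, hprime 2 Nat.prime_two h.symm⟩
    · exact Or.inr (hbal 3 (by norm_num) h (by norm_num) (by norm_num) (by norm_num))
  · exact Or.inr (special 2 9 14 (by norm_num) hq2 (by norm_num) (by norm_num) (by norm_num)
      (by norm_num) (by norm_num) (by norm_num) (by norm_num))
  · exact Or.inr (special 2 10 14 (by norm_num) hq2 (by norm_num) (by norm_num) (by norm_num)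
      (by norm_num) (by norm_num) (by norm_num) (by norm_num))
  · exact Or.inr (hbal 2 (by norm_num) hq2 (by norm_num) (by norm_num) (by norm_num))
  · exact Or.inr (special 2 12 14 (by norm_num) hq2 (by norm_num) (by norm_num) (by norm_num)
      (by norm_num) (by norm_num) (by norm_num) (by norm_num))

theorem numeric_stepanov {n P s : ℕ} (hn : 2 ≤ n) (hP : n ≤ P) (hs : n ^ 2 ≤ s)
    (h : n * (n - 1) * (s + n * P) ≤ 2 * (s * P)) :
    ∃ α, n ≤ α + 1 ∧ n * α < s ∧ n * (n - 1) * (α + 1 + P) ≤ 2 * ((α + 1) * P) ∧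
      s * (P - 1) + α + n * (n - 1) < P * s := by
  have hs0 : 0 < s := lt_of_lt_of_le (by positivity) hs
  obtain ⟨m, rfl⟩ : ∃ m, n = m + 1 := ⟨n - 1, by omega⟩
  obtain ⟨t, rfl⟩ : ∃ t, s = t + 1 := ⟨s - 1, by omega⟩
  obtain ⟨P, rfl⟩ : ∃ P', P = P' + 1 := ⟨P - 1, by omega⟩
  simp only [Nat.add_sub_cancel] at *
  set α := t / (m + 1) with hα
  have h1 : (m + 1) * α ≤ t := Nat.mul_div_le _ _
  have h2 : t < (m + 1) * (α + 1) := Nat.lt_mul_div_succ _ (by omega)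
  have h3 : (m + 1) * m ≤ 2 * (P + 1) := by
    by_contra! hlt
    have h4 := Nat.mul_lt_mul_of_pos_right hlt hs0
    have h5 := (Nat.mul_le_mul_left ((m + 1) * m) (Nat.le_add_right (t + 1) _)).trans h
    linarith
  have h5 : m + 1 ≤ α + 1 := by
    by_contra! hlt
    nlinarith
  refine ⟨α, h5, by omega, ?_, ?_⟩
  · obtain ⟨d, hd⟩ : ∃ d, (m + 1) * (α + 1) = t + 1 + d := ⟨(m + 1) * (α + 1) - (t + 1), by omega⟩
    have h6 := Nat.mul_le_mul_right d h3
    refine Nat.le_of_mul_le_mul_left ?_ (by omega : 0 < m + 1)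
    calc (m + 1) * ((m + 1) * m * (α + 1 + (P + 1)))
        = (m + 1) * m * ((m + 1) * (α + 1) + (m + 1) * (P + 1)) := by ring
      _ = (m + 1) * m * (t + 1 + (m + 1) * (P + 1)) + (m + 1) * m * d := by rw [hd]; ring
      _ ≤ 2 * ((t + 1) * (P + 1)) + 2 * (P + 1) * d := by omega
      _ = 2 * (((m + 1) * (α + 1)) * (P + 1)) := by rw [hd]; ring
      _ = _ := by ring
  · have : α + (m + 1) * m < t + 1 := by nlinarith
    nlinarith

theorem sum_vecCons_cubeRoots_pow {A : Type*} [CommRing A] (h4 : (4 : A) = 0) {w : A}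
    (hw : w ^ 2 + w + 1 = 0) (m : ℕ) :
    ∑ c, (![0, 1, w, w ^ 2] : Fin 4 → A) c ^ m = if m ≠ 0 ∧ 3 ∣ m then -1 else 0 := by
  have hw3 : w ^ 3 = 1 := by linear_combination (w - 1) * hw
  rcases Nat.eq_zero_or_pos m with rfl | hm
  · simp [h4]
  simp only [Fin.sum_univ_four, Matrix.cons_val, zero_pow hm.ne', one_pow, zero_add]
  obtain ⟨c, r, hr, rfl⟩ : ∃ c r, r < 3 ∧ m = 3 * c + r :=
    ⟨m / 3, m % 3, Nat.mod_lt _ (by norm_num), by omega⟩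
  have h1 : (w ^ 2) ^ 3 = 1 := by rw [← pow_mul, mul_comm, pow_mul, hw3, one_pow]
  rw [pow_add, pow_mul, hw3, pow_add, pow_mul (w ^ 2), h1, one_pow, one_mul, one_mul]
  interval_cases r
  · rw [if_pos ⟨by omega, by omega⟩]
    linear_combination h4
  · rw [if_neg (by omega)]
    linear_combination hw
  · rw [if_neg (by omega)]
    linear_combination (w ^ 2 - w + 1) * hw

theorem eq_one_of_three_dvd {σ : Type*} [Fintype σ] {κ κ' : σ → ℕ}
    (h : ∑ i, κ i ≤ Fintype.card σ) (h' : ∑ i, κ' i ≤ Fintype.card σ)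
    (hd : ∀ i, κ i + 2 * κ' i ≠ 0 ∧ 3 ∣ κ i + 2 * κ' i) : ∀ i, κ i = 1 ∧ κ' i = 1 := by
  have h3 : ∀ i ∈ Finset.univ, 3 ≤ κ i + 2 * κ' i := fun i _ =>
    Nat.le_of_dvd (Nat.pos_of_ne_zero (hd i).1) (hd i).2
  have hs : ∑ i, (κ i + 2 * κ' i) ≤ ∑ _i : σ, 3 := by
    rw [Finset.sum_add_distrib, ← Finset.mul_sum, Finset.sum_const, Finset.card_univ, smul_eq_mul]
    omega
  have he := (Finset.sum_eq_sum_iff_of_le h3).1 (le_antisymm (Finset.sum_le_sum h3) hs)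
  have h1 : ∀ i ∈ Finset.univ, 1 ≤ κ i := fun i hi => by have := he i hi; omega
  have hs1 : ∑ i, κ i ≤ ∑ _i : σ, 1 := by simpa using h
  have he1 := (Finset.sum_eq_sum_iff_of_le h1).1 (le_antisymm (Finset.sum_le_sum h1) hs1)
  intro i
  have := he i (Finset.mem_univ i)
  have := he1 i (Finset.mem_univ i)
  omega

theorem exists_sq_sum_eq {A ι : Type*} [CommRing A] (S : Finset ι) (g : ι → A) :
    ∃ r, (∑ i ∈ S, g i) ^ 2 = ∑ i ∈ S, g i ^ 2 + 2 * r := by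
  classical
  induction S using Finset.induction_on with
  | empty => exact ⟨0, by simp⟩
  | insert a S ha ih =>
    obtain ⟨r, hr⟩ := ih
    refine ⟨r + g a * ∑ i ∈ S, g i, ?_⟩
    rw [Finset.sum_insert ha, Finset.sum_insert ha]
    linear_combination hr

theorem false_of_pow_six_eq_one {A σ : Type*} [CommRing A] [Fintype σ]
    (h4 : (4 : A) = 0) (h2 : (2 : A) ≠ 0) {w : A} (hw : w ^ 2 + w + 1 = 0)
    (hcard : 0 < Fintype.card σ) (heven : Even (Fintype.card σ)) (S : Finset (σ →₀ ℕ))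
    (hS : ∀ κ ∈ S, ∑ i, κ i ≤ Fintype.card σ) (G : (σ → Fin 4) → A)
    (hG : ∀ z, G z = ∑ κ ∈ S, ∏ i, (![0, 1, w, w ^ 2] : Fin 4 → A) (z i) ^ κ i)
    (h0 : G 0 = 0) (h6 : ∀ z, z ≠ 0 → G z ^ 6 = 1) : False := by
  classical
  set t : Fin 4 → A := ![0, 1, w, w ^ 2] with ht
  have hw3 : w ^ 3 = 1 := by linear_combination (w - 1) * hw
  have htπ : ∀ c, t (Equiv.swap 2 3 c) = t c ^ 2 := by
    intro c
    fin_cases c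
    · rw [Equiv.swap_apply_of_ne_of_ne (by decide) (by decide)]; simp [ht]
    · rw [Equiv.swap_apply_of_ne_of_ne (by decide) (by decide)]; simp [ht]
    · rw [show (⟨2, by norm_num⟩ : Fin 4) = 2 from rfl, Equiv.swap_apply_left]; simp [ht]
    · rw [show (⟨3, by norm_num⟩ : Fin 4) = 3 from rfl, Equiv.swap_apply_right]
      simp only [ht, Matrix.cons_val]
      linear_combination -w * hw3
  let π : (σ → Fin 4) ≃ (σ → Fin 4) := Equiv.piCongrRight fun _ => Equiv.swap 2 3
  have hππ : ∀ z, π (π z) = z := fun z => by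
    ext i
    simp [π, Equiv.swap_apply_self]
  have hGπ : ∀ z, G (π z) = ∑ κ ∈ S, ∏ i, t (z i) ^ (2 * κ i) := fun z => by
    rw [hG]
    refine Finset.sum_congr rfl fun κ _ => Finset.prod_congr rfl fun i _ => ?_
    rw [pow_mul, ← htπ]
    rfl
  have hsq : ∀ z, ∃ r, G z ^ 2 = G (π z) + 2 * r := fun z => by
    obtain ⟨r, hr⟩ := exists_sq_sum_eq S fun κ => ∏ i, t (z i) ^ κ i
    refine ⟨r, ?_⟩
    rw [hG, hr, hGπ]
    simp only [← Finset.prod_pow, ← pow_mul, mul_comm]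
  choose r hr using hsq
  have hsix : ∀ z, G z ^ 6 = G z * G (π z) + 2 * (r z * G z + r (π z) * G (π z)) := fun z => by
    have h1 := hr (π z)
    rw [hππ] at h1
    have h5 : (G z ^ 2) ^ 2 = G z + 2 * r (π z) := by
      rw [hr z]
      linear_combination h1 + (G (π z) * r z + r z ^ 2) * h4
    calc G z ^ 6 = G z ^ 2 * (G z ^ 2) ^ 2 := by ring
      _ = _ := by
        rw [h5, hr z]
        linear_combination r z * r (π z) * h4
  have hleft : ∑ z, G z ^ 6 = -1 := by
    rw [← Finset.add_sum_erase _ _ (Finset.mem_univ (0 : σ → Fin 4)), h0,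
      Finset.sum_congr rfl fun z hz => h6 z (Finset.ne_of_mem_erase hz), Finset.sum_const,
      Finset.card_erase_of_mem (Finset.mem_univ _), Finset.card_univ, Fintype.card_fun,
      Fintype.card_fin, nsmul_eq_mul, Nat.cast_sub (Nat.one_le_pow _ _ (by norm_num))]
    push_cast
    rw [h4, zero_pow hcard.ne']
    ring
  have hright : ∑ z, G z ^ 6 = ∑ z, G z * G (π z) := by
    have h1 : ∑ z, r (π z) * G (π z) = ∑ z, r z * G z := Equiv.sum_comp π fun z => r z * G z
    simp only [hsix, Finset.sum_add_distrib, ← Finset.mul_sum, h1]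
    linear_combination (∑ z, r z * G z) * h4
  have hprod : ∑ z, G z * G (π z) = ∑ κ ∈ S, ∑ κ' ∈ S,
      ∏ i, if κ i + 2 * κ' i ≠ 0 ∧ 3 ∣ κ i + 2 * κ' i then (-1 : A) else 0 := by
    simp only [hGπ, hG, Finset.sum_mul_sum]
    rw [Finset.sum_comm]
    refine Finset.sum_congr rfl fun κ _ => ?_
    rw [Finset.sum_comm]
    refine Finset.sum_congr rfl fun κ' _ => ?_
    simp only [← sum_vecCons_cubeRoots_pow h4 hw, Finset.prod_univ_sum, Fintype.piFinset_univ,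
      ← Finset.prod_mul_distrib, ← pow_add]
    rfl
  have hone : ∀ κ ∈ S, ∀ κ' ∈ S,
      (∏ i, if κ i + 2 * κ' i ≠ 0 ∧ 3 ∣ κ i + 2 * κ' i then (-1 : A) else 0) =
        if κ = Finsupp.equivFunOnFinite.symm 1 ∧ κ' = Finsupp.equivFunOnFinite.symm 1
        then 1 else 0 := fun κ hκ κ' hκ' => by
    split_ifs with h
    · rw [h.1, h.2]
      simp [heven.neg_one_pow]
    · by_contra hne
      have h1 := eq_one_of_three_dvd (hS κ hκ) (hS κ' hκ') fun i => by
        by_contra hi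
        exact hne (Finset.prod_eq_zero (Finset.mem_univ i) (if_neg hi))
      exact h ⟨by ext i; simpa using (h1 i).1, by ext i; simpa using (h1 i).2⟩
  rw [hleft, hprod, Finset.sum_congr rfl fun κ hκ => Finset.sum_congr rfl (hone κ hκ)] at hright
  have h01 : (-1 : A) = 0 ∨ (-1 : A) = 1 := by
    by_cases hm : Finsupp.equivFunOnFinite.symm (1 : σ → ℕ) ∈ S
    · right
      rw [hright]
      simp [ite_and, Finset.sum_ite_eq', hm]
    · left
      rw [hright]
      simp [ite_and, Finset.sum_ite_eq', hm]
  rcases h01 with h | h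
  · exact h2 (by linear_combination -2 * h)
  · exact h2 (by linear_combination -h)

theorem quadraticAlgebra_pow_six (a : QuadraticAlgebra (ZMod 4) (-1) (-1)) :
    a ^ 6 = 1 ∨ ∃ b, a = 2 * b := by
  have key : ∀ x y : ZMod 4,
      ((⟨x, y⟩ : QuadraticAlgebra (ZMod 4) (-1) (-1)) * ⟨x, y⟩ * ⟨x, y⟩) *
        (⟨x, y⟩ * ⟨x, y⟩ * ⟨x, y⟩) = 1 ∨
      ∃ u v : ZMod 4, x = 2 * u ∧ y = 2 * v := by
    decide
  obtain ⟨x, y⟩ := a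
  rcases key x y with h | ⟨u, v, rfl, rfl⟩
  · left
    rw [← h]
    ring
  · exact Or.inr ⟨⟨u, v⟩, by ext <;> simp [two_mul]⟩

theorem false_of_anisotropic_of_coeff_sq {K σ : Type*} [Field K] [CharP K 2] [Fintype σ]
    (hcard : 0 < Fintype.card σ) (heven : Even (Fintype.card σ)) {ω : K}
    (hω : ω ^ 2 + ω + 1 = 0) (f : MvPolynomial σ K) (hf : f.totalDegree ≤ Fintype.card σ)
    (hco : ∀ m, f.coeff m ^ 2 = f.coeff m) (h0 : MvPolynomial.eval 0 f = 0)
    (hz : ∀ x, MvPolynomial.eval x f = 0 → x = 0) : False := by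
  have hK2 : (2 : K) = 0 := CharTwo.two_eq_zero
  have hω3 : ω ^ 3 = 1 := by linear_combination (ω - 1) * hω
  have hω0 : ω ≠ 0 := fun h => by simp [h] at hω
  let : Algebra (ZMod 4) K := ZMod.algebra' K 2 (by norm_num)
  let φ : QuadraticAlgebra (ZMod 4) (-1) (-1) →ₐ[ZMod 4] K := QuadraticAlgebra.lift ⟨ω, by
    simp only [neg_smul, one_smul]
    linear_combination hω⟩
  let w : QuadraticAlgebra (ZMod 4) (-1) (-1) := ⟨0, 1⟩
  have hφw : φ w = ω := by simp [φ, w]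
  have hco1 : ∀ m ∈ f.support, f.coeff m = 1 := fun m hm => by
    have h1 := MvPolynomial.mem_support_iff.1 hm
    have h2 := hco m
    rw [sq] at h2
    exact mul_right_cancel₀ h1 (by rw [h2, one_mul])
  have hφG : ∀ z : σ → Fin 4, φ (∑ κ ∈ f.support, ∏ i,
      (![0, 1, w, w ^ 2] : Fin 4 → QuadraticAlgebra (ZMod 4) (-1) (-1)) (z i) ^ κ i) =
      MvPolynomial.eval (fun i => φ ((![0, 1, w, w ^ 2] :
        Fin 4 → QuadraticAlgebra (ZMod 4) (-1) (-1)) (z i))) f := fun z => by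
    rw [MvPolynomial.eval_eq', map_sum]
    refine Finset.sum_congr rfl fun m hm => ?_
    rw [hco1 m hm, one_mul, map_prod]
    simp only [map_pow]
  refine false_of_pow_six_eq_one (A := QuadraticAlgebra (ZMod 4) (-1) (-1)) (w := w) (by decide)
    (by decide) (by rw [sq]; decide) hcard heven f.support (fun κ hκ => ?_) _
    (fun z => rfl) ?_ fun z hz0 => ?_
  · refine le_trans ?_ ((MvPolynomial.le_totalDegree hκ).trans hf)
    rw [Finsupp.sum_fintype _ _ fun _ => rfl]
  · refine Finset.sum_eq_zero fun κ hκ => ?_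
    have hκ0 : κ ≠ 0 := fun h => by
      rw [MvPolynomial.eval_zero, MvPolynomial.constantCoeff_eq] at h0
      exact MvPolynomial.mem_support_iff.1 hκ (h ▸ h0)
    obtain ⟨i, hi⟩ := Finsupp.ne_iff.1 hκ0
    exact Finset.prod_eq_zero (Finset.mem_univ i) (zero_pow hi)
  · refine (quadraticAlgebra_pow_six _).resolve_right ?_
    rintro ⟨b, hb⟩
    have h1 := hφG z
    rw [hb, map_mul, map_ofNat, hK2, zero_mul] at h1
    have h2 := hz _ h1.symm
    refine hz0 (funext fun i => ?_)
    have h3 := congrFun h2 i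
    by_contra hi
    have hall : ∀ c : Fin 4, c ≠ 0 → φ ((![0, 1, w, w ^ 2] :
        Fin 4 → QuadraticAlgebra (ZMod 4) (-1) (-1)) c) ≠ 0 := by
      intro c hc
      fin_cases c
      · exact absurd rfl hc
      · simp
      · simpa [hφw] using hω0
      · simpa [hφw] using hω0
    exact hall _ hi h3

theorem MvPolynomial.totalDegree_bind₁_le_of_linear {R σ τ : Type*} [CommSemiring R]
    (g : σ → MvPolynomial τ R) (hg : ∀ i, (g i).totalDegree ≤ 1) (f : MvPolynomial σ R) :
    (bind₁ g f).totalDegree ≤ f.totalDegree := by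
  conv_lhs => rw [f.as_sum, map_sum]
  refine totalDegree_finsetSum_le fun m hm => ?_
  rw [bind₁_monomial]
  refine (totalDegree_mul _ _).trans ?_
  rw [totalDegree_C, zero_add]
  refine (totalDegree_finsetProd _ _).trans (le_trans ?_ (le_totalDegree hm))
  refine Finset.sum_le_sum fun i _ => (totalDegree_pow _ _).trans ?_
  exact (Nat.mul_le_mul_left _ (hg i)).trans (mul_one _).le

theorem false_of_even_of_anisotropic {n : ℕ} [NeZero n] (hn2 : 2 ≤ n) (heven : Even n)
    {K : Type*} [Field K] [Fintype K] [CharP K 2] [ExpChar K 2] (hK : Fintype.card K = 2 ^ n)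
    (f : MvPolynomial (Fin n) K) (htd : f.totalDegree ≤ n) (h0 : MvPolynomial.eval 0 f = 0)
    (hz : ∀ x, MvPolynomial.eval x f = 0 → x = 0)
    (hfs : MvPolynomial.rename (Equiv.addRight (1 : Fin n))
      (MvPolynomial.map (iterateFrobenius K 2 1) f) = f) : False := by
  classical
  obtain ⟨θ, hθ⟩ := IsCyclic.exists_generator (α := Kˣ)
  have hord : orderOf θ = 2 ^ n - 1 := by
    rw [orderOf_eq_card_of_forall_mem_zpowers hθ, Nat.card_eq_fintype_card, Fintype.card_units, hK]
  obtain ⟨ω, hω⟩ : ∃ ω : K, ω ^ 2 + ω + 1 = 0 := by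
    have h3 : 3 ∣ 2 ^ n - 1 := by
      obtain ⟨m, rfl⟩ := heven
      rw [← two_mul, pow_mul]
      exact (by norm_num : 3 ∣ 2 ^ 2 - 1).trans
        (by simpa only [one_pow] using Nat.sub_dvd_pow_sub_pow (2 ^ 2) 1 m)
    obtain ⟨m, hm⟩ := h3
    have hpos : 2 ^ 2 ≤ 2 ^ n := Nat.pow_le_pow_right (by norm_num) hn2
    have h1 : θ ^ m ≠ 1 := pow_ne_one_of_lt_orderOf (by omega) (by omega)
    have h2 : (θ ^ m) ^ 3 = 1 := by
      rw [← pow_mul, mul_comm, ← hm, ← hord, pow_orderOf_eq_one]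
    refine ⟨((θ ^ m : Kˣ) : K), ?_⟩
    have h4 : (((θ ^ m : Kˣ) : K)) ^ 3 = 1 := by
      rw [← Units.val_pow_eq_pow_val, h2, Units.val_one]
    have h5 : ((θ ^ m : Kˣ) : K) - 1 ≠ 0 := fun h => h1 (Units.ext (sub_eq_zero.1 h))
    exact mul_left_cancel₀ h5 (by linear_combination h4)
  let L : Fin n → MvPolynomial (Fin n) K := fun j =>
    ∑ i : Fin n, MvPolynomial.C (((θ : K) ^ (i : ℕ)) ^ 2 ^ (j : ℕ)) * MvPolynomial.X i
  have hL : ∀ j, MvPolynomial.map (iterateFrobenius K 2 1) (L j) = L (j + 1) := fun j => by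
    simp only [L, map_sum, map_mul, MvPolynomial.map_C, MvPolynomial.map_X, iterateFrobenius_def,
      ← pow_mul (_ ^ _), pow_one, ← pow_succ]
    refine Finset.sum_congr rfl fun i _ => ?_
    congr 2
    by_cases hj : (j : ℕ) + 1 < n
    · rw [Fin.val_add_one_of_lt' hj]
    · have hj1 : j + 1 = 0 := by
        ext
        rw [Fin.val_add, Fin.val_zero, Fin.val_one', Nat.add_mod_mod, show (j : ℕ) + 1 = n by omega,
          Nat.mod_self]
      rw [hj1, show (j : ℕ) + 1 = n by omega, ← hK, FiniteField.pow_card]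
      simp
  let f₀ := MvPolynomial.bind₁ L f
  have hf₀ : MvPolynomial.map (iterateFrobenius K 2 1) f₀ = f₀ := by
    rw [MvPolynomial.map_bind₁]
    conv_rhs => rw [show f₀ = MvPolynomial.bind₁ L f from rfl, ← hfs, MvPolynomial.bind₁_rename]
    congr 2
    exact funext hL
  have heval : ∀ x, MvPolynomial.eval x f₀ =
      MvPolynomial.eval (fun j => MvPolynomial.eval x (L j)) f := fun x => by
    simp only [f₀, MvPolynomial.eval, MvPolynomial.eval₂Hom_bind₁]
  have hevalL : ∀ x j, MvPolynomial.eval x (L j) =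
      (Matrix.vandermonde fun j : Fin n => (θ : K) ^ 2 ^ (j : ℕ)).mulVec x j := fun x j => by
    simp only [L, map_sum, map_mul, MvPolynomial.eval_C, MvPolynomial.eval_X, Matrix.mulVec,
      dotProduct, Matrix.vandermonde_apply, ← pow_mul, mul_comm]
  have hdet : (Matrix.vandermonde fun j : Fin n => (θ : K) ^ 2 ^ (j : ℕ)).det ≠ 0 := by
    refine Matrix.det_vandermonde_ne_zero_iff.2 fun i j hij => ?_
    have hlt : ∀ i : Fin n, 2 ^ (i : ℕ) < orderOf θ := fun i => by
      obtain ⟨m, rfl⟩ : ∃ m, n = m + 2 := ⟨n - 2, by omega⟩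
      have h1 : 2 ^ (i : ℕ) ≤ 2 ^ (m + 1) := Nat.pow_le_pow_right (by norm_num) (by omega)
      have h2 : 0 < 2 ^ m := by positivity
      rw [hord]
      rw [pow_succ] at h1
      rw [pow_succ, pow_succ]
      omega
    have h1 : θ ^ 2 ^ (i : ℕ) = θ ^ 2 ^ (j : ℕ) := Units.ext (by simpa using hij)
    exact Fin.ext (Nat.pow_right_injective le_rfl
      (pow_injOn_Iio_orderOf (Set.mem_Iio.2 (hlt i)) (Set.mem_Iio.2 (hlt j)) h1))
  refine false_of_anisotropic_of_coeff_sq (σ := Fin n) (by simp; omega) (by simpa using heven) hω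
    f₀ (le_trans (MvPolynomial.totalDegree_bind₁_le_of_linear L (fun j => ?_) f)
      (by simpa using htd))
    (fun m => ?_) ?_ fun x hx => ?_
  · refine MvPolynomial.totalDegree_finsetSum_le fun i _ =>
      (MvPolynomial.totalDegree_mul _ _).trans ?_
    rw [MvPolynomial.totalDegree_C, zero_add]
    exact (MvPolynomial.totalDegree_X i).le
  · have h1 := congrArg (MvPolynomial.coeff m) hf₀
    rwa [MvPolynomial.coeff_map, iterateFrobenius_def, pow_one] at h1
  · rw [heval]
    have h1 : (fun j => MvPolynomial.eval 0 (L j)) = 0 := funext fun j => by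
      rw [hevalL, Matrix.mulVec_zero]
    rwa [h1]
  · rw [heval] at hx
    have h1 := hz _ hx
    refine Matrix.eq_zero_of_mulVec_eq_zero hdet (funext fun j => ?_)
    rw [← hevalL]
    exact congrFun h1 j

theorem exists_det_eq_zero_of_large {p k n : ℕ} (hp : p.Prime) (hk : 0 < k) [NeZero n]
    (hn : 2 ≤ n) {K : Type*} [Field K] [Fintype K] [CharP K p]
    (hK : Fintype.card K = (p ^ k) ^ n) (M : Matrix (ZMod n) (ZMod n) K)
    (hbig : 125 * n ^ 13 < (p ^ k) ^ (3 * n)) :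
    ∃ x : Fin n → K, x ≠ 0 ∧
      (∑ j : Fin n, x j • (sigmaTwist (p ^ k))^[(j : ℕ)] M).det = 0 := by
  have : Fact p.Prime := ⟨hp⟩
  have : ExpChar K p := .prime hp
  rcases exists_numeric hp hk hn hbig with ⟨rfl, rfl, rfl⟩ | ⟨r, e, hre, hP, hs, h⟩
  · by_contra! hne
    refine false_of_even_of_anisotropic hn (by decide) (by simpa using hK)
      (twistDet (2 ^ 1) M) (totalDegree_twistDet_le _ M) ?_ (fun x hx => ?_)
      (rename_map_twistDet hK M)
    · rw [eval_twistDet]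
      simp
    · by_contra hx0
      exact hne x hx0 (by rwa [eval_twistDet] at hx)
  · obtain ⟨α, h1, h2, h3, h4⟩ := numeric_stepanov hn hP hs h
    refine exists_det_eq_zero hn hK M ?_ (r := r) (e := e) ?_ h1 hP h2 h3 h4
    · by_contra! hle
      rw [hK] at hle
      have h5 : ((p ^ k) ^ n) ^ 3 ≤ (n ^ 4) ^ 3 := Nat.pow_le_pow_left hle 3
      rw [← pow_mul, ← pow_mul n, mul_comm n 3] at h5
      have h6 : n ^ 12 ≤ n ^ 13 := Nat.pow_le_pow_right (by omega) (by norm_num)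
      simp only [Nat.reduceMul] at h5
      omega
    · rw [hK, ← pow_mul, ← pow_add, hre]

/-- If the multiplication `x ∘ y = ∑ c_{ij} x^{qⁱ} y^{qʲ}` defined by `M` has no zero
divisors (a finite semifield) and `q` is large enough, then there is a nonzero tuple
`x` with `det (∑ xⱼ • M^{[σʲ]}) = 0`, and this tuple is not of the form
`(α, α^q, …, α^{q^{n-1}})`. -/
theorem stmt3 (q n : ℕ) [NeZero n] (hn : 2 ≤ n)
    (hq : ∃ p k : ℕ, p.Prime ∧ 0 < k ∧ q = p ^ k)
    (K : Type*) [Field K] [Fintype K] (hK : Fintype.card K = q ^ n)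
    (M : Matrix (ZMod n) (ZMod n) K)
    (hsf : ∀ x y : K,
      (∑ i : ZMod n, ∑ j : ZMod n, M i j * x ^ q ^ i.val * y ^ q ^ j.val) = 0 →
        x = 0 ∨ y = 0)
    (hbig : (q : ℝ) ^ (n * (n - 1)) >
      ((n : ℝ) - 1) * ((n : ℝ) - 2) * (q : ℝ) ^ ((n : ℝ) * ((n : ℝ) - 3 / 2)) +
        5 * (n : ℝ) ^ ((13 : ℝ) / 3) * (q : ℝ) ^ (n * (n - 2))) :
    ∃ x : Fin n → K, x ≠ 0 ∧
      (∑ j : Fin n, x j • (sigmaTwist q)^[(j : ℕ)] M).det = 0 ∧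
      ¬∃ α : K, x = fun j : Fin n => α ^ q ^ (j : ℕ) := by
  obtain ⟨p, k, hp, hk, rfl⟩ := hq
  have hq1 : 1 < p ^ k := Nat.one_lt_pow hk.ne' hp.one_lt
  have : CharP K p := by
    obtain ⟨p', hp'⟩ := CharP.exists K
    obtain ⟨m, hp'p, hm⟩ := FiniteField.card K p'
    have hdvd : p' ∣ p := hp'p.dvd_of_dvd_pow (n := k * n) (by
      rw [pow_mul, ← hK, hm]
      exact dvd_pow_self p' m.ne_zero)
    rwa [← (Nat.prime_dvd_prime_iff_eq hp'p hp).1 hdvd]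
  have : ExpChar K p := .prime hp
  obtain ⟨x, hx0, hx⟩ := exists_det_eq_zero_of_large hp hk hn hK M (lt_pow_of_large hn hq1 hbig)
  refine ⟨x, hx0, hx, ?_⟩
  rintro ⟨α, rfl⟩
  refine det_sum_frobenius_smul_ne_zero hq1 hK M hsf (α := α) ?_ hx
  rintro rfl
  exact hx0 (funext fun j => zero_pow (pow_pos (by omega) _).ne')
end

section
/- Let v ∈ F⁴ be nonzero and suppose v is not an F-scalar multiple of any Σ-vector. Then the following two conditions are equivalent: (a) there exist two F-linearly independent Σ-vectors u, w with v ∈ span_F{u, w} such that Q(su + tw) ≠ 0 for all (s,t) ∈ 𝔽_q² \ {(0,0)} (v lies on an extended Σ-line external to Q₀); (b) for every Σ-vector r with Q(r) = 0 one has h(v, r) ≠ 0 (v lies on no extended tangent plane of Q₀). -/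
/-- `Q(α,β,γ,δ) = αδ - βγ`, the quadratic form of the hyperbolic quadric. -/
def Qf {F : Type*} [Field F] (v : Fin 4 → F) : F := v 0 * v 3 - v 1 * v 2

/-- `H(α,β,γ,δ) = α^{q+1} - β^{q+1} - γ^{q+1} + δ^{q+1}`, the Hermitian form. -/
def Hf (q : ℕ) {F : Type*} [Field F] (v : Fin 4 → F) : F :=
  v 0 ^ (q + 1) - v 1 ^ (q + 1) - v 2 ^ (q + 1) + v 3 ^ (q + 1)

/-- `v = (α,β,γ,δ)` is nonsingular if `(αz + δ^q z^q)x + (γz + β^q z^q)x^q ≠ 0`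
for all nonzero `x, z`. -/
def Nonsingular (q : ℕ) {F : Type*} [Field F] (v : Fin 4 → F) : Prop :=
  ∀ x z : F, x ≠ 0 → z ≠ 0 →
    (v 0 * z + v 3 ^ q * z ^ q) * x + (v 2 * z + v 1 ^ q * z ^ q) * x ^ q ≠ 0

/-- `Δ(v) = H(v)² - 4·Q(v)^{q+1}`. -/
def Deltaf (q : ℕ) {F : Type*} [Field F] (v : Fin 4 → F) : F :=
  Hf q v ^ 2 - 4 * Qf v ^ (q + 1)

/-- A Σ-vector: a nonzero vector of the form `(α, β, β^q, α^q)`. -/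
def IsSigmaVec (q : ℕ) {F : Type*} [Field F] (v : Fin 4 → F) : Prop :=
  v ≠ 0 ∧ ∃ α β : F, v = ![α, β, β ^ q, α ^ q]

/-- The sesquilinear form `h(u,v) = u₁v₁^q - u₂v₂^q - u₃v₃^q + u₄v₄^q`. -/
def hForm (q : ℕ) {F : Type*} [Field F] (u v : Fin 4 → F) : F :=
  u 0 * v 0 ^ q - u 1 * v 1 ^ q - u 2 * v 2 ^ q + u 3 * v 3 ^ q

/-- The one-dimensional `F`-subspace (as a set) spanned by `v`. -/
def Fline {F : Type*} [Field F] (v : Fin 4 → F) : Set (Fin 4 → F) :=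
  {x | ∃ a : F, x = a • v}

/-- The number of one-dimensional `𝔽_q`-subspaces `⟨(s,t)⟩` of `𝔽_q²` with
`Q(s·u + t·w) = 0`. -/
noncomputable def tangentCount (q : ℕ) {F : Type*} [Field F] (u w : Fin 4 → F) : ℕ :=
  Set.ncard {L : Set (F × F) | ∃ s t : F, s ^ q = s ∧ t ^ q = t ∧ (s, t) ≠ (0, 0) ∧
    Qf (fun i => s * u i + t * w i) = 0 ∧
    L = {p : F × F | ∃ e : F, e ^ q = e ∧ p = (e * s, e * t)}}

/-- `Z₁`: the set of `ξ ∉ {0, 1, -1}` such that `1 - ξ⁻²` is a nonzero square of `𝔽_q`. -/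
def Zone (q : ℕ) (F : Type*) [Field F] : Set F :=
  {ξ | ξ ≠ 0 ∧ ξ ≠ 1 ∧ ξ ≠ -1 ∧ ∃ s : F, s ^ q = s ∧ s ≠ 0 ∧ 1 - (ξ ^ 2)⁻¹ = s ^ 2}

/-- `Z₂`: the set of `ξ ≠ 0` such that `1 - ξ⁻²` is a nonzero nonsquare of `𝔽_q`. -/
def Ztwo (q : ℕ) (F : Type*) [Field F] : Set F :=
  {ξ | ξ ≠ 0 ∧ (1 - (ξ ^ 2)⁻¹) ^ q = 1 - (ξ ^ 2)⁻¹ ∧ 1 - (ξ ^ 2)⁻¹ ≠ 0 ∧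
    ¬∃ s : F, s ^ q = s ∧ 1 - (ξ ^ 2)⁻¹ = s ^ 2}

theorem hForm_smul_add_smul (q : ℕ) {F : Type*} [Field F] (s t : F) (u w r : Fin 4 → F) :
    hForm q (s • u + t • w) r = s * hForm q u r + t * hForm q w r := by
  simp only [hForm, Pi.add_apply, Pi.smul_apply, smul_eq_mul]
  ring

/-- The `q`-power map on a field with `q²` elements is an involutive ring homomorphism. -/
theorem exists_involutive_powHom {q : ℕ} (hq : ∃ p k : ℕ, p.Prime ∧ 0 < k ∧ q = p ^ k)
    {F : Type*} [Field F] [Fintype F] (hF : Fintype.card F = q ^ 2) :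
    ∃ σ : F →+* F, (∀ x, x ^ q = σ x) ∧ ∀ x, σ (σ x) = x := by
  obtain ⟨p, k, hp, hk, rfl⟩ := hq
  have : Fact p.Prime := ⟨hp⟩
  have : CharP F p := charP_of_card_eq_prime_pow (f := k * 2) (by rw [hF, pow_mul])
  refine ⟨iterateFrobenius F p k, fun x => (iterateFrobenius_def p k x).symm, fun x => ?_⟩
  rw [iterateFrobenius_def, iterateFrobenius_def, ← pow_mul, ← sq, ← hF, FiniteField.pow_card]

theorem two_ne_zero_of_odd_card {q : ℕ} (hodd : Odd q) {F : Type*} [Field F] [Fintype F]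
    (hF : Fintype.card F = q ^ 2) : (2 : F) ≠ 0 := by
  intro h2
  have h : ((q ^ 2 : ℕ) : F) = 0 := by rw [← hF, FiniteField.cast_card_eq_zero]
  obtain ⟨m, rfl⟩ := hodd
  push_cast at h
  rw [h2] at h
  simp at h

theorem exists_ne_zero_map_eq_neg {q : ℕ} (hq : 1 < q) {F : Type*} [Field F] [Fintype F]
    (hF : Fintype.card F = q ^ 2) {σ : F →+* F} (hσ : ∀ x, x ^ q = σ x)
    (hσσ : ∀ x, σ (σ x) = x) : ∃ θ : F, θ ≠ 0 ∧ σ θ = -θ := by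
  obtain ⟨a, ha⟩ : ∃ a : F, σ a ≠ a := by
    by_contra! h
    have hle := Polynomial.card_le_degree_of_subset_roots
      (p := (Polynomial.X ^ q - Polynomial.X : Polynomial F)) (Z := Finset.univ) (by
        intro x _
        rw [Polynomial.mem_roots (FiniteField.X_pow_card_sub_X_ne_zero F hq)]
        simp [hσ, h])
    rw [FiniteField.X_pow_card_sub_X_natDegree_eq F hq, Finset.card_univ, hF] at hle
    nlinarith
  exact ⟨a - σ a, sub_ne_zero.2 ha.symm, by rw [map_sub, hσσ, neg_sub]⟩

section Involution

variable {q : ℕ} {F : Type*} [Field F] {σ : F →+* F}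

theorem isSigmaVec_iff (hσ : ∀ x, x ^ q = σ x) {r : Fin 4 → F} :
    IsSigmaVec q r ↔ r ≠ 0 ∧ r 2 = σ (r 1) ∧ r 3 = σ (r 0) := by
  refine and_congr_right fun _ => ⟨?_, fun h => ⟨r 0, r 1, ?_⟩⟩
  · rintro ⟨a, b, rfl⟩
    simp [hσ]
  · ext i
    fin_cases i <;> simp [hσ, h.1, h.2]

theorem IsSigmaVec.smul_add_smul (hσ : ∀ x, x ^ q = σ x)
    {u w : Fin 4 → F} (hu : IsSigmaVec q u) (hw : IsSigmaVec q w) {s t : F} (hs : σ s = s)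
    (ht : σ t = t) (h0 : s • u + t • w ≠ 0) : IsSigmaVec q (s • u + t • w) := by
  rw [isSigmaVec_iff hσ] at *
  refine ⟨h0, ?_, ?_⟩ <;> simp [hu, hw, hs, ht]

theorem map_hForm (hσ : ∀ x, x ^ q = σ x) (hσσ : ∀ x, σ (σ x) = x) {u r : Fin 4 → F}
    (hu : IsSigmaVec q u) (hr : IsSigmaVec q r) : σ (hForm q u r) = hForm q u r := by
  rw [isSigmaVec_iff hσ] at hu hr
  simp only [hForm, hσ, hu, hr, hσσ, map_add, map_sub, map_mul]
  ring

/-- A point off the Baer subgeometry that is orthogonal to a `Σ`-vector lies only on extended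
`Σ`-lines orthogonal to it. -/
theorem hForm_eq_zero_of_smul_add_smul (hσ : ∀ x, x ^ q = σ x) (hσσ : ∀ x, σ (σ x) = x)
    {u w r : Fin 4 → F} (hu : IsSigmaVec q u) (hw : IsSigmaVec q w) (hr : IsSigmaVec q r)
    (hli : LinearIndependent F ![u, w]) {l m : F}
    (hns : ¬∃ (a : F) (r : Fin 4 → F), IsSigmaVec q r ∧ l • u + m • w = a • r)
    (h : hForm q (l • u + m • w) r = 0) : hForm q u r = 0 ∧ hForm q w r = 0 := by
  have hBu := map_hForm hσ hσσ hu hr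
  have hBw := map_hForm hσ hσσ hw hr
  rw [hForm_smul_add_smul] at h
  generalize hForm q u r = b at *
  generalize hForm q w r = c at *
  by_contra hbc
  have h0 : c • u + (-b) • w ≠ 0 := fun h0 => by
    obtain ⟨hc, hb⟩ := LinearIndependent.pair_iff.1 hli _ _ h0
    exact hbc ⟨neg_eq_zero.1 hb, hc⟩
  have hsig := hu.smul_add_smul hσ hw hBw (t := -b) (by rw [map_neg, hBu]) h0
  by_cases hc : c = 0
  · have hb : b ≠ 0 := fun hb => hbc ⟨hb, hc⟩
    refine hns ⟨-(m / b), _, hsig, ?_⟩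
    have hl : l = 0 := by simpa [hc, hb] using h
    rw [hc, hl]
    ext i
    simp
    field_simp
  · refine hns ⟨l / c, _, hsig, ?_⟩
    have hm : m = -(l * b / c) := by
      field_simp
      linear_combination h
    rw [hm]
    ext i
    simp
    field_simp

theorem sigmaVec_apply_ne_zero (hσ : ∀ x, x ^ q = σ x) {r : Fin 4 → F}
    (hr : IsSigmaVec q r) (hQ : Qf r = 0) : r 0 ≠ 0 ∧ r 1 ≠ 0 := by
  obtain ⟨h0, h2, h3⟩ := (isSigmaVec_iff hσ).1 hr
  rw [Qf, h2, h3] at hQ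
  by_contra h
  have h01 : r 0 = 0 ∧ r 1 = 0 := by
    by_cases ha : r 0 = 0
    · simp_all
    · by_cases hb : r 1 = 0
      · simp_all
      · exact absurd ⟨ha, hb⟩ h
  apply h0
  ext i
  fin_cases i <;> simp [h2, h3, h01]

/-- A line in the tangent plane at a singular `Σ`-vector `r` has a singular point. -/
theorem exists_Qf_eq_zero_of_orthogonal (hσ : ∀ x, x ^ q = σ x) (hσσ : ∀ x, σ (σ x) = x)
    {u w r : Fin 4 → F} (hu : IsSigmaVec q u) (hw : IsSigmaVec q w) (hr : IsSigmaVec q r)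
    (hQ : Qf r = 0) (hur : hForm q u r = 0) (hwr : hForm q w r = 0) :
    ∃ s t : F, σ s = s ∧ σ t = t ∧ (s, t) ≠ (0, 0) ∧ Qf (s • u + t • w) = 0 := by
  obtain ⟨ha, hb⟩ := sigmaVec_apply_ne_zero hσ hr hQ
  obtain ⟨-, hr2, hr3⟩ := (isSigmaVec_iff hσ).1 hr
  obtain ⟨-, hu2, hu3⟩ := (isSigmaVec_iff hσ).1 hu
  obtain ⟨-, hw2, hw3⟩ := (isSigmaVec_iff hσ).1 hw
  simp only [hForm, hσ, hr2, hr3, hu2, hu3, hw2, hw3, hσσ] at hur hwr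
  rw [Qf, hr2, hr3] at hQ
  have hsa : σ (r 0) ≠ 0 := (map_ne_zero σ).2 ha
  have key : ∀ s t : F, σ s = s → σ t = t →
      (s * u 0 + t * w 0) * r 1 = (s * u 1 + t * w 1) * r 0 → Qf (s • u + t • w) = 0 := by
    intro s t hs ht h
    have h' := congrArg σ h
    simp only [map_mul, map_add, hs, ht] at h'
    simp only [Qf, Pi.add_apply, Pi.smul_apply, smul_eq_mul, hu2, hu3, hw2, hw3]
    have hN : r 0 * σ (r 0) ≠ 0 := mul_ne_zero ha hsa
    apply mul_left_cancel₀ hN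
    linear_combination (s * u 0 + t * w 0) * (s * σ (u 0) + t * σ (w 0)) * hQ
      + (s * σ (u 0) + t * σ (w 0)) * σ (r 1) * h + (s * u 1 + t * w 1) * r 0 * h'
  have hp : ∀ x y : F, x * σ (r 0) - y * σ (r 1) - σ y * r 1 + σ x * r 0 = 0 →
      (x * r 1 - y * r 0) * σ (r 1) = (x * σ (r 0) - y * σ (r 1)) * r 0 ∧
      σ (x * σ (r 0) - y * σ (r 1)) = -(x * σ (r 0) - y * σ (r 1)) := by
    intro x y h
    constructor
    · linear_combination -x * hQ
    · simp only [map_sub, map_mul, hσσ]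
      linear_combination h
  obtain ⟨hcu, hpu⟩ := hp (u 0) (u 1) hur
  obtain ⟨hcw, hpw⟩ := hp (w 0) (w 1) hwr
  generalize u 0 * σ (r 0) - u 1 * σ (r 1) = pu at *
  generalize w 0 * σ (r 0) - w 1 * σ (r 1) = pw at *
  have hsb : σ (r 1) ≠ 0 := (map_ne_zero σ).2 hb
  by_cases h0 : pw = 0
  · refine ⟨0, 1, map_zero σ, map_one σ, by simp, key _ _ (map_zero σ) (map_one σ) ?_⟩
    apply mul_left_cancel₀ hsb
    linear_combination hcw + r 0 * h0
  · have hs : σ (pw * pw) = pw * pw := by rw [map_mul, hpw]; ring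
    have ht : σ (-(pu * pw)) = -(pu * pw) := by rw [map_neg, map_mul, hpu, hpw]; ring
    refine ⟨pw * pw, -(pu * pw), hs, ht, by simp [h0], key _ _ hs ht ?_⟩
    apply mul_left_cancel₀ hsb
    linear_combination pw * pw * hcu - pu * pw * hcw

/-- On a ruling line through a singular `Σ`-vector `m` there is a `Σ`-vector orthogonal
to a given `Σ`-vector `n`. -/
theorem exists_isSigmaVec_orthogonal (hσ : ∀ x, x ^ q = σ x) (hσσ : ∀ x, σ (σ x) = x)
    {θ : F} (hθ : θ ≠ 0) (hσθ : σ θ = -θ) {m n : Fin 4 → F} (hm : IsSigmaVec q m)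
    (hn : IsSigmaVec q n) (hQ : Qf m = 0) :
    ∃ r, IsSigmaVec q r ∧ Qf r = 0 ∧ hForm q m r = 0 ∧ hForm q n r = 0 := by
  obtain ⟨ha, -⟩ := sigmaVec_apply_ne_zero hσ hm hQ
  obtain ⟨-, hm2, hm3⟩ := (isSigmaVec_iff hσ).1 hm
  obtain ⟨-, hn2, hn3⟩ := (isSigmaVec_iff hσ).1 hn
  rw [Qf, hm2, hm3] at hQ
  obtain ⟨z, hz, hk⟩ : ∃ z : F, z ≠ 0 ∧
      (n 0 * σ (m 0) - n 1 * σ (m 1)) * σ z + σ (n 0 * σ (m 0) - n 1 * σ (m 1)) * z = 0 := by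
    generalize n 0 * σ (m 0) - n 1 * σ (m 1) = k
    by_cases h0 : k = 0
    · exact ⟨1, one_ne_zero, by simp [h0]⟩
    · have hsk : σ k ≠ 0 := (map_ne_zero σ).2 h0
      refine ⟨θ / σ k, div_ne_zero hθ hsk, ?_⟩
      rw [map_div₀, hσσ, hσθ]
      field_simp
      ring
  refine ⟨![m 0 * z, m 1 * z, σ (m 1 * z), σ (m 0 * z)],
    (isSigmaVec_iff hσ).2 ⟨fun h => mul_ne_zero ha hz (congrFun h 0), rfl, rfl⟩, ?_, ?_, ?_⟩
  · simp [Qf]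
    linear_combination z * σ z * hQ
  · simp [hForm, hσ, hσσ, hm2, hm3]
    linear_combination (z + σ z) * hQ
  · simp only [map_sub, map_mul, hσσ] at hk
    simp [hForm, hσ, hσσ, hn2, hn3]
    linear_combination hk

end Involution

/-- A point not in the Baer subgeometry lies on an extended `Σ`-line external to `Q₀`
iff it lies on no extended tangent plane of `Q₀`. -/
theorem stmt9 (q : ℕ) (hq : ∃ p k : ℕ, p.Prime ∧ 0 < k ∧ q = p ^ k) (hodd : Odd q)
    (F : Type*) [Field F] [Fintype F] (hF : Fintype.card F = q ^ 2)
    (v : Fin 4 → F) (hv : v ≠ 0)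
    (hns : ¬∃ (a : F) (r : Fin 4 → F), IsSigmaVec q r ∧ v = a • r) :
    (∃ u w : Fin 4 → F, IsSigmaVec q u ∧ IsSigmaVec q w ∧
        LinearIndependent F ![u, w] ∧
        v ∈ Submodule.span F {u, w} ∧
        ∀ s t : F, s ^ q = s → t ^ q = t → (s, t) ≠ (0, 0) →
          Qf (fun i => s * u i + t * w i) ≠ 0) ↔
      (∀ r : Fin 4 → F, IsSigmaVec q r → Qf r = 0 → hForm q v r ≠ 0) := by
  obtain ⟨σ, hσ, hσσ⟩ := exists_involutive_powHom hq hF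
  constructor
  · rintro ⟨u, w, hu, hw, hli, hvs, hext⟩ r hr hQ hvr
    obtain ⟨l, m, rfl⟩ := Submodule.mem_span_pair.1 hvs
    obtain ⟨hur, hwr⟩ := hForm_eq_zero_of_smul_add_smul hσ hσσ hu hw hr hli hns hvr
    obtain ⟨s, t, hs, ht, hst, h⟩ :=
      exists_Qf_eq_zero_of_orthogonal hσ hσσ hu hw hr hQ hur hwr
    exact hext s t ((hσ s).trans hs) ((hσ t).trans ht) hst h
  · intro hb
    have h1q : 1 < q := by
      obtain ⟨p, k, hp, hk, rfl⟩ := hq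
      exact Nat.one_lt_pow hk.ne' hp.one_lt
    obtain ⟨θ, hθ, hσθ⟩ := exists_ne_zero_map_eq_neg h1q hF hσ hσσ
    have h2 := two_ne_zero_of_odd_card hodd hF
    set u : Fin 4 → F :=
      ![v 0 + σ (v 3), v 1 + σ (v 2), v 2 + σ (v 1), v 3 + σ (v 0)] with hu_def
    set w : Fin 4 → F := ![θ * (v 0 - σ (v 3)), θ * (v 1 - σ (v 2)),
      θ * (v 2 - σ (v 1)), θ * (v 3 - σ (v 0))] with hw_def
    have hvuw : v = (2⁻¹ : F) • u + (2⁻¹ * θ⁻¹) • w := by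
      ext i
      fin_cases i <;> simp [hu_def, hw_def] <;> field_simp <;> ring
    have hu_sig : u ≠ 0 → IsSigmaVec q u := fun h =>
      (isSigmaVec_iff hσ).2 ⟨h, by simp [hu_def, hσσ, add_comm], by
        simp [hu_def, hσσ, add_comm]⟩
    have hw_sig : w ≠ 0 → IsSigmaVec q w := fun h =>
      (isSigmaVec_iff hσ).2 ⟨h, by simp [hw_def, hσσ, hσθ, ← mul_neg], by
        simp [hw_def, hσσ, hσθ, ← mul_neg]⟩
    clear_value u w
    have hu0 : u ≠ 0 := by
      intro h
      have hvw : v = (2⁻¹ * θ⁻¹) • w := by simpa [h] using hvuw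
      exact hns ⟨_, w, hw_sig fun h' => hv (by simpa [h'] using hvw), hvw⟩
    have hu := hu_sig hu0
    have hli : LinearIndependent F ![u, w] := by
      refine (LinearIndependent.pair_iff' hu0).2 fun a ha => hns ⟨2⁻¹ + 2⁻¹ * θ⁻¹ * a, u, hu, ?_⟩
      rw [hvuw, ← ha, smul_smul, add_smul]
    have hw := hw_sig (hli.ne_zero 1)
    refine ⟨u, w, hu, hw, hli, Submodule.mem_span_pair.2 ⟨_, _, hvuw.symm⟩, ?_⟩
    intro s t hs ht hst hQ
    have hm0 : s • u + t • w ≠ 0 := fun h => hst (by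
      obtain ⟨rfl, rfl⟩ := LinearIndependent.pair_iff.1 hli _ _ h
      rfl)
    have hm := hu.smul_add_smul hσ hw ((hσ s).symm.trans hs) ((hσ t).symm.trans ht) hm0
    by_cases ht0 : t = 0
    · have hs0 : s ≠ 0 := fun h => hst (by rw [h, ht0])
      obtain ⟨r, hr, hQr, hmr, hwr⟩ := exists_isSigmaVec_orthogonal hσ hσσ hθ hσθ hm hw hQ
      rw [hForm_smul_add_smul, hwr, mul_zero, add_zero] at hmr
      have hur := (mul_eq_zero.1 hmr).resolve_left hs0
      exact hb r hr hQr (by rw [hvuw, hForm_smul_add_smul, hur, hwr]; ring)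
    · obtain ⟨r, hr, hQr, hmr, hur⟩ := exists_isSigmaVec_orthogonal hσ hσσ hθ hσθ hm hu hQ
      rw [hForm_smul_add_smul, hur, mul_zero, zero_add] at hmr
      have hwr := (mul_eq_zero.1 hmr).resolve_left ht0
      exact hb r hr hQr (by rw [hvuw, hForm_smul_add_smul, hur, hwr]; ring)
end
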